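/- There exist universal constants c_1, c_2 > 0 such that for every integer d ≥ 1, every convex body B in ℝ^d, and every real number α ≥ 0, one has g_α(B) ≤ c_1 · 4^d · e^{−c_2 √d}. -/

import Mathlib

open Set MeasureTheory Pointwise

/-- A convex body: a compact convex set with nonempty interior. -/
def IsConvexBody {E : Type*} [NormedAddCommGroup E] [NormedSpace ℝ E] (B : Set E) : Prop :=
  Convex ℝ B ∧ IsCompact B ∧ (interior B).Nonempty

/-- `gCov α B` is the infimum of `∑ λᵢ^α` over all finite translative coverings of `B`
by homothets `xᵢ + λᵢ • B` with `λᵢ ∈ (0,1)`. -/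
noncomputable def gCov {E : Type*} [NormedAddCommGroup E] [NormedSpace ℝ E]
    (α : ℝ) (B : Set E) : ℝ :=
  sInf {s : ℝ | ∃ (k : ℕ) (lam : Fin k → ℝ) (x : Fin k → E),
    (∀ i, lam i ∈ Set.Ioo (0 : ℝ) 1) ∧
    B ⊆ (⋃ i, x i +ᵥ lam i • B) ∧
    s = ∑ i, lam i ^ α}

/-- One-dimensional Brunn-Minkowski for midpoints. -/
theorem volume_add_le_two_mul_of_midpoint {A B C : Set ℝ} (hA : MeasurableSet A)
    (hB : MeasurableSet B) (hAn : A.Nonempty) (hBn : B.Nonempty)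
    (hC : ∀ a ∈ A, ∀ b ∈ B, (1 / 2 : ℝ) * (a + b) ∈ C) :
    volume A + volume B ≤ 2 * volume C := by
  have key : ∀ K ⊆ A, IsCompact K → K.Nonempty → ∀ L ⊆ B, IsCompact L → L.Nonempty →
      volume K + volume L ≤ 2 * volume C := by
    intro K hKA hK hKn L hLB hL hLn
    obtain ⟨a, ha, hamax⟩ := hK.exists_isGreatest hKn
    obtain ⟨b, hb, hbmin⟩ := hL.exists_isLeast hLn
    have hL' : MeasurableSet ((fun x => a + x) '' L) :=
      (hL.image (by fun_prop)).measurableSet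
    have h1 : volume ((fun x => x + b) '' K ∪ (fun x => a + x) '' L) =
        volume K + volume L := by
      rw [measure_union₀ hL'.nullMeasurableSet]
      · simp
      · refine measure_mono_null (t := {a + b}) ?_ (by simp)
        rintro x ⟨⟨u, hu, rfl⟩, ⟨v, hv, h⟩⟩
        have := hamax hu
        have := hbmin hv
        simp only at h
        simp only [mem_singleton_iff]
        linarith
    have h2 : (fun x => x + b) '' K ∪ (fun x => a + x) '' L ⊆ (2 : ℝ) • C := by
      rintro x (⟨u, hu, rfl⟩ | ⟨v, hv, rfl⟩)
      · exact ⟨_, hC u (hKA hu) b (hLB hb), by simp⟩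
      · exact ⟨_, hC a (hKA ha) v (hLB hv), by simp⟩
    rw [← h1]
    refine (measure_mono h2).trans ?_
    rw [Measure.addHaar_smul]
    simp
  obtain ⟨a0, ha0⟩ := hAn
  obtain ⟨b0, hb0⟩ := hBn
  by_contra! hlt
  rcases eq_or_ne (volume A) 0 with hA0 | hA0
  · rw [hA0, zero_add] at hlt
    obtain ⟨L, hLB, hL, hqL⟩ := hB.exists_lt_isCompact hlt
    have hLn : L.Nonempty := nonempty_of_measure_ne_zero (ne_bot_of_gt hqL)
    have := key {a0} (by simpa using ha0) isCompact_singleton (by simp) L hLB hL hLn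
    simp only [measure_singleton, zero_add] at this
    exact absurd (hqL.trans_le this) (lt_irrefl _)
  rcases eq_or_ne (volume B) 0 with hB0 | hB0
  · rw [hB0, add_zero] at hlt
    obtain ⟨K, hKA, hK, hpK⟩ := hA.exists_lt_isCompact hlt
    have hKn : K.Nonempty := nonempty_of_measure_ne_zero (ne_bot_of_gt hpK)
    have := key K hKA hK hKn {b0} (by simpa using hb0) isCompact_singleton (by simp)
    simp only [measure_singleton, add_zero] at this
    exact absurd (hpK.trans_le this) (lt_irrefl _)
  obtain ⟨p, hp, q, hq, hpq⟩ := ENNReal.exists_lt_add_of_lt_add hlt hA0 hB0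
  refine hpq.not_ge ?_
  obtain ⟨K, hKA, hK, hpK⟩ := hA.exists_lt_isCompact hp
  obtain ⟨L, hLB, hL, hqL⟩ := hB.exists_lt_isCompact hq
  have hKn : K.Nonempty := nonempty_of_measure_ne_zero (ne_bot_of_gt hpK)
  have hLn : L.Nonempty := nonempty_of_measure_ne_zero (ne_bot_of_gt hqL)
  exact (add_le_add hpK.le hqL.le).trans (key K hKA hK hKn L hLB hL hLn)

theorem lintegral_eq_lintegral_meas_ofReal_lt {f : ℝ → ENNReal} (hf : Measurable f)
    (hf1 : ∀ x, f x ≤ 1) :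
    ∫⁻ x, f x = ∫⁻ t in Ioo (0 : ℝ) 1, volume {x | ENNReal.ofReal t < f x} := by
  have hfin : ∀ x, f x ≠ ⊤ := fun x => ((hf1 x).trans_lt ENNReal.one_lt_top).ne
  have h1 := lintegral_eq_lintegral_meas_lt (volume : Measure ℝ) (f := fun x => (f x).toReal)
    (Filter.Eventually.of_forall fun x => ENNReal.toReal_nonneg) hf.ennreal_toReal.aemeasurable
  simp_rw [ENNReal.ofReal_toReal (hfin _)] at h1
  rw [h1, ← lintegral_indicator measurableSet_Ioi, ← lintegral_indicator measurableSet_Ioo]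
  refine lintegral_congr fun t => ?_
  by_cases ht : 0 < t
  · have h2 : {x | t < (f x).toReal} = {x | ENNReal.ofReal t < f x} := by
      ext x
      simp [ENNReal.ofReal_lt_iff_lt_toReal ht.le (hfin x)]
    by_cases ht1 : t < 1
    · rw [indicator_of_mem (by exact ht), indicator_of_mem (by exact ⟨ht, ht1⟩), h2]
    · rw [indicator_of_mem (by exact ht), indicator_of_notMem (by simp [ht1]), h2]
      convert measure_empty
      · ext x
        simp only [mem_ofPred_eq, mem_empty_iff_false, iff_false, not_lt]
        exact (hf1 x).trans (by simpa using not_lt.mp ht1)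
      · infer_instance
  · rw [indicator_of_notMem (by simpa using ht), indicator_of_notMem (by simp [ht])]

theorem lintegral_add_le_two_mul_of_midpoint {u v w : ℝ → ENNReal} (hu : Measurable u)
    (hv : Measurable v) (hw : Measurable w) (hu1 : ∀ x, u x ≤ 1) (hv1 : ∀ x, v x ≤ 1)
    (hus : ⨆ x, u x = 1) (hvs : ⨆ x, v x = 1)
    (h : ∀ x y, min (u x) (v y) ≤ w ((1 / 2 : ℝ) * (x + y))) :
    (∫⁻ x, u x) + ∫⁻ x, v x ≤ 2 * ∫⁻ x, w x := by
  have hw' : ∫⁻ x, min (w x) 1 ≤ ∫⁻ x, w x := lintegral_mono fun x => min_le_left _ _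
  have hmeas : ∀ f : ℝ → ENNReal, Measurable fun t : ℝ => volume {x | ENNReal.ofReal t < f x} :=
    fun f => Antitone.measurable fun s t hst => measure_mono fun x hx =>
      (ENNReal.ofReal_le_ofReal hst).trans_lt hx
  refine le_trans ?_ (mul_le_mul_right hw' 2)
  rw [lintegral_eq_lintegral_meas_ofReal_lt hu hu1, lintegral_eq_lintegral_meas_ofReal_lt hv hv1,
    lintegral_eq_lintegral_meas_ofReal_lt (hw.min measurable_const) fun x => min_le_right _ _,
    ← lintegral_add_left (hmeas u), ← lintegral_const_mul _ (hmeas _)]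
  refine setLIntegral_mono' measurableSet_Ioo fun t ht => ?_
  have ht1 : ENNReal.ofReal t < 1 := by simpa using ht.2
  have hne : ∀ f : ℝ → ENNReal, ⨆ x, f x = 1 → {x | ENNReal.ofReal t < f x}.Nonempty := by
    intro f hfs
    obtain ⟨x, hx⟩ := lt_iSup_iff.mp (hfs ▸ ht1)
    exact ⟨x, hx⟩
  refine volume_add_le_two_mul_of_midpoint (measurableSet_lt measurable_const hu)
    (measurableSet_lt measurable_const hv) (hne u hus) (hne v hvs) fun a ha b hb => ?_
  exact lt_min ((lt_min ha hb).trans_le (h a b)) ht1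

theorem ENNReal.four_mul_le_add_sq (a b : ENNReal) : 4 * (a * b) ≤ (a + b) ^ 2 := by
  rcases eq_or_ne a ⊤ with rfl | ha
  · simp
  rcases eq_or_ne b ⊤ with rfl | hb
  · simp
  lift a to NNReal using ha
  lift b to NNReal using hb
  norm_cast
  rw [← NNReal.coe_le_coe]
  push_cast
  nlinarith [sq_nonneg ((a : ℝ) - b)]

/-- A functional midpoint inequality of Prékopa–Leindler type for the measure `μ`, with respect
to the midpoint operation `m` and the weight `c`. -/
def PLProp {α : Type*} [MeasurableSpace α] (μ : Measure α) (m : α → α → α)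
    (c : α → α → ENNReal) : Prop :=
  ∀ f g h : α → ENNReal, Measurable f → Measurable g → Measurable h →
    (∀ x y, f x * g y ≤ (c x y * h (m x y)) ^ 2) →
    (∫⁻ x, f x ∂μ) * (∫⁻ x, g x ∂μ) ≤ (∫⁻ x, h x ∂μ) ^ 2

theorem plProp_volume_real :
    PLProp (volume : Measure ℝ) (fun x y => (1 / 2 : ℝ) * (x + y)) fun _ _ => 1 := by
  have bdd : ∀ (k : NNReal) (f g h : ℝ → ENNReal), Measurable f → Measurable g → Measurable h →
      (∀ x, f x ≤ k) → (∀ x, g x ≤ k) →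
      (∀ x y, f x * g y ≤ (h ((1 / 2 : ℝ) * (x + y))) ^ 2) →
      (∫⁻ x, f x) * (∫⁻ x, g x) ≤ (∫⁻ x, h x) ^ 2 := by
    intro k f g h hf hg hh hfk hgk H
    set a := ⨆ x, f x with ha
    set b := ⨆ x, g x with hb
    have hat : a ≠ ⊤ := ((iSup_le hfk).trans_lt ENNReal.coe_lt_top).ne
    have hbt : b ≠ ⊤ := ((iSup_le hgk).trans_lt ENNReal.coe_lt_top).ne
    rcases eq_or_ne a 0 with ha0 | ha0
    · have : f = 0 := by
        ext x
        exact le_antisymm ((le_iSup f x).trans ha0.le) zero_le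
      simp [this]
    rcases eq_or_ne b 0 with hb0 | hb0
    · have : g = 0 := by
        ext x
        exact le_antisymm ((le_iSup g x).trans hb0.le) zero_le
      simp [this]
    obtain ⟨c, hc⟩ : ∃ c : ENNReal, c ^ 2 = a * b :=
      ⟨(a * b) ^ (1 / 2 : ℝ), by rw [← ENNReal.rpow_natCast, ← ENNReal.rpow_mul]; norm_num⟩
    have hc0 : c ≠ 0 := by
      rintro rfl
      simp [ha0, hb0] at hc
    have hct : c ≠ ⊤ := by
      rintro rfl
      exact (ENNReal.mul_lt_top hat.lt_top hbt.lt_top).ne (by rw [← hc]; simp)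
    have key := lintegral_add_le_two_mul_of_midpoint (u := fun x => a⁻¹ * f x)
      (v := fun x => b⁻¹ * g x) (w := fun x => c⁻¹ * h x) (hf.const_mul _) (hg.const_mul _)
      (hh.const_mul _)
      (fun x => by
        rw [mul_comm, ← div_eq_mul_inv]
        exact ENNReal.div_le_of_le_mul (by simpa using le_iSup f x))
      (fun x => by
        rw [mul_comm, ← div_eq_mul_inv]
        exact ENNReal.div_le_of_le_mul (by simpa using le_iSup g x))
      (by rw [← ENNReal.mul_iSup]; exact ENNReal.inv_mul_cancel ha0 hat)
      (by rw [← ENNReal.mul_iSup]; exact ENNReal.inv_mul_cancel hb0 hbt)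
      (fun x y => by
        rw [← ENNReal.pow_le_pow_left_iff two_ne_zero]
        calc min (a⁻¹ * f x) (b⁻¹ * g y) ^ 2 ≤ (a⁻¹ * f x) * (b⁻¹ * g y) := by
              rw [sq]; exact mul_le_mul' (min_le_left _ _) (min_le_right _ _)
          _ = (c ^ 2)⁻¹ * (f x * g y) := by
              rw [hc, ENNReal.mul_inv (Or.inl ha0) (Or.inl hat)]; ring
          _ ≤ (c ^ 2)⁻¹ * (h ((1 / 2 : ℝ) * (x + y))) ^ 2 := by gcongr; exact H x y
          _ = _ := by rw [mul_pow, ENNReal.inv_pow])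
    rw [lintegral_const_mul _ hf, lintegral_const_mul _ hg, lintegral_const_mul _ hh] at key
    have k2 := (ENNReal.four_mul_le_add_sq _ _).trans (pow_le_pow_left₀ zero_le key 2)
    set F := ∫⁻ x, f x
    set G := ∫⁻ x, g x
    set W := ∫⁻ x, h x
    have k3 : 4 * ((c ^ 2)⁻¹ * (F * G)) ≤ 4 * ((c ^ 2)⁻¹ * W ^ 2) := by
      calc 4 * ((c ^ 2)⁻¹ * (F * G)) = 4 * (a⁻¹ * F * (b⁻¹ * G)) := by
            rw [hc, ENNReal.mul_inv (Or.inl ha0) (Or.inl hat)]; ring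
        _ ≤ (2 * (c⁻¹ * W)) ^ 2 := k2
        _ = _ := by rw [ENNReal.inv_pow]; ring
    rw [ENNReal.mul_le_mul_iff_right (by simp) (by simp),
      ENNReal.mul_le_mul_iff_right (by simp [hct]) (by simp [hc0])] at k3
    exact k3
  intro f g h hf hg hh H
  have hsup : ∀ f : ℝ → ENNReal, Measurable f →
      ∫⁻ x, f x = ⨆ k : ℕ, ∫⁻ x, min (f x) k := by
    intro f hf
    rw [← lintegral_iSup (fun k => hf.min measurable_const)
      (fun i j hij x => min_le_min_left _ (by exact_mod_cast hij))]
    congr with x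
    rw [← inf_iSup_eq (f x) (fun k : ℕ => (k : ENNReal)), ENNReal.iSup_natCast]
    simp
  rw [hsup f hf, hsup g hg, ENNReal.iSup_mul]
  refine iSup_le fun i => ?_
  rw [ENNReal.mul_iSup]
  refine iSup_le fun j => ?_
  refine bdd (max i j) _ _ h (hf.min measurable_const) (hg.min measurable_const) hh
    (fun x => (min_le_right _ _).trans (by simp)) (fun x => (min_le_right _ _).trans (by simp))
    fun x y => ?_
  refine (mul_le_mul' (min_le_left _ _) (min_le_left _ _)).trans ?_
  simpa using H x y

namespace PLProp

variable {α β : Type*} [MeasurableSpace α] [MeasurableSpace β] {μ : Measure α} {ν : Measure β}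
  {m : α → α → α} {c : α → α → ENNReal} {m' : β → β → β} {c' : β → β → ENNReal}

theorem of_measurePreserving (hμ : PLProp μ m c) {e : α → β} (he : MeasurePreserving e μ ν)
    (hm : ∀ x y, m' (e x) (e y) = e (m x y)) (hc : ∀ x y, c' (e x) (e y) ≤ c x y) :
    PLProp ν m' c' := by
  intro f g h hf hg hh H
  have := hμ (f ∘ e) (g ∘ e) (h ∘ e) (hf.comp he.measurable) (hg.comp he.measurable)
    (hh.comp he.measurable) fun x y => by
      refine (H (e x) (e y)).trans ?_
      rw [hm]
      exact pow_le_pow_left₀ zero_le (mul_le_mul' (hc x y) le_rfl) 2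
  simp only [Function.comp_def] at this
  rwa [he.lintegral_comp hf, he.lintegral_comp hg, he.lintegral_comp hh] at this

theorem withDensity (hμ : PLProp μ m c) {φ : α → ENNReal} (hφ : Measurable φ)
    {c₁ : α → α → ENNReal} (hc : ∀ x y, φ x * φ y * c₁ x y ^ 2 ≤ (c x y * φ (m x y)) ^ 2) :
    PLProp (μ.withDensity φ) m c₁ := by
  intro f g h hf hg hh H
  rw [lintegral_withDensity_eq_lintegral_mul _ hφ hf,
    lintegral_withDensity_eq_lintegral_mul _ hφ hg,
    lintegral_withDensity_eq_lintegral_mul _ hφ hh]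
  refine hμ _ _ _ (hφ.mul hf) (hφ.mul hg) (hφ.mul hh) fun x y => ?_
  simp only [Pi.mul_apply]
  calc φ x * f x * (φ y * g y) = φ x * φ y * (f x * g y) := by ring
    _ ≤ φ x * φ y * (c₁ x y * h (m x y)) ^ 2 := by gcongr; exact H x y
    _ = φ x * φ y * c₁ x y ^ 2 * h (m x y) ^ 2 := by ring
    _ ≤ (c x y * φ (m x y)) ^ 2 * h (m x y) ^ 2 := by gcongr; exact hc x y
    _ = _ := by ring

theorem smul (hμ : PLProp μ m c) (a : ENNReal) : PLProp (a • μ) m c := by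
  intro f g h hf hg hh H
  simp only [lintegral_smul_measure, smul_eq_mul]
  calc _ = a ^ 2 * ((∫⁻ x, f x ∂μ) * (∫⁻ x, g x ∂μ)) := by ring
    _ ≤ a ^ 2 * (∫⁻ x, h x ∂μ) ^ 2 := by gcongr; exact hμ f g h hf hg hh H
    _ = _ := by ring

theorem prod [SFinite μ] [SFinite ν] (hμ : PLProp μ m c) (hν : PLProp ν m' c') :
    PLProp (μ.prod ν) (fun x y => (m x.1 y.1, m' x.2 y.2))
      fun x y => c x.1 y.1 * c' x.2 y.2 := by
  intro f g h hf hg hh H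
  rw [lintegral_prod _ hf.aemeasurable, lintegral_prod _ hg.aemeasurable,
    lintegral_prod _ hh.aemeasurable]
  refine hμ _ _ _ hf.lintegral_prod_right' hg.lintegral_prod_right' hh.lintegral_prod_right'
    fun x y => ?_
  have hh' : Measurable fun z => h (m x y, z) := hh.comp measurable_prodMk_left
  rw [← lintegral_const_mul _ hh']
  refine hν _ _ _ (hf.comp measurable_prodMk_left) (hg.comp measurable_prodMk_left)
    (hh'.const_mul _) fun u v => ?_
  refine (H (x, u) (y, v)).trans (le_of_eq ?_)
  ring

theorem pi [SigmaFinite μ] (hμ : PLProp μ m c) (n : ℕ) :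
    PLProp (Measure.pi fun _ : Fin n => μ) (fun x y i => m (x i) (y i))
      fun x y => ∏ i, c (x i) (y i) := by
  induction n with
  | zero =>
    intro f g h hf hg hh H
    have hd := Measure.pi_of_empty (fun _ : Fin 0 => μ)
    rw [hd, lintegral_dirac, lintegral_dirac, lintegral_dirac]
    refine (H _ _).trans (le_of_eq ?_)
    simp only [Finset.univ_eq_empty, Finset.prod_empty, one_mul]
    congr
    exact Subsingleton.elim _ _
  | succ n ih =>
    refine (hμ.prod ih).of_measurePreserving
      (measurePreserving_piFinSuccAbove (fun _ : Fin (n + 1) => μ) 0).symm ?_ ?_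
    · intro x y
      ext i
      refine Fin.cases ?_ (fun i => ?_) i <;> simp [MeasurableEquiv.piFinSuccAbove]
    · intro x y
      rw [Fin.prod_univ_succ]
      simp [MeasurableEquiv.piFinSuccAbove]

end PLProp

/-- The functional midpoint inequality with respect to the linear midpoint. -/
def MidPL {E : Type*} [AddCommGroup E] [Module ℝ E] [MeasurableSpace E] (μ : Measure E) : Prop :=
  PLProp μ (fun x y => (1 / 2 : ℝ) • (x + y)) fun _ _ => 1

theorem midPL_volume (n : ℕ) : MidPL (volume : Measure (EuclideanSpace ℝ (Fin n))) := by
  refine (plProp_volume_real.pi n).of_measurePreserving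
    (EuclideanSpace.volume_preserving_symm_measurableEquiv_toLp (Fin n)).symm ?_ ?_
  · intro x y
    ext i
    simp [mul_add]
  · simp

namespace MidPL

variable {E : Type*} [AddCommGroup E] [Module ℝ E] [MeasurableSpace E] {μ : Measure E}
  {F : Type*} [AddCommGroup F] [Module ℝ F] [MeasurableSpace F] {ν : Measure F}

theorem restrict (hμ : MidPL μ) {K : Set E} (hK : Convex ℝ K) (hKm : MeasurableSet K) :
    MidPL (μ.restrict K) := by
  classical
  rw [← withDensity_indicator_one hKm]
  refine PLProp.withDensity hμ (measurable_one.indicator hKm) fun x y => ?_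
  by_cases hx : x ∈ K
  · by_cases hy : y ∈ K
    · have : (1 / 2 : ℝ) • (x + y) ∈ K := by
        rw [smul_add]
        exact hK hx hy (by norm_num) (by norm_num) (by norm_num)
      rw [one_div, smul_add] at this
      simp [hx, hy, this]
    · simp [hy]
  · simp [hx]

theorem smul (hμ : MidPL μ) (a : ENNReal) : MidPL (a • μ) := PLProp.smul hμ a

theorem map (hμ : MidPL μ) (L : E →ₗ[ℝ] F) (hL : Measurable L) : MidPL (μ.map L) :=
  PLProp.of_measurePreserving hμ (hL.measurePreserving μ) (by intro x y; simp) (by simp)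

theorem prod [SFinite μ] [SFinite ν] (hμ : MidPL μ) (hν : MidPL ν) : MidPL (μ.prod ν) :=
  PLProp.of_measurePreserving (PLProp.prod hμ hν) (MeasurePreserving.id _)
    (by intro x y; ext <;> simp) (by simp)

/-- Midpoint log-concavity of a measure satisfying the functional inequality. -/
theorem measure_mul_le (hμ : MidPL μ) {A B C : Set E} (hA : MeasurableSet A)
    (hB : MeasurableSet B) (hC : MeasurableSet C)
    (h : ∀ a ∈ A, ∀ b ∈ B, (1 / 2 : ℝ) • (a + b) ∈ C) : μ A * μ B ≤ μ C ^ 2 := by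
  classical
  have := hμ (A.indicator 1) (B.indicator 1) (C.indicator 1) (measurable_one.indicator hA)
    (measurable_one.indicator hB) (measurable_one.indicator hC) fun x y => by
      by_cases hx : x ∈ A
      · by_cases hy : y ∈ B
        · have := h x hx y hy
          rw [one_div, smul_add] at this
          simp [hx, hy, this]
        · simp [hy]
      · simp [hx]
  simpa [lintegral_indicator_one, hA, hB, hC] using this

end MidPL

theorem plProp_gaussianReal : PLProp (ProbabilityTheory.gaussianReal 0 1)
    (fun x y => (1 / 2 : ℝ) * (x + y)) fun x y => ENNReal.ofReal (Real.exp ((x - y) ^ 2 / 8)) := by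
  rw [ProbabilityTheory.gaussianReal, if_neg one_ne_zero]
  refine plProp_volume_real.withDensity (ProbabilityTheory.measurable_gaussianPDF 0 1)
    fun x y => le_of_eq ?_
  simp only [ProbabilityTheory.gaussianPDF, ProbabilityTheory.gaussianPDFReal, one_mul]
  rw [← ENNReal.ofReal_pow (by positivity), ← ENNReal.ofReal_pow (by positivity),
    ← ENNReal.ofReal_mul (by positivity), ← ENNReal.ofReal_mul (by positivity)]
  congr 1
  have h : Real.exp (-(x - 0) ^ 2 / (2 * (1 : NNReal))) *
      Real.exp (-(y - 0) ^ 2 / (2 * (1 : NNReal))) * Real.exp ((x - y) ^ 2 / 8) ^ 2 =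
      Real.exp (-(1 / 2 * (x + y) - 0) ^ 2 / (2 * (1 : NNReal))) ^ 2 := by
    rw [← Real.exp_nat_mul, ← Real.exp_nat_mul, ← Real.exp_add, ← Real.exp_add]
    congr 1
    push_cast
    ring
  rw [mul_pow, ← h]
  ring

theorem plProp_stdGaussian (n : ℕ) :
    PLProp (ProbabilityTheory.stdGaussian (EuclideanSpace ℝ (Fin n)))
      (fun x y => (1 / 2 : ℝ) • (x + y))
      fun x y => ENNReal.ofReal (Real.exp (‖x - y‖ ^ 2 / 8)) := by
  refine (plProp_gaussianReal.pi n).of_measurePreserving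
    (e := WithLp.toLp 2) ⟨by fun_prop, ProbabilityTheory.map_pi_eq_stdGaussian⟩ ?_ ?_
  · intro x y
    ext i
    simp [mul_add]
  · intro x y
    rw [← ENNReal.ofReal_prod_of_nonneg fun i _ => by positivity, ← Real.exp_sum]
    refine ENNReal.ofReal_le_ofReal (Real.exp_le_exp.mpr (le_of_eq ?_))
    rw [EuclideanSpace.norm_sq_eq, Finset.sum_div]
    simp

/-- The Gaussian transport-type (property tau) inequality. -/
theorem lintegral_mul_lintegral_stdGaussian_le_one {n : ℕ}
    {f g : EuclideanSpace ℝ (Fin n) → ENNReal} (hf : Measurable f) (hg : Measurable g)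
    (h : ∀ x y, f x * g y ≤ ENNReal.ofReal (Real.exp (‖x - y‖ ^ 2 / 4))) :
    (∫⁻ x, f x ∂ProbabilityTheory.stdGaussian _) * (∫⁻ x, g x ∂ProbabilityTheory.stdGaussian _)
      ≤ 1 := by
  have := plProp_stdGaussian n f g (fun _ => 1) hf hg measurable_const fun x y => by
    refine (h x y).trans (le_of_eq ?_)
    rw [mul_one, ← ENNReal.ofReal_pow (by positivity), ← Real.exp_nat_mul]
    congr 2
    push_cast
    ring
  simpa using this

theorem convex_of_isClosed_of_midpoint {E : Type*} [NormedAddCommGroup E] [NormedSpace ℝ E]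
    {L : Set E} (hL : IsClosed L) (h : ∀ x ∈ L, ∀ y ∈ L, (1 / 2 : ℝ) • (x + y) ∈ L) :
    Convex ℝ L := by
  rw [convex_iff_segment_subset]
  intro x hx y hy
  rw [segment_eq_image_lineMap]
  rintro _ ⟨t, ht, rfl⟩
  set T : Set ℝ := {s | AffineMap.lineMap x y s ∈ L} with hT
  have hTc : IsClosed T := hL.preimage (AffineMap.lineMap_continuous (p := x) (q := y))
  by_contra htL
  obtain ⟨a, ⟨haT, ha⟩, hamax⟩ := (isCompact_Icc.inter_left hTc :
    IsCompact (T ∩ Icc 0 t)).exists_isGreatest ⟨0, by simpa [hT] using hx, by simpa using ht.1⟩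
  obtain ⟨b, ⟨hbT, hb⟩, hbmin⟩ := (isCompact_Icc.inter_left hTc :
    IsCompact (T ∩ Icc t 1)).exists_isLeast ⟨1, by simpa [hT] using hy, by simpa using ht.2⟩
  have hat : a < t := lt_of_le_of_ne ha.2 fun e => htL (by rw [← e]; exact haT)
  have hbt : t < b := lt_of_le_of_ne hb.1 fun e => htL (by rw [e]; exact hbT)
  have hmid : (a + b) / 2 ∈ T := by
    have := h _ haT _ hbT
    rw [hT, mem_ofPred_eq]
    convert this using 1
    simp only [AffineMap.lineMap_apply_module]
    module
  rcases le_total ((a + b) / 2) t with hle | hle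
  · have := hamax ⟨hmid, by linarith [ha.1], hle⟩
    linarith
  · have := hbmin ⟨hmid, hle, by linarith [hb.2]⟩
    linarith

section BallMass

variable {q : ℕ} {ν : Measure (EuclideanSpace ℝ (Fin q))} [IsProbabilityMeasure ν]

theorem ballMass_mul_le (hν : MidPL ν) (ρ : ℝ) (x y : EuclideanSpace ℝ (Fin q)) :
    ν.real (Metric.closedBall x ρ) * ν.real (Metric.closedBall y ρ) ≤
      ν.real (Metric.closedBall ((1 / 2 : ℝ) • (x + y)) ρ) ^ 2 := by
  have := hν.measure_mul_le (A := Metric.closedBall x ρ) (B := Metric.closedBall y ρ)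
    (C := Metric.closedBall ((1 / 2 : ℝ) • (x + y)) ρ) Metric.isClosed_closedBall.measurableSet
    Metric.isClosed_closedBall.measurableSet Metric.isClosed_closedBall.measurableSet
    fun a ha b hb => by
      rw [mem_closedBall_iff_norm] at *
      calc ‖(1 / 2 : ℝ) • (a + b) - (1 / 2 : ℝ) • (x + y)‖
          = ‖(1 / 2 : ℝ) • ((a - x) + (b - y))‖ := by congr 1; module
        _ ≤ (1 / 2) * (‖a - x‖ + ‖b - y‖) := by
            rw [norm_smul]
            norm_num
            exact norm_add_le _ _
        _ ≤ ρ := by linarith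
  have h2 := ENNReal.toReal_mono (by finiteness) this
  simpa [Measure.real] using h2

theorem ballMass_neg {ν : Measure (EuclideanSpace ℝ (Fin q))}
    (hs : ν.map Neg.neg = ν) (ρ : ℝ) (x : EuclideanSpace ℝ (Fin q)) :
    ν.real (Metric.closedBall (-x) ρ) = ν.real (Metric.closedBall x ρ) := by
  conv_rhs => rw [← hs]
  rw [map_measureReal_apply measurable_neg Metric.isClosed_closedBall.measurableSet]
  congr 1
  ext y
  simp only [Metric.mem_closedBall, mem_preimage, dist_eq_norm]
  rw [← norm_neg]
  congr! 2
  abel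

theorem ballMass_mul_pow_le (hν : MidPL ν) (ρ : ℝ) (k : ℕ) (x : EuclideanSpace ℝ (Fin q)) :
    ν.real (Metric.closedBall x ρ) * ν.real (Metric.closedBall 0 ρ) ^ (2 ^ k) ≤
      ν.real (Metric.closedBall 0 ρ) *
        ν.real (Metric.closedBall ((1 / 2 : ℝ) ^ k • x) ρ) ^ (2 ^ k) := by
  induction k with
  | zero => simp [mul_comm]
  | succ k ih =>
    set M := ν.real (Metric.closedBall 0 ρ)
    have h1 := ballMass_mul_le hν ρ ((1 / 2 : ℝ) ^ k • x) 0
    rw [add_zero, smul_smul, ← pow_succ'] at h1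
    calc _ = ν.real (Metric.closedBall x ρ) * M ^ (2 ^ k) * M ^ (2 ^ k) := by ring
      _ ≤ M * ν.real (Metric.closedBall ((1 / 2 : ℝ) ^ k • x) ρ) ^ (2 ^ k) * M ^ (2 ^ k) := by
          gcongr
      _ = M * (ν.real (Metric.closedBall ((1 / 2 : ℝ) ^ k • x) ρ) * M) ^ (2 ^ k) := by
          rw [mul_pow]; ring
      _ ≤ M * (ν.real (Metric.closedBall ((1 / 2 : ℝ) ^ (k + 1) • x) ρ) ^ 2) ^ (2 ^ k) := by
          gcongr
      _ = _ := by rw [← pow_mul]; ring_nf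

theorem isClosed_le_ballMass (ρ : ℝ) (hρ : 0 ≤ ρ) (s : ℝ) :
    IsClosed {y | s ≤ ν.real (Metric.closedBall y ρ)} := by
  rw [← isSeqClosed_iff_isClosed]
  intro u y hu huy
  have h1 : Filter.Tendsto (fun r => ν.real (Metric.cthickening r (Metric.closedBall y ρ)))
      (nhdsWithin 0 (Ioi 0)) (nhds (ν.real (Metric.closedBall y ρ))) :=
    ((ENNReal.tendsto_toReal (by finiteness)).comp
      (tendsto_measure_cthickening_of_isClosed ⟨1, one_pos, by finiteness⟩
        Metric.isClosed_closedBall)).mono_left nhdsWithin_le_nhds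
  refine ge_of_tendsto h1 (Filter.eventually_of_mem self_mem_nhdsWithin fun r hr => ?_)
  obtain ⟨k, hk⟩ := (Metric.tendsto_atTop.mp huy r hr)
  refine (hu k).trans ?_
  rw [cthickening_closedBall (le_of_lt hr) hρ]
  refine measureReal_mono ?_
  exact Metric.closedBall_subset_closedBall' (by linarith [hk k le_rfl])

theorem measurable_ballMass (ρ : ℝ) (ν : Measure (EuclideanSpace ℝ (Fin q))) [SFinite ν] :
    Measurable fun y => ν (Metric.closedBall y ρ) := by
  have : MeasurableSet {p : EuclideanSpace ℝ (Fin q) × EuclideanSpace ℝ (Fin q) |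
      dist p.2 p.1 ≤ ρ} := (isClosed_le (by fun_prop) continuous_const).measurableSet
  exact measurable_measure_prodMk_left this

theorem lintegral_ballMass_mul {f : EuclideanSpace ℝ (Fin q) → ENNReal} (hf : Measurable f)
    (ρ : ℝ) :
    ∫⁻ y, ν (Metric.closedBall y ρ) * f y = ∫⁻ x, (∫⁻ y in Metric.closedBall x ρ, f y) ∂ν := by
  have hS : MeasurableSet {p : EuclideanSpace ℝ (Fin q) × EuclideanSpace ℝ (Fin q) |
      dist p.2 p.1 ≤ ρ} := (isClosed_le (by fun_prop) continuous_const).measurableSet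
  have hm : Measurable fun p : EuclideanSpace ℝ (Fin q) × EuclideanSpace ℝ (Fin q) =>
      {p : EuclideanSpace ℝ (Fin q) × EuclideanSpace ℝ (Fin q) | dist p.2 p.1 ≤ ρ}.indicator
        (fun p => f p.1) p := (hf.comp measurable_fst).indicator hS
  have h1 : ∀ y, ν (Metric.closedBall y ρ) * f y = ∫⁻ x,
      {p : EuclideanSpace ℝ (Fin q) × EuclideanSpace ℝ (Fin q) | dist p.2 p.1 ≤ ρ}.indicator
        (fun p => f p.1) (y, x) ∂ν := by
    intro y
    rw [mul_comm, ← setLIntegral_const,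
      ← lintegral_indicator Metric.isClosed_closedBall.measurableSet]
    rfl
  simp_rw [h1]
  rw [lintegral_lintegral_swap hm.aemeasurable]
  refine lintegral_congr fun x => ?_
  rw [← lintegral_indicator Metric.isClosed_closedBall.measurableSet]
  refine lintegral_congr fun y => ?_
  by_cases h : y ∈ Metric.closedBall x ρ
  · rw [indicator_of_mem h, indicator_of_mem (by simpa [dist_comm] using h)]
  · rw [indicator_of_notMem h, indicator_of_notMem (by simpa [dist_comm] using h)]

end BallMass

section BallMass

variable {q : ℕ} {ν : Measure (EuclideanSpace ℝ (Fin q))} [IsProbabilityMeasure ν]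

/-- The superlevel set of the ball mass at relative height `e^{-q}`. -/
def ballLevel (ν : Measure (EuclideanSpace ℝ (Fin q))) (ρ : ℝ) : Set (EuclideanSpace ℝ (Fin q)) :=
  {y | ν.real (Metric.closedBall 0 ρ) * Real.exp (-q) ≤ ν.real (Metric.closedBall y ρ)}

theorem convex_ballLevel (hν : MidPL ν) {ρ : ℝ} (hρ : 0 ≤ ρ) : Convex ℝ (ballLevel ν ρ) := by
  refine convex_of_isClosed_of_midpoint (isClosed_le_ballMass ρ hρ _) fun x hx y hy => ?_
  have h := ballMass_mul_le hν ρ x y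
  set M := ν.real (Metric.closedBall 0 ρ) * Real.exp (-q)
  have hM : 0 ≤ M := by positivity
  have h2 : M ^ 2 ≤ ν.real (Metric.closedBall ((1 / 2 : ℝ) • (x + y)) ρ) ^ 2 := by
    refine le_trans ?_ h
    rw [sq]
    exact mul_le_mul hx hy hM measureReal_nonneg
  exact le_of_sq_le_sq h2 measureReal_nonneg

theorem exists_level_of_ballMass_pos (hν : MidPL ν) (hq : 0 < q) {ρ : ℝ}
    (y : EuclideanSpace ℝ (Fin q)) (hM : 0 < ν.real (Metric.closedBall 0 ρ))
    (hy : 0 < ν.real (Metric.closedBall y ρ)) (hyL : y ∉ ballLevel ν ρ) :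
    ∃ j : ℕ, (1 / 2 : ℝ) ^ (j + 1) • y ∈ ballLevel ν ρ ∧
      ν.real (Metric.closedBall y ρ) ≤
        ν.real (Metric.closedBall 0 ρ) * Real.exp (-(q * 2 ^ j : ℝ)) := by
  set M := ν.real (Metric.closedBall 0 ρ)
  have hbound : ∀ k : ℕ, (1 / 2 : ℝ) ^ k • y ∉ ballLevel ν ρ →
      ν.real (Metric.closedBall y ρ) ≤ M * Real.exp (-(q * 2 ^ k : ℝ)) := by
    intro k hk
    have h1 := ballMass_mul_pow_le hν ρ k y
    have h2 : ν.real (Metric.closedBall ((1 / 2 : ℝ) ^ k • y) ρ) ≤ M * Real.exp (-q) :=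
      le_of_lt (not_le.mp hk)
    have h3 : ν.real (Metric.closedBall y ρ) * M ^ 2 ^ k ≤
        M * Real.exp (-(q * 2 ^ k : ℝ)) * M ^ 2 ^ k := by
      calc _ ≤ M * ν.real (Metric.closedBall ((1 / 2 : ℝ) ^ k • y) ρ) ^ 2 ^ k := h1
        _ ≤ M * (M * Real.exp (-q)) ^ 2 ^ k := by gcongr
        _ = _ := by
          rw [mul_pow, ← Real.exp_nat_mul]
          push_cast
          ring_nf
    exact le_of_mul_le_mul_right h3 (by positivity)
  have hex : ∃ k : ℕ, (1 / 2 : ℝ) ^ k • y ∈ ballLevel ν ρ := by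
    by_contra! hno
    have h1 : Filter.Tendsto (fun k : ℕ => M * Real.exp (-(q * 2 ^ k : ℝ))) Filter.atTop
        (nhds (M * 0)) := by
      refine Filter.Tendsto.const_mul _ (Real.tendsto_exp_neg_atTop_nhds_zero.comp ?_)
      exact (tendsto_pow_atTop_atTop_of_one_lt one_lt_two).const_mul_atTop (by positivity)
    have h2 := ge_of_tendsto' h1 fun k => hbound k (hno k)
    linarith
  classical
  have hpos : Nat.find hex ≠ 0 := by
    intro h0
    have := Nat.find_spec hex
    rw [h0] at this
    simp at this
    exact hyL this
  obtain ⟨j, hj⟩ := Nat.exists_eq_succ_of_ne_zero hpos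
  refine ⟨j, ?_, hbound j (Nat.find_min hex (by omega))⟩
  have := Nat.find_spec hex
  rwa [hj] at this

theorem lintegral_ballMass (ρ : ℝ) :
    ∫⁻ y, ν (Metric.closedBall y ρ) =
      volume (Metric.closedBall (0 : EuclideanSpace ℝ (Fin q)) ρ) := by
  have := lintegral_ballMass_mul (ν := ν) (f := fun _ => 1) measurable_const ρ
  simp only [mul_one, setLIntegral_const, one_mul] at this
  rw [this]
  simp_rw [Measure.addHaar_closedBall_center]
  simp

theorem volume_ballLevel_le (ρ : ℝ) :
    ENNReal.ofReal (ν.real (Metric.closedBall 0 ρ) * Real.exp (-q)) * volume (ballLevel ν ρ) ≤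
      volume (Metric.closedBall (0 : EuclideanSpace ℝ (Fin q)) ρ) := by
  rw [← lintegral_ballMass (ν := ν)]
  refine le_trans (mul_le_mul' le_rfl (measure_mono fun y hy => ?_))
    (mul_meas_ge_le_lintegral (measurable_ballMass ρ ν) _)
  exact (ENNReal.ofReal_le_iff_le_toReal (by finiteness)).mpr hy

/-- Numerical bound for the dyadic tail. -/
theorem four_pow_mul_exp_le (j : ℕ) :
    (4 : ℝ) ^ (j + 1) * Real.exp (1 - 2 ^ j) ≤ 288 * (1 / 4) ^ j := by
  have h1 : (2 : ℝ) ^ (4 * j) / 24 ≤ Real.exp (2 ^ j) := by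
    have := Real.pow_div_factorial_le_exp ((2 : ℝ) ^ j) (by positivity) 4
    rw [← pow_mul, mul_comm j 4] at this
    simpa [Nat.factorial] using this
  have h2 : Real.exp 1 ≤ 3 := by linarith [Real.exp_one_lt_d9]
  rw [Real.exp_sub, mul_div_assoc', div_le_iff₀ (Real.exp_pos _)]
  calc (4 : ℝ) ^ (j + 1) * Real.exp 1 ≤ 4 ^ (j + 1) * 3 := by gcongr
    _ = 288 * (1 / 4) ^ j * (2 ^ (4 * j) / 24) := by
      rw [pow_mul, pow_succ]
      norm_num
      rw [show (16 : ℝ) = 4 * 4 by norm_num, mul_pow]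
      field_simp
      rw [show (4 : ℝ) ^ j * 288 * (1 / 4) ^ j = 288 * (4 * (1 / 4)) ^ j by rw [mul_pow]; ring]
      norm_num
    _ ≤ _ := by gcongr

end BallMass

section BallMass

variable {q : ℕ} {ν : Measure (EuclideanSpace ℝ (Fin q))} [IsProbabilityMeasure ν]

theorem ballMass_mul_abs_inner_pow_le (hν : MidPL ν) (hq : 0 < q) {ρ r' : ℝ}
    (hM : 0 < ν.real (Metric.closedBall 0 ρ)) {θ : EuclideanSpace ℝ (Fin q)}
    (hL : ∀ y ∈ ballLevel ν ρ, |inner ℝ θ y| ≤ r') (y : EuclideanSpace ℝ (Fin q)) :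
    ν (Metric.closedBall y ρ) * ENNReal.ofReal (|inner ℝ θ y| ^ q) ≤
      ν (Metric.closedBall y ρ) * ENNReal.ofReal (r' ^ q) +
        ∑' j : ℕ, ((2 : ℝ) ^ (j + 1) • ballLevel ν ρ).indicator (fun _ => ENNReal.ofReal
          (ν.real (Metric.closedBall 0 ρ) * Real.exp (-(q * 2 ^ j : ℝ)) *
            (2 ^ (j + 1) * r') ^ q)) y := by
  by_cases hyL : y ∈ ballLevel ν ρ
  · refine le_trans ?_ le_self_add
    gcongr
    exact hL y hyL
  rcases (measureReal_nonneg (μ := ν) (s := Metric.closedBall y ρ)).eq_or_lt' with h0 | hpos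
  · rw [measureReal_eq_zero_iff] at h0
    simp [h0]
  obtain ⟨j, hj, hjb⟩ := exists_level_of_ballMass_pos hν hq y hM hpos hyL
  refine le_trans ?_ le_add_self
  refine le_trans ?_ (ENNReal.le_tsum j)
  have hmem : y ∈ (2 : ℝ) ^ (j + 1) • ballLevel ν ρ := by
    refine ⟨_, hj, ?_⟩
    simp only [smul_smul, ← mul_pow]
    norm_num
  rw [indicator_of_mem hmem, ← ofReal_measureReal, ← ENNReal.ofReal_mul measureReal_nonneg]
  refine ENNReal.ofReal_le_ofReal ?_
  have h1 := hL _ hj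
  rw [inner_smul_right, abs_mul, abs_of_nonneg (by positivity), one_div, inv_pow,
    inv_mul_le_iff₀ (by positivity)] at h1
  gcongr

theorem tsum_pow_le (hq : 0 < q) :
    ∑' j : ℕ, ENNReal.ofReal ((288 * (1 / 4) ^ j) ^ q) ≤ ENNReal.ofReal (288 ^ q * (4 / 3)) := by
  calc ∑' j : ℕ, ENNReal.ofReal ((288 * (1 / 4) ^ j) ^ q)
      ≤ ∑' j : ℕ, ENNReal.ofReal (288 ^ q * (1 / 4) ^ j) := by
        refine ENNReal.tsum_le_tsum fun j => ENNReal.ofReal_le_ofReal ?_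
        rw [mul_pow]
        gcongr
        exact pow_le_of_le_one (by positivity) (pow_le_one₀ (by norm_num) (by norm_num)) hq.ne'
    _ = _ := by
        rw [← ENNReal.ofReal_tsum_of_nonneg (fun j => by positivity)
          ((summable_geometric_of_lt_one (by norm_num) (by norm_num)).mul_left _), tsum_mul_left,
          tsum_geometric_of_lt_one (by norm_num) (by norm_num)]
        norm_num

theorem lintegral_ballMass_mul_abs_inner_pow_le (hν : MidPL ν) (hq : 0 < q) {ρ r' : ℝ}
    (hρ : 0 ≤ ρ) (hr' : 0 ≤ r') (hM : 0 < ν.real (Metric.closedBall 0 ρ))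
    {θ : EuclideanSpace ℝ (Fin q)} (hL : ∀ y ∈ ballLevel ν ρ, |inner ℝ θ y| ≤ r') :
    ∫⁻ y, ν (Metric.closedBall y ρ) * ENNReal.ofReal (|inner ℝ θ y| ^ q) ≤
      volume (Metric.closedBall (0 : EuclideanSpace ℝ (Fin q)) ρ) *
        ENNReal.ofReal ((700 * r') ^ q) := by
  set b := volume (Metric.closedBall (0 : EuclideanSpace ℝ (Fin q)) ρ)
  set M := ν.real (Metric.closedBall 0 ρ)
  have hLm : ∀ j : ℕ, MeasurableSet ((2 : ℝ) ^ (j + 1) • ballLevel ν ρ) := fun j =>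
    (isClosed_le_ballMass ρ hρ _).measurableSet.const_smul₀ _
  have hterm : ∀ j : ℕ, ∫⁻ y, ((2 : ℝ) ^ (j + 1) • ballLevel ν ρ).indicator (fun _ =>
      ENNReal.ofReal (M * Real.exp (-(q * 2 ^ j : ℝ)) * (2 ^ (j + 1) * r') ^ q)) y ≤
      b * (ENNReal.ofReal (r' ^ q) * ENNReal.ofReal ((288 * (1 / 4) ^ j) ^ q)) := by
    intro j
    rw [lintegral_indicator (hLm j), setLIntegral_const, Measure.addHaar_smul,
      ← mul_assoc, ← ENNReal.ofReal_mul (by positivity)]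
    have h1 : M * Real.exp (-(q * 2 ^ j : ℝ)) * (2 ^ (j + 1) * r') ^ q *
        |((2 : ℝ) ^ (j + 1)) ^ Module.finrank ℝ (EuclideanSpace ℝ (Fin q))| =
        (r' ^ q * (4 ^ (j + 1) * Real.exp (1 - 2 ^ j)) ^ q) * (M * Real.exp (-q)) := by
      rw [finrank_euclideanSpace_fin, abs_of_nonneg (by positivity)]
      have h2 : Real.exp (-(q * 2 ^ j : ℝ)) = Real.exp (1 - 2 ^ j) ^ q * Real.exp (-q) := by
        rw [← Real.exp_nat_mul, ← Real.exp_add]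
        ring_nf
      have h3 : (4 : ℝ) ^ (j + 1) = 2 ^ (j + 1) * 2 ^ (j + 1) := by
        rw [← mul_pow]; norm_num
      rw [h2, h3, mul_pow, mul_pow, mul_pow]
      ring
    rw [h1, ENNReal.ofReal_mul (by positivity), mul_assoc, mul_comm b]
    refine mul_le_mul' ?_ (volume_ballLevel_le ρ)
    rw [← ENNReal.ofReal_mul (by positivity)]
    refine ENNReal.ofReal_le_ofReal ?_
    exact mul_le_mul_of_nonneg_left (pow_le_pow_left₀ (by positivity) (four_pow_mul_exp_le j) q)
      (by positivity)
  refine (lintegral_mono (ballMass_mul_abs_inner_pow_le hν hq hM hL)).trans ?_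
  rw [lintegral_add_left ((measurable_ballMass ρ ν).mul_const _),
    lintegral_mul_const _ (measurable_ballMass ρ ν), lintegral_ballMass,
    lintegral_tsum fun j => (measurable_const.indicator (hLm j)).aemeasurable]
  refine (add_le_add le_rfl (ENNReal.tsum_le_tsum hterm)).trans ?_
  rw [ENNReal.tsum_mul_left, ENNReal.tsum_mul_left, ← mul_add]
  gcongr
  refine (add_le_add le_rfl (mul_le_mul' le_rfl (tsum_pow_le hq))).trans ?_
  rw [← ENNReal.ofReal_mul (by positivity), ← ENNReal.ofReal_add (by positivity) (by positivity)]
  refine ENNReal.ofReal_le_ofReal ?_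
  rw [mul_pow]
  have h288 : (1 : ℝ) ≤ 288 ^ q := one_le_pow₀ (by norm_num)
  have h700 : (7 / 3 : ℝ) * 288 ^ q ≤ 700 ^ q := by
    calc (7 / 3 : ℝ) * 288 ^ q ≤ (700 / 288) ^ q * 288 ^ q := by
          gcongr
          refine le_trans ?_ (le_self_pow₀ (by norm_num) hq.ne')
          norm_num
      _ = 700 ^ q := by rw [← mul_pow]; norm_num
  have hr'q : 0 ≤ r' ^ q := by positivity
  nlinarith

theorem lintegral_abs_inner_pow_le {ρ : ℝ} (hρ : 0 < ρ) {θ : EuclideanSpace ℝ (Fin q)}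
    (hθ : ‖θ‖ = 1) :
    volume (Metric.closedBall (0 : EuclideanSpace ℝ (Fin q)) ρ) *
      ∫⁻ x, ENNReal.ofReal (|inner ℝ θ x| ^ q) ∂ν ≤
    ENNReal.ofReal (2 ^ q) *
      ((∫⁻ y, ν (Metric.closedBall y ρ) * ENNReal.ofReal (|inner ℝ θ y| ^ q)) +
        volume (Metric.closedBall (0 : EuclideanSpace ℝ (Fin q)) ρ) * ENNReal.ofReal (ρ ^ q)) := by
  set b := volume (Metric.closedBall (0 : EuclideanSpace ℝ (Fin q)) ρ) with hb
  have hm : Measurable fun y : EuclideanSpace ℝ (Fin q) =>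
      ENNReal.ofReal (|inner ℝ θ y| ^ q) := by fun_prop
  have hm2 : Measurable fun y : EuclideanSpace ℝ (Fin q) =>
      ENNReal.ofReal (|inner ℝ θ y| ^ q) + ENNReal.ofReal (ρ ^ q) := by fun_prop
  have hsum : (∫⁻ y, ν (Metric.closedBall y ρ) * ENNReal.ofReal (|inner ℝ θ y| ^ q)) +
      b * ENNReal.ofReal (ρ ^ q) = ∫⁻ x, (∫⁻ y in Metric.closedBall x ρ,
        (ENNReal.ofReal (|inner ℝ θ y| ^ q) + ENNReal.ofReal (ρ ^ q))) ∂ν := by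
    rw [← lintegral_ballMass_mul hm2, hb, ← lintegral_ballMass (ν := ν),
      ← lintegral_mul_const _ (measurable_ballMass ρ ν)]
    simp_rw [mul_add]
    exact (lintegral_add_left ((measurable_ballMass ρ ν).mul hm) _).symm
  rw [hsum, ← lintegral_const_mul _ hm, ← lintegral_const_mul' _ _ (by finiteness)]
  refine lintegral_mono fun x => ?_
  have hbx : b = volume (Metric.closedBall x ρ) := (Measure.addHaar_closedBall_center _ _ _).symm
  rw [← lintegral_const_mul' _ _ (by finiteness), mul_comm, hbx, ← setLIntegral_const]
  refine setLIntegral_mono' Metric.isClosed_closedBall.measurableSet fun y hy => ?_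
  rw [← ENNReal.ofReal_add (by positivity) (by positivity), ← ENNReal.ofReal_mul (by positivity)]
  refine ENNReal.ofReal_le_ofReal ?_
  have h1 : |inner ℝ θ x| ≤ |inner ℝ θ y| + ρ := by
    have h2 : inner ℝ θ x = inner ℝ θ y - inner ℝ θ (y - x) := by rw [inner_sub_right]; ring
    rw [h2]
    refine (abs_sub _ _).trans ?_
    have h3 := abs_real_inner_le_norm θ (y - x)
    rw [hθ, one_mul] at h3
    rw [mem_closedBall_iff_norm] at hy
    linarith
  calc |inner ℝ θ x| ^ q ≤ (|inner ℝ θ y| + ρ) ^ q := by gcongr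
    _ ≤ (2 * max |inner ℝ θ y| ρ) ^ q := by
      gcongr
      linarith [le_max_left |inner ℝ θ y| ρ, le_max_right |inner ℝ θ y| ρ]
    _ ≤ _ := by
      rw [mul_pow]
      gcongr
      rcases max_choice |inner ℝ θ y| ρ with h | h <;> rw [h]
      · linarith [pow_nonneg hρ.le q]
      · linarith [pow_nonneg (abs_nonneg (inner ℝ θ y)) q]

/-- Small ball estimate in dimension `q` from lower bounds for the `q`-th moments. -/
theorem ballMass_zero_le (hν : MidPL ν) (hs : ν.map Neg.neg = ν) (hq : 0 < q) {r ρ : ℝ}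
    (hρ : 0 < ρ) (hρr : ρ ≤ r / 8)
    (hmom : ∀ θ : EuclideanSpace ℝ (Fin q), ‖θ‖ = 1 →
      ENNReal.ofReal (r ^ q) ≤ ∫⁻ x, ENNReal.ofReal (|inner ℝ θ x| ^ q) ∂ν) :
    ν.real (Metric.closedBall 0 ρ) ≤ (Real.exp 1 * (ρ / (r / 7000))) ^ q := by
  have hr : 0 < r := by linarith
  have : Nonempty (Fin q) := ⟨⟨0, hq⟩⟩
  rcases (measureReal_nonneg (μ := ν) (s := Metric.closedBall 0 ρ)).eq_or_lt' with h0 | hM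
  · rw [h0]; positivity
  set r' := r / 7000 with hr'
  have hr'0 : 0 < r' := by positivity
  set b := volume (Metric.closedBall (0 : EuclideanSpace ℝ (Fin q)) ρ) with hb
  have hb0 : b ≠ 0 := (Metric.measure_closedBall_pos _ _ hρ).ne'
  have hbt : b ≠ ⊤ := measure_closedBall_lt_top.ne
  have hsub : Metric.ball 0 r' ⊆ ballLevel ν ρ := by
    by_contra hns
    obtain ⟨y, hy, hyL⟩ := not_subset.mp hns
    obtain ⟨f, u, hfL, hfy⟩ := geometric_hahn_banach_closed_point (convex_ballLevel hν hρ.le)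
      (isClosed_le_ballMass ρ hρ.le _) hyL
    set w := (InnerProductSpace.toDual ℝ (EuclideanSpace ℝ (Fin q))).symm f
    have hw : ∀ x, f x = inner ℝ w x := fun x => by simp [w]
    have h0L : (0 : EuclideanSpace ℝ (Fin q)) ∈ ballLevel ν ρ := by
      refine mul_le_of_le_one_right measureReal_nonneg ?_
      simp
    have hu : 0 < u := by simpa using hfL 0 h0L
    have hw0 : w ≠ 0 := by
      intro h
      have := hw y
      rw [h, inner_zero_left] at this
      linarith
    have hwn : 0 < ‖w‖ := norm_pos_iff.mpr hw0
    have hyw : f y ≤ ‖w‖ * r' := by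
      rw [hw]
      refine (real_inner_le_norm _ _).trans ?_
      have := mem_ball_zero_iff.mp hy
      gcongr
    have hL : ∀ z ∈ ballLevel ν ρ, |inner ℝ (‖w‖⁻¹ • w) z| ≤ r' := by
      intro z hz
      have hz' : -z ∈ ballLevel ν ρ := by
        simp only [ballLevel, mem_ofPred_eq, ballMass_neg hs]
        exact hz
      have h1 := hfL z hz
      have h2 := hfL _ hz'
      rw [map_neg] at h2
      rw [inner_smul_left, abs_mul, ← hw]
      simp only [map_inv₀, conj_trivial, abs_inv, abs_norm]
      rw [inv_mul_le_iff₀ hwn, abs_le]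
      constructor <;> linarith
    have hθ : ‖‖w‖⁻¹ • w‖ = 1 := by
      rw [norm_smul, norm_inv, norm_norm, inv_mul_cancel₀ hwn.ne']
    have h1 := lintegral_abs_inner_pow_le (ν := ν) hρ hθ
    have h2 := lintegral_ballMass_mul_abs_inner_pow_le hν hq hρ.le hr'0.le hM hL
    have h3 : b * ENNReal.ofReal (r ^ q) ≤ b * (ENNReal.ofReal (2 ^ q) *
        (ENNReal.ofReal ((700 * r') ^ q) + ENNReal.ofReal (ρ ^ q))) := by
      refine (mul_le_mul' le_rfl (hmom _ hθ)).trans (h1.trans ?_)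
      refine (mul_le_mul' le_rfl (add_le_add h2 le_rfl)).trans (le_of_eq ?_)
      ring
    rw [ENNReal.mul_le_mul_iff_right hb0 hbt, ← ENNReal.ofReal_add (by positivity) (by positivity),
      ← ENNReal.ofReal_mul (by positivity), ENNReal.ofReal_le_ofReal_iff (by positivity), mul_add,
      ← mul_pow, ← mul_pow] at h3
    have h4 : (2 * (700 * r')) ^ q ≤ (1 / 4 : ℝ) * r ^ q := by
      have : 2 * (700 * r') = 1 / 5 * r := by rw [hr']; ring
      rw [this, mul_pow]
      gcongr
      refine (pow_le_of_le_one (by norm_num) (by norm_num) hq.ne').trans (by norm_num)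
    have h5 : (2 * ρ) ^ q ≤ (1 / 4 : ℝ) * r ^ q := by
      calc (2 * ρ) ^ q ≤ (1 / 4 * r) ^ q := by
            exact pow_le_pow_left₀ (by positivity) (by linarith) q
        _ = (1 / 4 : ℝ) ^ q * r ^ q := mul_pow _ _ _
        _ ≤ _ := by
          gcongr
          exact pow_le_of_le_one (by norm_num) (by norm_num) hq.ne'
    have : 0 < r ^ q := by positivity
    linarith
  have h1 := volume_ballLevel_le (ν := ν) (q := q) ρ
  have h2 : ENNReal.ofReal (ν.real (Metric.closedBall 0 ρ) * Real.exp (-q)) *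
      volume (Metric.ball (0 : EuclideanSpace ℝ (Fin q)) r') ≤ b :=
    (mul_le_mul' le_rfl (measure_mono hsub)).trans h1
  rw [hb, Measure.addHaar_ball _ _ hr'0.le, Measure.addHaar_closedBall _ _ hρ.le, ← mul_assoc,
    ENNReal.mul_le_mul_iff_left (Metric.measure_ball_pos _ _ one_pos).ne' measure_ball_lt_top.ne,
    ← ENNReal.ofReal_mul (by positivity), ENNReal.ofReal_le_ofReal_iff (by positivity),
    finrank_euclideanSpace_fin, Real.exp_neg] at h2
  rw [mul_pow, div_pow, ← Real.exp_nat_mul, mul_one]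
  rw [← div_eq_mul_inv, div_mul_eq_mul_div, div_le_iff₀ (Real.exp_pos _)] at h2
  rw [mul_div_assoc', le_div_iff₀ (by positivity)]
  linarith

end BallMass

theorem exists_finset_packing {n : ℕ} {W A D : Set (EuclideanSpace ℝ (Fin n))}
    (hWm : MeasurableSet W) (hW : ∀ w ∈ W, -w ∈ W) (hW0 : volume W ≠ 0) (hD : volume D ≠ ⊤)
    (hAD : ∀ a ∈ A, ∀ w ∈ W, a + w ∈ D) :
    ∃ F : Finset (EuclideanSpace ℝ (Fin n)), ↑F ⊆ A ∧ F.card * volume W ≤ volume D ∧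
      ∀ a ∈ A, ∃ x ∈ F, ∃ w ∈ W, ∃ w' ∈ W, a - x = w + w' := by
  classical
  set P : Finset (EuclideanSpace ℝ (Fin n)) → Prop := fun F =>
    ↑F ⊆ A ∧ (F : Set (EuclideanSpace ℝ (Fin n))).PairwiseDisjoint fun x => x +ᵥ W with hP
  have hcard : ∀ F, P F → F.card * volume W ≤ volume D := by
    intro F hF
    calc F.card * volume W = ∑ x ∈ F, volume (x +ᵥ W) := by simp [measure_vadd]
      _ = volume (⋃ x ∈ F, x +ᵥ W) :=
        (measure_biUnion_finset hF.2 fun x _ => hWm.const_vadd x).symm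
      _ ≤ volume D := by
        refine measure_mono (iUnion₂_subset fun x hx => ?_)
        rintro _ ⟨w, hw, rfl⟩
        exact hAD x (hF.1 hx) w hw
  obtain ⟨N, hN⟩ : ∃ N : ℕ, ∀ F, P F → F.card ≤ N := by
    obtain ⟨N, hN⟩ := ENNReal.exists_nat_mul_gt hW0 hD
    refine ⟨N, fun F hF => ?_⟩
    by_contra! hlt
    have h1 : (N : ENNReal) * volume W ≤ F.card * volume W := by gcongr
    exact absurd (hN.trans_le (h1.trans (hcard F hF))) (lt_irrefl _)
  have hbdd : BddAbove {k | ∃ F, P F ∧ F.card = k} := ⟨N, by rintro _ ⟨F, hF, rfl⟩; exact hN F hF⟩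
  obtain ⟨F, hF, hFc⟩ := Nat.sSup_mem (s := {k | ∃ F, P F ∧ F.card = k}) ⟨0, ∅, by simp [hP]⟩ hbdd
  refine ⟨F, hF.1, hcard F hF, fun a ha => ?_⟩
  by_cases haF : a ∈ F
  · obtain ⟨w, hw⟩ := nonempty_of_measure_ne_zero hW0
    exact ⟨a, haF, w, hw, -w, hW w hw, by simp⟩
  by_contra! hno
  have hins : P (insert a F) := by
    refine ⟨by simpa [insert_subset_iff] using ⟨ha, hF.1⟩, ?_⟩
    rw [Finset.coe_insert]
    refine hF.2.insert fun x hx _ => ?_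
    rw [Set.disjoint_left]
    rintro _ ⟨w, hw, rfl⟩ ⟨w', hw', h⟩
    refine hno x hx w' hw' (-w) (hW w hw) ?_
    simp only [vadd_eq_add] at h
    rw [sub_eq_iff_eq_add, add_assoc, add_comm, add_assoc, h]
    abel
  have := le_csSup hbdd ⟨_, hins, rfl⟩
  rw [← hFc, Finset.card_insert_of_notMem haF] at this
  omega

theorem exists_sphere_net (q : ℕ) (hq : 0 < q) :
    ∃ F : Finset (EuclideanSpace ℝ (Fin q)), (∀ x ∈ F, ‖x‖ = 1) ∧ F.card ≤ 21 ^ q ∧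
      ∀ t, ‖t‖ = 1 → ∃ x ∈ F, ‖t - x‖ ≤ 1 / 10 := by
  have : Nonempty (Fin q) := ⟨⟨0, hq⟩⟩
  obtain ⟨F, hFA, hFc, hF⟩ := exists_finset_packing (n := q) (W := Metric.closedBall 0 (1 / 20))
    (A := Metric.sphere 0 1) (D := Metric.closedBall 0 (21 / 20))
    Metric.isClosed_closedBall.measurableSet (by simp)
    (Metric.measure_closedBall_pos _ _ (by norm_num)).ne' measure_closedBall_lt_top.ne
    fun a ha w hw => by
      rw [mem_closedBall_zero_iff] at *
      rw [mem_sphere_zero_iff_norm] at ha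
      refine (norm_add_le _ _).trans ?_
      linarith
  refine ⟨F, fun x hx => by simpa using hFA hx, ?_, fun t ht => ?_⟩
  · rw [Measure.addHaar_closedBall _ _ (by norm_num), Measure.addHaar_closedBall _ _ (by norm_num),
      ← mul_assoc, ENNReal.mul_le_mul_iff_left (Metric.measure_ball_pos _ _ one_pos).ne'
      measure_ball_lt_top.ne, finrank_euclideanSpace_fin, ← ENNReal.ofReal_natCast,
      ← ENNReal.ofReal_mul (by positivity), ENNReal.ofReal_le_ofReal_iff (by positivity), one_div,
      inv_pow, ← div_eq_mul_inv, div_le_iff₀ (by positivity), ← mul_pow] at hFc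
    norm_num at hFc
    exact_mod_cast hFc
  · obtain ⟨x, hx, w, hw, w', hw', h⟩ := hF t (by simpa using ht)
    refine ⟨x, hx, ?_⟩
    rw [h]
    rw [mem_closedBall_zero_iff] at *
    refine (norm_add_le _ _).trans ?_
    linarith

section RealMoments

variable {ν : Measure ℝ} [IsProbabilityMeasure ν]

theorem measureReal_Iic_neg {ν : Measure ℝ}
    (hs : ν.map Neg.neg = ν) (x : ℝ) :
    ν.real (Iic (-x)) = ν.real (Ici x) := by
  conv_lhs => rw [← hs]
  rw [map_measureReal_apply measurable_neg measurableSet_Iic]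
  congr 1
  ext y
  simp

theorem measureReal_Ici_mul_le (hν : MidPL ν) (x y : ℝ) :
    ν.real (Ici x) * ν.real (Ici y) ≤ ν.real (Ici ((x + y) / 2)) ^ 2 := by
  have := hν.measure_mul_le (A := Ici x) (B := Ici y) (C := Ici ((x + y) / 2)) measurableSet_Ici
    measurableSet_Ici measurableSet_Ici fun a ha b hb => by
      simp only [mem_Ici, smul_eq_mul] at *
      linarith
  have h2 := ENNReal.toReal_mono (by finiteness) this
  simpa [Measure.real] using h2

theorem measureReal_abs_ge_le {ν : Measure ℝ}
    (hs : ν.map Neg.neg = ν) (x : ℝ) :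
    ν.real {t | x ≤ |t|} ≤ 2 * ν.real (Ici x) := by
  have : {t : ℝ | x ≤ |t|} = Ici x ∪ Iic (-x) := by
    ext t
    simp [le_abs, le_neg]
  rw [this, two_mul]
  have h := measureReal_union_le (μ := ν) (Ici x) (Iic (-x))
  rwa [measureReal_Iic_neg hs] at h

theorem measureReal_Ici_le_of_moment (hν : MidPL ν) (hs : ν.map Neg.neg = ν) {s : ℝ}
    (hs0 : 0 < s) (hmom : ∫⁻ t, ENNReal.ofReal (t ^ 2) ∂ν ≤ ENNReal.ofReal (s ^ 2)) (k : ℕ) :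
    ν.real (Ici (k * (3 * s))) ≤ (1 / 9) ^ k := by
  set G : ℕ → ℝ := fun k => ν.real (Ici (k * (3 * s))) with hG
  have hG0 : ∀ k, 0 ≤ G k := fun k => measureReal_nonneg
  have hhalf : 1 / 2 ≤ G 0 := by
    have h1 : ν.real univ ≤ ν.real (Ici 0) + ν.real (Iic (-0)) := by
      rw [neg_zero, ← Ici_union_Iic (a := (0 : ℝ))]
      exact measureReal_union_le _ _
    rw [measureReal_Iic_neg hs, probReal_univ] at h1
    simp only [hG, Nat.cast_zero, zero_mul]
    linarith
  have hone : G 1 ≤ 1 / 18 := by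
    have hdisj : Disjoint (Ici (3 * s)) (Iic (-(3 * s))) := by
      rw [Set.disjoint_left]
      intro x hx hx'
      simp only [mem_Ici, mem_Iic] at hx hx'
      linarith
    have h2 : 2 * G 1 = ν.real (Ici (3 * s) ∪ Iic (-(3 * s))) := by
      rw [measureReal_union hdisj measurableSet_Iic, measureReal_Iic_neg hs]
      simp [hG, two_mul]
    have h3 : ENNReal.ofReal ((3 * s) ^ 2) * ν (Ici (3 * s) ∪ Iic (-(3 * s))) ≤
        ENNReal.ofReal (s ^ 2) := by
      refine le_trans (mul_le_mul' le_rfl (measure_mono ?_)) ((mul_meas_ge_le_lintegral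
        (f := fun t : ℝ => ENNReal.ofReal (t ^ 2)) (by fun_prop) _).trans hmom)
      rintro x (hx | hx) <;> simp only [mem_Ici, mem_Iic] at hx <;>
        exact ENNReal.ofReal_le_ofReal (by nlinarith)
    rw [← ofReal_measureReal, ← ENNReal.ofReal_mul (by positivity),
      ENNReal.ofReal_le_ofReal_iff (by positivity), ← h2] at h3
    have : 0 < s ^ 2 := by positivity
    nlinarith
  have hanti : ∀ k, G (k + 1) ≤ G k := fun k => by
    refine measureReal_mono (Ici_subset_Ici.mpr ?_)
    push_cast
    nlinarith
  have hratio : ∀ k, G (k + 1) ≤ 1 / 9 * G k := by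
    intro k
    induction k with
    | zero => simp only [zero_add]; linarith
    | succ k ih =>
      rcases (hG0 k).eq_or_lt' with h0 | hpos
      · have h1 := hanti k
        have h2 := hanti (k + 1)
        have h3 := hG0 (k + 1)
        linarith
      · have h1 := measureReal_Ici_mul_le hν (k * (3 * s)) ((k + 1 + 1 : ℕ) * (3 * s))
        have h2 : (k * (3 * s) + (k + 1 + 1 : ℕ) * (3 * s)) / 2 = (k + 1 : ℕ) * (3 * s) := by
          push_cast; ring
        rw [h2] at h1
        have h3 : G k * G (k + 1 + 1) ≤ G k * (1 / 9 * G (k + 1)) := by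
          refine h1.trans ?_
          have := mul_le_mul_of_nonneg_right ih (hG0 (k + 1))
          rw [sq]
          linarith
        exact le_of_mul_le_mul_left h3 hpos
  have : ∀ k, G k ≤ (1 / 9) ^ k := by
    intro k
    induction k with
    | zero => simpa using measureReal_le_one
    | succ k ih =>
      rw [pow_succ']
      exact (hratio k).trans (by linarith)
  exact this k

theorem lintegral_abs_pow_le (hν : MidPL ν) (hs : ν.map Neg.neg = ν) {s : ℝ}
    (hs0 : 0 < s) (hmom : ∫⁻ t, ENNReal.ofReal (t ^ 2) ∂ν ≤ ENNReal.ofReal (s ^ 2)) {q : ℕ}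
    (hq : 0 < q) :
    ∫⁻ t, ENNReal.ofReal (|t| ^ q) ∂ν ≤ ENNReal.ofReal ((30 * q * s) ^ q) := by
  have hmeas : ∀ k : ℕ, MeasurableSet {t : ℝ | k * (3 * s) ≤ |t|} := fun k =>
    (isClosed_le continuous_const continuous_abs).measurableSet
  have hpt : ∀ t : ℝ, ENNReal.ofReal (|t| ^ q) ≤ ∑' k : ℕ, {t : ℝ | k * (3 * s) ≤ |t|}.indicator
      (fun _ => ENNReal.ofReal (((k + 1) * (3 * s)) ^ q)) t := by
    intro t
    refine le_trans ?_ (ENNReal.le_tsum ⌊|t| / (3 * s)⌋₊)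
    have h1 := Nat.floor_le (a := |t| / (3 * s)) (by positivity)
    have h2 := Nat.lt_floor_add_one (|t| / (3 * s))
    rw [le_div_iff₀ (by positivity)] at h1
    rw [div_lt_iff₀ (by positivity)] at h2
    rw [indicator_of_mem (by exact h1)]
    refine ENNReal.ofReal_le_ofReal ?_
    gcongr
  have hterm : ∀ k : ℕ, ENNReal.ofReal (((k + 1) * (3 * s)) ^ q) * ν {t : ℝ | k * (3 * s) ≤ |t|} ≤
      ENNReal.ofReal ((q * (3 * s)) ^ q * 6 * (1 / 3) ^ k) := by
    intro k
    rw [← ofReal_measureReal, ← ENNReal.ofReal_mul (by positivity)]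
    refine ENNReal.ofReal_le_ofReal ?_
    have h1 := (measureReal_abs_ge_le hs (k * (3 * s))).trans
      (mul_le_mul_of_nonneg_left (measureReal_Ici_le_of_moment hν hs hs0 hmom k) (by norm_num))
    have h2 : ((k : ℝ) + 1) ^ q ≤ q ^ q * 3 ^ (k + 1) := by
      have h3 : ((k : ℝ) + 1) ≤ q * Real.exp ((k + 1) / q) := by
        rw [← div_le_iff₀' (by positivity)]
        linarith [Real.add_one_le_exp (((k : ℝ) + 1) / q)]
      calc ((k : ℝ) + 1) ^ q ≤ (q * Real.exp ((k + 1) / q)) ^ q := by gcongr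
        _ = q ^ q * Real.exp 1 ^ (k + 1) := by
          rw [mul_pow, ← Real.exp_nat_mul, ← Real.exp_nat_mul]
          congr 2
          push_cast
          field_simp
        _ ≤ _ := by
          gcongr
          linarith [Real.exp_one_lt_d9]
    calc ((k + 1) * (3 * s)) ^ q * ν.real {t : ℝ | k * (3 * s) ≤ |t|}
        ≤ (q ^ q * 3 ^ (k + 1) * (3 * s) ^ q) * (2 * (1 / 9) ^ k) := by
          rw [mul_pow]
          gcongr
      _ = _ := by
          rw [mul_pow, pow_succ, show (1 / 9 : ℝ) = 1 / 3 * (1 / 3) by norm_num,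
            mul_pow (1 / 3 : ℝ)]
          have : (3 : ℝ) ^ k * (1 / 3) ^ k = 1 := by rw [← mul_pow]; norm_num
          linear_combination (q ^ q * (3 * s) ^ q * 6 * (1 / 3) ^ k) * this
  refine (lintegral_mono hpt).trans ?_
  rw [lintegral_tsum fun k => (measurable_const.indicator (hmeas k)).aemeasurable]
  simp_rw [lintegral_indicator (hmeas _), setLIntegral_const]
  refine (ENNReal.tsum_le_tsum hterm).trans ?_
  rw [← ENNReal.ofReal_tsum_of_nonneg (fun j => by positivity)
    ((summable_geometric_of_lt_one (by norm_num) (by norm_num)).mul_left _), tsum_mul_left,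
    tsum_geometric_of_lt_one (by norm_num) (by norm_num)]
  refine ENNReal.ofReal_le_ofReal ?_
  have h9 : (9 : ℝ) ≤ 10 ^ q :=
    le_trans (by norm_num) (le_self_pow₀ (by norm_num : (1 : ℝ) ≤ 10) hq.ne')
  calc (q * (3 * s)) ^ q * 6 * (1 - 1 / 3)⁻¹ = (q * (3 * s)) ^ q * 9 := by norm_num; ring
    _ ≤ (q * (3 * s)) ^ q * 10 ^ q := by gcongr
    _ = _ := by rw [← mul_pow]; ring_nf

end RealMoments

/-- The `L^q(μ)`-norm of the linear functional `⟪v, ·⟫`. -/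
noncomputable def momNorm {n : ℕ} (μ : Measure (EuclideanSpace ℝ (Fin n))) (q : ℕ)
    (v : EuclideanSpace ℝ (Fin n)) : ℝ :=
  (eLpNorm (fun x => inner ℝ v x) q μ).toReal

section MomNorm

variable {n : ℕ} {μ : Measure (EuclideanSpace ℝ (Fin n))} {q : ℕ}

theorem eLpNorm_natCast_pow {α : Type*} [MeasurableSpace α] {μ : Measure α} (f : α → ℝ)
    (hq : 0 < q) : eLpNorm f q μ ^ q = ∫⁻ x, ENNReal.ofReal (|f x| ^ q) ∂μ := by
  have h := eLpNorm_nnreal_pow_eq_lintegral (f := f) (μ := μ) (p := (q : NNReal))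
    (by exact_mod_cast hq.ne')
  simp only [NNReal.coe_natCast, ENNReal.rpow_natCast, ENNReal.coe_natCast] at h
  rw [h]
  refine lintegral_congr fun x => ?_
  rw [Real.enorm_eq_ofReal_abs, ENNReal.ofReal_pow (abs_nonneg _)]

theorem momNorm_nonneg (v : EuclideanSpace ℝ (Fin n)) : 0 ≤ momNorm μ q v :=
  ENNReal.toReal_nonneg

theorem momNorm_smul (c : ℝ) (v : EuclideanSpace ℝ (Fin n)) :
    momNorm μ q (c • v) = |c| * momNorm μ q v := by
  have : (fun x => inner ℝ (c • v) x) = c • fun x => inner ℝ v x := by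
    ext x
    simp [inner_smul_left]
  rw [momNorm, this, eLpNorm_const_smul, ENNReal.toReal_mul, momNorm]
  simp

theorem momNorm_neg (v : EuclideanSpace ℝ (Fin n)) : momNorm μ q (-v) = momNorm μ q v := by
  have := momNorm_smul (μ := μ) (q := q) (-1) v
  simpa using this

variable [IsProbabilityMeasure μ]

theorem lintegral_abs_inner_pow_le_of_isotropic (hμ : MidPL μ) (hs : μ.map Neg.neg = μ)
    (hiso : ∀ v, ∫⁻ x, ENNReal.ofReal (inner ℝ v x ^ 2) ∂μ = ENNReal.ofReal (‖v‖ ^ 2))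
    (hq : 0 < q) (v : EuclideanSpace ℝ (Fin n)) :
    ∫⁻ x, ENNReal.ofReal (|inner ℝ v x| ^ q) ∂μ ≤ ENNReal.ofReal ((30 * q * ‖v‖) ^ q) := by
  rcases eq_or_ne v 0 with rfl | hv
  · simp [hq.ne']
  set L : EuclideanSpace ℝ (Fin n) →ₗ[ℝ] ℝ := (innerSL ℝ v).toLinearMap with hL
  have hLv : ∀ x, L x = inner ℝ v x := fun x => rfl
  have hLm : Measurable L := (innerSL ℝ v).measurable
  have : IsProbabilityMeasure (μ.map L) := Measure.isProbabilityMeasure_map hLm.aemeasurable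
  have h := lintegral_abs_pow_le (ν := μ.map L) (hμ.map L hLm) (s := ‖v‖) (q := q) ?_
    (norm_pos_iff.mpr hv) ?_ hq
  · rwa [lintegral_map (by fun_prop) hLm] at h
  · conv_rhs => rw [← hs]
    rw [Measure.map_map measurable_neg hLm, Measure.map_map hLm measurable_neg]
    congr 1
    ext x
    simp
  · rw [lintegral_map (by fun_prop) hLm]
    exact (hiso v).le

theorem eLpNorm_inner_le (hμ : MidPL μ) (hs : μ.map Neg.neg = μ)
    (hiso : ∀ v, ∫⁻ x, ENNReal.ofReal (inner ℝ v x ^ 2) ∂μ = ENNReal.ofReal (‖v‖ ^ 2))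
    (hq : 0 < q) (v : EuclideanSpace ℝ (Fin n)) :
    eLpNorm (fun x => inner ℝ v x) q μ ≤ ENNReal.ofReal (30 * q * ‖v‖) := by
  rw [← ENNReal.pow_le_pow_left_iff hq.ne', eLpNorm_natCast_pow _ hq,
    ← ENNReal.ofReal_pow (by positivity)]
  exact lintegral_abs_inner_pow_le_of_isotropic hμ hs hiso hq v

theorem momNorm_le (hμ : MidPL μ) (hs : μ.map Neg.neg = μ)
    (hiso : ∀ v, ∫⁻ x, ENNReal.ofReal (inner ℝ v x ^ 2) ∂μ = ENNReal.ofReal (‖v‖ ^ 2))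
    (hq : 0 < q) (v : EuclideanSpace ℝ (Fin n)) : momNorm μ q v ≤ 30 * q * ‖v‖ :=
  ENNReal.toReal_le_of_le_ofReal (by positivity) (eLpNorm_inner_le hμ hs hiso hq v)

theorem eLpNorm_inner_ne_top (hμ : MidPL μ) (hs : μ.map Neg.neg = μ)
    (hiso : ∀ v, ∫⁻ x, ENNReal.ofReal (inner ℝ v x ^ 2) ∂μ = ENNReal.ofReal (‖v‖ ^ 2))
    (hq : 0 < q) (v : EuclideanSpace ℝ (Fin n)) :
    eLpNorm (fun x => inner ℝ v x) q μ ≠ ⊤ :=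
  ((eLpNorm_inner_le hμ hs hiso hq v).trans_lt ENNReal.ofReal_lt_top).ne

theorem ofReal_momNorm_pow (hμ : MidPL μ) (hs : μ.map Neg.neg = μ)
    (hiso : ∀ v, ∫⁻ x, ENNReal.ofReal (inner ℝ v x ^ 2) ∂μ = ENNReal.ofReal (‖v‖ ^ 2))
    (hq : 0 < q) (v : EuclideanSpace ℝ (Fin n)) :
    ENNReal.ofReal (momNorm μ q v ^ q) = ∫⁻ x, ENNReal.ofReal (|inner ℝ v x| ^ q) ∂μ := by
  rw [momNorm, ENNReal.ofReal_pow ENNReal.toReal_nonneg,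
    ENNReal.ofReal_toReal (eLpNorm_inner_ne_top hμ hs hiso hq v), eLpNorm_natCast_pow _ hq]

theorem momNorm_add_le (hμ : MidPL μ) (hs : μ.map Neg.neg = μ)
    (hiso : ∀ v, ∫⁻ x, ENNReal.ofReal (inner ℝ v x ^ 2) ∂μ = ENNReal.ofReal (‖v‖ ^ 2))
    (hq : 0 < q) (u v : EuclideanSpace ℝ (Fin n)) :
    momNorm μ q (u + v) ≤ momNorm μ q u + momNorm μ q v := by
  rw [momNorm, momNorm, momNorm, ← ENNReal.toReal_add (eLpNorm_inner_ne_top hμ hs hiso hq u)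
    (eLpNorm_inner_ne_top hμ hs hiso hq v)]
  refine ENNReal.toReal_mono (ENNReal.add_ne_top.mpr ⟨eLpNorm_inner_ne_top hμ hs hiso hq u,
    eLpNorm_inner_ne_top hμ hs hiso hq v⟩) ?_
  have : (fun x => inner ℝ (u + v) x) = (fun x => inner ℝ u x) + fun x => inner ℝ v x := by
    ext x
    simp [inner_add_left]
  rw [this]
  exact eLpNorm_add_le (by fun_prop) (by fun_prop) (by exact_mod_cast hq)

theorem abs_momNorm_sub_le (hμ : MidPL μ) (hs : μ.map Neg.neg = μ)
    (hiso : ∀ v, ∫⁻ x, ENNReal.ofReal (inner ℝ v x ^ 2) ∂μ = ENNReal.ofReal (‖v‖ ^ 2))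
    (hq : 0 < q) (u v : EuclideanSpace ℝ (Fin n)) :
    |momNorm μ q u - momNorm μ q v| ≤ momNorm μ q (u - v) := by
  have h1 := momNorm_add_le hμ hs hiso hq (u - v) v
  have h2 := momNorm_add_le hμ hs hiso hq (v - u) u
  rw [sub_add_cancel] at h1 h2
  rw [← neg_sub u v, momNorm_neg] at h2
  rw [abs_le]
  constructor <;> linarith

theorem lipschitz_momNorm (hμ : MidPL μ) (hs : μ.map Neg.neg = μ)
    (hiso : ∀ v, ∫⁻ x, ENNReal.ofReal (inner ℝ v x ^ 2) ∂μ = ENNReal.ofReal (‖v‖ ^ 2))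
    (hq : 0 < q) (u v : EuclideanSpace ℝ (Fin n)) :
    |momNorm μ q u - momNorm μ q v| ≤ 30 * q * ‖u - v‖ :=
  (abs_momNorm_sub_le hμ hs hiso hq u v).trans (momNorm_le hμ hs hiso hq _)

theorem continuous_momNorm (hμ : MidPL μ) (hs : μ.map Neg.neg = μ)
    (hiso : ∀ v, ∫⁻ x, ENNReal.ofReal (inner ℝ v x ^ 2) ∂μ = ENNReal.ofReal (‖v‖ ^ 2))
    (hq : 0 < q) :
    Continuous (momNorm μ q) := by
  refine (LipschitzWith.of_dist_le_mul (K := 30 * q) fun u v => ?_).continuous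
  rw [Real.dist_eq, dist_eq_norm]
  push_cast
  exact lipschitz_momNorm hμ hs hiso hq u v

end MomNorm

section StdGaussian

variable {Ω F : Type*} [NormedAddCommGroup Ω] [InnerProductSpace ℝ Ω] [FiniteDimensional ℝ Ω]
  [MeasurableSpace Ω] [BorelSpace Ω] [NormedAddCommGroup F] [InnerProductSpace ℝ F]
  [FiniteDimensional ℝ F] [MeasurableSpace F] [BorelSpace F]

theorem map_stdGaussian_of_adjoint_isometry (L : Ω →L[ℝ] F) (A : F → Ω)
    (hA : ∀ ω v, inner ℝ (L ω) v = inner ℝ ω (A v)) (hn : ∀ v, ‖A v‖ = ‖v‖) :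
    (ProbabilityTheory.stdGaussian Ω).map L = ProbabilityTheory.stdGaussian F := by
  have : IsProbabilityMeasure ((ProbabilityTheory.stdGaussian Ω).map L) :=
    Measure.isProbabilityMeasure_map L.measurable.aemeasurable
  refine Measure.ext_of_charFun (funext fun t => ?_)
  rw [charFun_apply, integral_map L.measurable.aemeasurable (by fun_prop),
    ProbabilityTheory.charFun_stdGaussian, ← hn t, ← ProbabilityTheory.charFun_stdGaussian,
    charFun_apply]
  simp_rw [hA]

theorem map_inner_stdGaussian {v : F} (hv : ‖v‖ = 1) :
    (ProbabilityTheory.stdGaussian F).map (fun g => inner ℝ v g) =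
      ProbabilityTheory.gaussianReal 0 1 := by
  have hm : Measurable fun g : F => inner ℝ v g := by fun_prop
  have : IsProbabilityMeasure ((ProbabilityTheory.stdGaussian F).map fun g => inner ℝ v g) :=
    Measure.isProbabilityMeasure_map hm.aemeasurable
  refine Measure.ext_of_charFun (funext fun t => ?_)
  rw [charFun_apply, integral_map hm.aemeasurable (by fun_prop),
    ProbabilityTheory.charFun_gaussianReal]
  have h := ProbabilityTheory.charFun_stdGaussian (t • v)
  rw [charFun_apply] at h
  convert h using 2
  · ext g
    simp [inner_smul_right, real_inner_comm]
  · rw [norm_smul, hv, mul_one, Real.norm_eq_abs, ← Complex.ofReal_pow |t|, sq_abs]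
    simp
    ring

end StdGaussian

theorem le_lintegral_abs_pow_gaussianReal {q : ℕ} (hq : 0 < q) :
    ENNReal.ofReal ((Real.exp (-3) * Real.sqrt q) ^ q) ≤
      ∫⁻ t, ENNReal.ofReal (|t| ^ q) ∂ProbabilityTheory.gaussianReal 0 1 := by
  set a := Real.sqrt q with ha
  have hq1 : (1 : ℝ) ≤ q := by exact_mod_cast hq
  have ha1 : 1 ≤ a := Real.one_le_sqrt.mpr hq1
  have ha2 : a ^ 2 = q := Real.sq_sqrt (by positivity)
  have hpdf : ∀ t ∈ Icc a (a + 1), ENNReal.ofReal (Real.exp (-3 * q)) ≤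
      ProbabilityTheory.gaussianPDF 0 1 t := by
    intro t ht
    refine ENNReal.ofReal_le_ofReal ?_
    rw [ProbabilityTheory.gaussianPDFReal]
    have h1 : Real.exp (-1) ≤ (Real.sqrt (2 * Real.pi * (1 : NNReal)))⁻¹ := by
      rw [Real.exp_neg]
      refine inv_anti₀ (Real.sqrt_pos.mpr (by simp [Real.pi_pos])) ?_
      rw [Real.sqrt_le_left (by positivity)]
      have h1 := Real.exp_one_gt_d9
      have h2 := Real.pi_lt_d2
      have h3 : (2.7 : ℝ) ^ 2 ≤ Real.exp 1 ^ 2 := by gcongr; linarith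
      rw [NNReal.coe_one]
      linarith
    have h2 : Real.exp (-2 * q) ≤ Real.exp (-(t - 0) ^ 2 / (2 * (1 : NNReal))) := by
      refine Real.exp_le_exp.mpr ?_
      simp only [NNReal.coe_one, sub_zero, mul_one]
      have := ht.1
      have := ht.2
      nlinarith
    calc Real.exp (-3 * q) ≤ Real.exp (-1) * Real.exp (-2 * q) := by
          rw [← Real.exp_add]
          exact Real.exp_le_exp.mpr (by linarith)
      _ ≤ _ := mul_le_mul h1 h2 (by positivity) (by positivity)
  calc ENNReal.ofReal ((Real.exp (-3) * a) ^ q)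
      = ENNReal.ofReal (a ^ q) * (ENNReal.ofReal (Real.exp (-3 * q)) * volume (Icc a (a + 1))) := by
        rw [Real.volume_Icc]
        simp only [add_sub_cancel_left, ENNReal.ofReal_one, mul_one]
        rw [← ENNReal.ofReal_mul (by positivity), mul_pow, ← Real.exp_nat_mul]
        congr 1
        rw [mul_comm, mul_comm (q : ℝ)]
    _ ≤ ENNReal.ofReal (a ^ q) * ∫⁻ t in Icc a (a + 1), ProbabilityTheory.gaussianPDF 0 1 t := by
        gcongr
        rw [← setLIntegral_const]
        exact setLIntegral_mono (ProbabilityTheory.measurable_gaussianPDF 0 1) hpdf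
    _ = ENNReal.ofReal (a ^ q) * ProbabilityTheory.gaussianReal 0 1 (Icc a (a + 1)) := by
        rw [ProbabilityTheory.gaussianReal_apply _ one_ne_zero]
    _ = ∫⁻ t in Icc a (a + 1), ENNReal.ofReal (a ^ q) ∂ProbabilityTheory.gaussianReal 0 1 := by
        rw [setLIntegral_const]
    _ ≤ ∫⁻ t in Icc a (a + 1), ENNReal.ofReal (|t| ^ q) ∂ProbabilityTheory.gaussianReal 0 1 := by
        refine setLIntegral_mono (by fun_prop) fun t ht => ENNReal.ofReal_le_ofReal ?_
        exact pow_le_pow_left₀ (by positivity) (ht.1.trans (le_abs_self t)) q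
    _ ≤ _ := setLIntegral_le_lintegral _ _

theorem le_lintegral_abs_inner_pow_stdGaussian {n q : ℕ} (hq : 0 < q)
    (v : EuclideanSpace ℝ (Fin n)) :
    ENNReal.ofReal ((Real.exp (-3) * Real.sqrt q * ‖v‖) ^ q) ≤
      ∫⁻ g, ENNReal.ofReal (|inner ℝ v g| ^ q) ∂ProbabilityTheory.stdGaussian _ := by
  rcases eq_or_ne v 0 with rfl | hv
  · simp [hq.ne']
  have hv' : ‖v‖ ≠ 0 := norm_ne_zero_iff.mpr hv
  set u := ‖v‖⁻¹ • v with hu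
  have hun : ‖u‖ = 1 := by rw [hu, norm_smul, norm_inv, norm_norm, inv_mul_cancel₀ hv']
  have hvu : v = ‖v‖ • u := by rw [hu, smul_smul, mul_inv_cancel₀ hv', one_smul]
  have h := le_lintegral_abs_pow_gaussianReal hq
  rw [← map_inner_stdGaussian hun, lintegral_map (by fun_prop) (by fun_prop)] at h
  calc ENNReal.ofReal ((Real.exp (-3) * Real.sqrt q * ‖v‖) ^ q)
      = ENNReal.ofReal (‖v‖ ^ q) * ENNReal.ofReal ((Real.exp (-3) * Real.sqrt q) ^ q) := by
        rw [← ENNReal.ofReal_mul (by positivity), ← mul_pow, mul_comm]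
    _ ≤ ENNReal.ofReal (‖v‖ ^ q) *
        ∫⁻ g, ENNReal.ofReal (|inner ℝ u g| ^ q) ∂ProbabilityTheory.stdGaussian _ := by gcongr
    _ = _ := by
        rw [← lintegral_const_mul _ (by fun_prop)]
        refine lintegral_congr fun g => ?_
        rw [← ENNReal.ofReal_mul (by positivity), ← mul_pow]
        congr 2
        conv_rhs => rw [hvu, inner_smul_left, abs_mul]
        simp

section Isotropic

variable {n : ℕ} {μ : Measure (EuclideanSpace ℝ (Fin n))} [IsProbabilityMeasure μ]

theorem lintegral_norm_sq_of_isotropic {μ : Measure (EuclideanSpace ℝ (Fin n))}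
    (hiso : ∀ v, ∫⁻ x, ENNReal.ofReal (inner ℝ v x ^ 2) ∂μ = ENNReal.ofReal (‖v‖ ^ 2)) :
    ∫⁻ x, ENNReal.ofReal (‖x‖ ^ 2) ∂μ = n := by
  have h : ∀ x : EuclideanSpace ℝ (Fin n), ENNReal.ofReal (‖x‖ ^ 2) =
      ∑ i, ENNReal.ofReal (inner ℝ (EuclideanSpace.single i (1 : ℝ)) x ^ 2) := by
    intro x
    rw [← ENNReal.ofReal_sum_of_nonneg fun i _ => by positivity, EuclideanSpace.norm_sq_eq]
    simp [EuclideanSpace.inner_single_left]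
  simp_rw [h]
  rw [lintegral_finsetSum _ fun i _ => by fun_prop]
  simp [hiso]

theorem pow_le_lintegral_norm_pow_of_isotropic
    (hiso : ∀ v, ∫⁻ x, ENNReal.ofReal (inner ℝ v x ^ 2) ∂μ = ENNReal.ofReal (‖v‖ ^ 2))
    {q : ℕ} (hq : 2 ≤ q) :
    ENNReal.ofReal (Real.sqrt n ^ q) ≤ ∫⁻ x, ENNReal.ofReal (‖x‖ ^ q) ∂μ := by
  have h1 : eLpNorm (fun x : EuclideanSpace ℝ (Fin n) => ‖x‖) 2 μ ≤
      eLpNorm (fun x : EuclideanSpace ℝ (Fin n) => ‖x‖) q μ :=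
    eLpNorm_le_eLpNorm_of_exponent_le (by exact_mod_cast hq)
      (by fun_prop)
  have h2 := eLpNorm_natCast_pow (μ := μ) (fun x : EuclideanSpace ℝ (Fin n) => ‖x‖) two_pos
  have h3 := eLpNorm_natCast_pow (μ := μ) (fun x : EuclideanSpace ℝ (Fin n) => ‖x‖)
    (q := q) (by omega)
  simp only [abs_norm] at h2 h3
  rw [lintegral_norm_sq_of_isotropic hiso] at h2
  rw [← h3, ENNReal.ofReal_pow (by positivity)]
  refine pow_le_pow_left' (le_trans ?_ h1) q
  refine (ENNReal.pow_le_pow_left_iff two_ne_zero).mp ?_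
  rw [← ENNReal.ofReal_pow (by positivity), Real.sq_sqrt (by positivity), ENNReal.ofReal_natCast]
  exact h2.ge

theorem le_lintegral_momNorm_pow (hμ : MidPL μ) (hs : μ.map Neg.neg = μ)
    (hiso : ∀ v, ∫⁻ x, ENNReal.ofReal (inner ℝ v x ^ 2) ∂μ = ENNReal.ofReal (‖v‖ ^ 2))
    {q : ℕ} (hq : 2 ≤ q) :
    ENNReal.ofReal ((Real.exp (-3) * Real.sqrt q * Real.sqrt n) ^ q) ≤
      ∫⁻ g, ENNReal.ofReal (momNorm μ q g ^ q) ∂ProbabilityTheory.stdGaussian _ := by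
  have hq0 : 0 < q := by omega
  simp_rw [ofReal_momNorm_pow hμ hs hiso hq0]
  rw [lintegral_lintegral_swap (by fun_prop)]
  calc ENNReal.ofReal ((Real.exp (-3) * Real.sqrt q * Real.sqrt n) ^ q)
      = ENNReal.ofReal ((Real.exp (-3) * Real.sqrt q) ^ q) * ENNReal.ofReal (Real.sqrt n ^ q) := by
        rw [← ENNReal.ofReal_mul (by positivity), ← mul_pow]
    _ ≤ ENNReal.ofReal ((Real.exp (-3) * Real.sqrt q) ^ q) *
          ∫⁻ x, ENNReal.ofReal (‖x‖ ^ q) ∂μ := by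
        gcongr
        exact pow_le_lintegral_norm_pow_of_isotropic hiso hq
    _ = ∫⁻ x, ENNReal.ofReal ((Real.exp (-3) * Real.sqrt q * ‖x‖) ^ q) ∂μ := by
        rw [← lintegral_const_mul _ (by fun_prop)]
        refine lintegral_congr fun x => ?_
        rw [← ENNReal.ofReal_mul (by positivity), ← mul_pow]
    _ ≤ _ := lintegral_mono fun x => by
        simpa only [real_inner_comm] using le_lintegral_abs_inner_pow_stdGaussian hq0 x

end Isotropic

theorem ofReal_integral_le_lintegral_ofReal {α : Type*} [MeasurableSpace α] {μ : Measure α}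
    {f : α → ℝ} (hf : Integrable f μ) :
    ENNReal.ofReal (∫ x, f x ∂μ) ≤ ∫⁻ x, ENNReal.ofReal (f x) ∂μ := by
  rw [integral_eq_lintegral_pos_part_sub_lintegral_neg_part hf]
  exact (ENNReal.ofReal_le_ofReal (sub_le_self _ ENNReal.toReal_nonneg)).trans
    ENNReal.ofReal_toReal_le

theorem ofReal_exp_integral_le {α : Type*} [MeasurableSpace α] {μ : Measure α}
    [IsProbabilityMeasure μ] {f : α → ℝ} (hf : Integrable f μ) :
    ENNReal.ofReal (Real.exp (∫ x, f x ∂μ)) ≤ ∫⁻ x, ENNReal.ofReal (Real.exp (f x)) ∂μ := by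
  set m := ∫ x, f x ∂μ with hm
  have hi : Integrable (fun x => Real.exp m * (1 + (f x - m))) μ := by fun_prop
  have h1 : ∫ x, Real.exp m * (1 + (f x - m)) ∂μ = Real.exp m := by
    rw [integral_const_mul, integral_add (by fun_prop) (by fun_prop),
      integral_sub hf (by fun_prop), ← hm]
    simp
  rw [← h1]
  refine (ofReal_integral_le_lintegral_ofReal hi).trans
    (lintegral_mono fun x => ENNReal.ofReal_le_ofReal ?_)
  have h2 := Real.add_one_le_exp (f x - m)
  calc Real.exp m * (1 + (f x - m)) ≤ Real.exp m * Real.exp (f x - m) := by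
        gcongr
        linarith
    _ = Real.exp (f x) := by rw [← Real.exp_add]; congr 1; ring

section Concentration

variable {n : ℕ} {h : EuclideanSpace ℝ (Fin n) → ℝ} {R : ℝ}

theorem continuous_of_abs_sub_le (hh : ∀ u v, |h u - h v| ≤ R * ‖u - v‖) : Continuous h := by
  refine (LipschitzWith.of_dist_le_mul (K := R.toNNReal) fun u v => ?_).continuous
  rw [Real.dist_eq, dist_eq_norm]
  exact (hh u v).trans (mul_le_mul_of_nonneg_right (Real.le_coe_toNNReal R) (norm_nonneg _))

theorem integrable_stdGaussian_of_lipschitz (hh : ∀ u v, |h u - h v| ≤ R * ‖u - v‖) :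
    Integrable h (ProbabilityTheory.stdGaussian _) := by
  have h1 : Integrable (fun x : EuclideanSpace ℝ (Fin n) => |h 0| + R * ‖x‖)
      (ProbabilityTheory.stdGaussian _) :=
    (integrable_const _).add ((ProbabilityTheory.IsGaussian.integrable_id.norm).const_mul R)
  refine h1.mono' (continuous_of_abs_sub_le hh).aestronglyMeasurable (.of_forall fun x => ?_)
  have h2 := hh x 0
  rw [sub_zero] at h2
  have h3 := abs_sub_abs_le_abs_sub (h x) (h 0)
  rw [Real.norm_eq_abs]
  linarith

theorem lintegral_exp_mul_sub_integral_le (hh : ∀ u v, |h u - h v| ≤ R * ‖u - v‖) (l : ℝ) :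
    ∫⁻ x, ENNReal.ofReal (Real.exp (l * h x)) ∂ProbabilityTheory.stdGaussian _ ≤
      ENNReal.ofReal (Real.exp (l * (∫ x, h x ∂ProbabilityTheory.stdGaussian _) +
        l ^ 2 * R ^ 2)) := by
  have hc := continuous_of_abs_sub_le hh
  set γ := ProbabilityTheory.stdGaussian (EuclideanSpace ℝ (Fin n))
  set m := ∫ x, h x ∂γ
  have hI := (integrable_stdGaussian_of_lipschitz hh).const_mul (-l)
  have hJ := ofReal_exp_integral_le hI
  rw [integral_const_mul] at hJ
  have hmul := lintegral_mul_lintegral_stdGaussian_le_one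
    (f := fun x => ENNReal.ofReal (Real.exp (l * h x - l ^ 2 * R ^ 2)))
    (g := fun x => ENNReal.ofReal (Real.exp (-l * h x))) (by fun_prop) (by fun_prop) fun x y => by
      rw [← ENNReal.ofReal_mul (by positivity), ← Real.exp_add]
      refine ENNReal.ofReal_le_ofReal (Real.exp_le_exp.mpr ?_)
      have h1 : l * (h x - h y) ≤ |l| * (R * ‖x - y‖) := (le_abs_self _).trans (by
        rw [abs_mul]
        exact mul_le_mul_of_nonneg_left (hh x y) (abs_nonneg l))
      have h2 : |l| ^ 2 = l ^ 2 := sq_abs l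
      nlinarith [sq_nonneg (‖x - y‖ / 2 - |l| * R)]
  have h1 : (∫⁻ x, ENNReal.ofReal (Real.exp (l * h x - l ^ 2 * R ^ 2)) ∂γ) *
      ENNReal.ofReal (Real.exp (-l * m)) ≤ 1 := le_trans (by gcongr) hmul
  have h2 : ∀ x, ENNReal.ofReal (Real.exp (l * h x)) =
      ENNReal.ofReal (Real.exp (l ^ 2 * R ^ 2)) *
        ENNReal.ofReal (Real.exp (l * h x - l ^ 2 * R ^ 2)) := fun x => by
    rw [← ENNReal.ofReal_mul (by positivity), ← Real.exp_add]
    congr 2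
    ring
  simp_rw [h2]
  rw [lintegral_const_mul _ (by fun_prop)]
  have h3 : Real.exp (l * m + l ^ 2 * R ^ 2) =
      Real.exp (l ^ 2 * R ^ 2) * (Real.exp (-l * m))⁻¹ := by
    rw [← Real.exp_neg, ← Real.exp_add]
    congr 1
    ring
  rw [h3, ENNReal.ofReal_mul (by positivity), ENNReal.ofReal_inv_of_pos (by positivity)]
  gcongr
  exact ENNReal.le_inv_iff_mul_le.mpr h1

theorem measure_le_sub_integral_le (hR : 0 < R) (hh : ∀ u v, |h u - h v| ≤ R * ‖u - v‖)
    {s : ℝ} (hs : 0 ≤ s) :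
    ProbabilityTheory.stdGaussian _ {x | s ≤ h x - ∫ x, h x ∂ProbabilityTheory.stdGaussian _} ≤
      ENNReal.ofReal (Real.exp (-(s ^ 2 / (4 * R ^ 2)))) := by
  have hc := continuous_of_abs_sub_le hh
  set m := ∫ x, h x ∂ProbabilityTheory.stdGaussian _ with hm
  set l := s / (2 * R ^ 2) with hl
  have hl0 : 0 ≤ l := by positivity
  have h1 := mul_meas_ge_le_lintegral
    (μ := ProbabilityTheory.stdGaussian (EuclideanSpace ℝ (Fin n)))
    (f := fun x => ENNReal.ofReal (Real.exp (l * h x))) (by fun_prop)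
    (ENNReal.ofReal (Real.exp (l * (m + s))))
  have h2 := h1.trans (lintegral_exp_mul_sub_integral_le hh l)
  rw [← hm] at h2
  have h3 : Real.exp (l * m + l ^ 2 * R ^ 2) =
      Real.exp (l * (m + s)) * Real.exp (-(s ^ 2 / (4 * R ^ 2))) := by
    rw [← Real.exp_add]
    congr 1
    rw [hl]
    field_simp
    ring
  rw [h3, ENNReal.ofReal_mul (by positivity), ENNReal.mul_le_mul_iff_right
    (ENNReal.ofReal_pos.mpr (Real.exp_pos _)).ne' ENNReal.ofReal_ne_top] at h2
  refine (measure_mono fun x hx => ?_).trans h2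
  simp only [mem_ofPred_eq] at hx ⊢
  exact ENNReal.ofReal_le_ofReal (Real.exp_le_exp.mpr (mul_le_mul_of_nonneg_left (by linarith) hl0))

theorem measure_le_abs_sub_integral_le (hR : 0 < R) (hh : ∀ u v, |h u - h v| ≤ R * ‖u - v‖)
    {s : ℝ} (hs : 0 ≤ s) :
    ProbabilityTheory.stdGaussian _ {x | s ≤ |h x - ∫ x, h x ∂ProbabilityTheory.stdGaussian _|} ≤
      2 * ENNReal.ofReal (Real.exp (-(s ^ 2 / (4 * R ^ 2)))) := by
  have hh' : ∀ u v, |(-h u) - (-h v)| ≤ R * ‖u - v‖ := fun u v => by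
    rw [← abs_neg]
    convert hh u v using 2
    ring
  have h1 := measure_le_sub_integral_le hR hh hs
  have h2 := measure_le_sub_integral_le (h := fun x => -h x) hR hh' hs
  rw [integral_neg] at h2
  rw [two_mul]
  refine ((measure_mono fun x hx => ?_).trans (measure_union_le _ _)).trans (add_le_add h1 h2)
  simp only [mem_union, mem_ofPred_eq] at hx ⊢
  rcases le_abs.mp hx with h | h
  · exact .inl h
  · exact .inr (by linarith)

theorem le_integral_stdGaussian_of_moment (hh : ∀ u v, |h u - h v| ≤ R * ‖u - v‖)
    (h0 : ∀ x, 0 ≤ h x) {q : ℕ} (hq : 0 < q) {T : ℝ} (hT : 0 < T)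
    (hmom : ENNReal.ofReal (T ^ q) ≤
      ∫⁻ x, ENNReal.ofReal (h x ^ q) ∂ProbabilityTheory.stdGaussian _)
    (hRT : Real.exp 4 * R ^ 2 * q ≤ T ^ 2) :
    Real.exp (-2) * T ≤ ∫ x, h x ∂ProbabilityTheory.stdGaussian _ := by
  have hc := continuous_of_abs_sub_le hh
  have hexp := lintegral_exp_mul_sub_integral_le hh
  set m := ∫ x, h x ∂ProbabilityTheory.stdGaussian _ with hm
  by_contra! hlt
  have hq' : (0 : ℝ) < q := by exact_mod_cast hq
  set b := Real.exp (-2) * T with hb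
  have hb0 : 0 < b := by positivity
  set l := q / b with hl
  have hl0 : 0 < l := by positivity
  have hlb : l * b = q := by rw [hl]; field_simp
  have hRb : R ^ 2 * q ≤ b ^ 2 := by
    have h1 : Real.exp 4 * Real.exp (-2) ^ 2 = 1 := by
      rw [← Real.exp_nat_mul, ← Real.exp_add]
      norm_num
    calc R ^ 2 * q = Real.exp 4 * Real.exp (-2) ^ 2 * (R ^ 2 * q) := by rw [h1, one_mul]
      _ = Real.exp (-2) ^ 2 * (Real.exp 4 * R ^ 2 * q) := by ring
      _ ≤ Real.exp (-2) ^ 2 * T ^ 2 := by gcongr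
      _ = b ^ 2 := by rw [hb]; ring
  have hlR : l ^ 2 * R ^ 2 ≤ q := by
    refine le_of_mul_le_mul_right ?_ (pow_pos hb0 2)
    calc l ^ 2 * R ^ 2 * b ^ 2 = (l * b) ^ 2 * R ^ 2 := by ring
      _ = q * (R ^ 2 * q) := by rw [hlb]; ring
      _ ≤ q * b ^ 2 := by gcongr
  have hpt : ∀ x, h x ^ q ≤ b ^ q * Real.exp (-q) * Real.exp (l * h x) := by
    intro x
    have h1 : h x ≤ b * Real.exp (h x / b - 1) := by
      have := Real.add_one_le_exp (h x / b - 1)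
      calc h x = b * (h x / b - 1 + 1) := by field_simp; ring
        _ ≤ _ := by gcongr
    calc h x ^ q ≤ (b * Real.exp (h x / b - 1)) ^ q := pow_le_pow_left₀ (h0 x) h1 q
      _ = b ^ q * Real.exp (-q) * Real.exp (l * h x) := by
        rw [mul_pow, ← Real.exp_nat_mul, mul_assoc, ← Real.exp_add]
        congr 2
        rw [hl]
        ring
  have hfin : ENNReal.ofReal (T ^ q) ≤
      ENNReal.ofReal (b ^ q * Real.exp (-q) * Real.exp (l * m + l ^ 2 * R ^ 2)) := by
    refine hmom.trans ?_
    rw [ENNReal.ofReal_mul (by positivity)]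
    refine le_trans ?_ (mul_le_mul_right (hexp l) _)
    rw [← lintegral_const_mul _ (by fun_prop)]
    refine lintegral_mono fun x => ?_
    rw [← ENNReal.ofReal_mul (by positivity)]
    exact ENNReal.ofReal_le_ofReal (hpt x)
  rw [ENNReal.ofReal_le_ofReal_iff (by positivity)] at hfin
  have h4 : b ^ q * Real.exp (-q) * Real.exp (l * m + l ^ 2 * R ^ 2) < T ^ q := by
    have h5 : l * m < q := by
      rw [← hlb]
      gcongr
    calc b ^ q * Real.exp (-q) * Real.exp (l * m + l ^ 2 * R ^ 2)
        < b ^ q * Real.exp (-q) * Real.exp (3 * q) := by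
          gcongr
          linarith
      _ = T ^ q := by
        rw [mul_assoc, ← Real.exp_add, hb, mul_pow, ← Real.exp_nat_mul, mul_right_comm,
          ← Real.exp_add]
        ring_nf
        simp
  exact absurd hfin (not_le.mpr h4)

end Concentration

theorem lintegral_sq_gaussianReal :
    ∫⁻ t, ENNReal.ofReal (t ^ 2) ∂ProbabilityTheory.gaussianReal 0 1 = 1 := by
  have h := ProbabilityTheory.variance_id_gaussianReal (μ := 0) (v := 1)
  have hL : MemLp id 2 (ProbabilityTheory.gaussianReal 0 1) :=
    ProbabilityTheory.IsGaussian.memLp_two_id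
  rw [ProbabilityTheory.variance_of_integral_eq_zero aemeasurable_id (by simp)] at h
  rw [NNReal.coe_one] at h
  rw [← ENNReal.ofReal_one, ← h]
  exact (ofReal_integral_eq_lintegral_ofReal hL.integrable_sq
    (.of_forall fun t => sq_nonneg t)).symm

theorem lintegral_inner_sq_stdGaussian {n : ℕ} (v : EuclideanSpace ℝ (Fin n)) :
    ∫⁻ g, ENNReal.ofReal (inner ℝ v g ^ 2) ∂ProbabilityTheory.stdGaussian _ =
      ENNReal.ofReal (‖v‖ ^ 2) := by
  rcases eq_or_ne v 0 with rfl | hv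
  · simp
  have hv' : ‖v‖ ≠ 0 := norm_ne_zero_iff.mpr hv
  set u := ‖v‖⁻¹ • v with hu
  have hun : ‖u‖ = 1 := by rw [hu, norm_smul, norm_inv, norm_norm, inv_mul_cancel₀ hv']
  have hvu : v = ‖v‖ • u := by rw [hu, smul_smul, mul_inv_cancel₀ hv', one_smul]
  have h := lintegral_sq_gaussianReal
  rw [← map_inner_stdGaussian hun, lintegral_map (by fun_prop) (by fun_prop)] at h
  have h2 : ∀ g, ENNReal.ofReal (inner ℝ v g ^ 2) =
      ENNReal.ofReal (‖v‖ ^ 2) * ENNReal.ofReal (inner ℝ u g ^ 2) := fun g => by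
    rw [← ENNReal.ofReal_mul (by positivity), ← mul_pow]
    congr 2
    conv_lhs => rw [hvu, inner_smul_left]
    simp
  simp_rw [h2]
  rw [lintegral_const_mul _ (by fun_prop), h, mul_one]

section GaussianMatrix

variable {q n : ℕ}

/-- The product of a `q × n` matrix with a column vector. -/
noncomputable def mulCol (Γ : EuclideanSpace ℝ (Fin q × Fin n)) (x : EuclideanSpace ℝ (Fin n)) :
    EuclideanSpace ℝ (Fin q) :=
  WithLp.toLp 2 fun i => ∑ j, Γ (i, j) * x j

/-- The product of a row vector with a `q × n` matrix. -/
noncomputable def rowMul (t : EuclideanSpace ℝ (Fin q)) (Γ : EuclideanSpace ℝ (Fin q × Fin n)) :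
    EuclideanSpace ℝ (Fin n) :=
  WithLp.toLp 2 fun j => ∑ i, t i * Γ (i, j)

theorem inner_mulCol (Γ : EuclideanSpace ℝ (Fin q × Fin n)) (x : EuclideanSpace ℝ (Fin n))
    (t : EuclideanSpace ℝ (Fin q)) :
    inner ℝ t (mulCol Γ x) = inner ℝ (rowMul t Γ) x := by
  simp only [mulCol, rowMul, PiLp.inner_apply, RCLike.inner_apply, conj_trivial,
    Finset.mul_sum, Finset.sum_mul]
  rw [Finset.sum_comm]
  exact Finset.sum_congr rfl fun i _ => Finset.sum_congr rfl fun j _ => by ring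

/-- The rank-one matrix `t xᵀ`. -/
noncomputable def outer (t : EuclideanSpace ℝ (Fin q)) (x : EuclideanSpace ℝ (Fin n)) :
    EuclideanSpace ℝ (Fin q × Fin n) :=
  WithLp.toLp 2 fun p => t p.1 * x p.2

theorem norm_outer (t : EuclideanSpace ℝ (Fin q)) (x : EuclideanSpace ℝ (Fin n)) :
    ‖outer t x‖ = ‖t‖ * ‖x‖ := by
  simp only [outer, EuclideanSpace.norm_eq, Fintype.sum_prod_type]
  rw [← Real.sqrt_mul (by positivity), Finset.sum_mul_sum]
  simp [mul_pow]

theorem inner_rowMul (Γ : EuclideanSpace ℝ (Fin q × Fin n)) (x : EuclideanSpace ℝ (Fin n))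
    (t : EuclideanSpace ℝ (Fin q)) :
    inner ℝ (rowMul t Γ) x = inner ℝ Γ (outer t x) := by
  simp only [outer, rowMul, PiLp.inner_apply, RCLike.inner_apply, conj_trivial,
    Finset.mul_sum, Fintype.sum_prod_type]
  rw [Finset.sum_comm]
  exact Finset.sum_congr rfl fun i _ => Finset.sum_congr rfl fun j _ => by ring

theorem map_rowMul_stdGaussian {t : EuclideanSpace ℝ (Fin q)} (ht : ‖t‖ = 1) :
    (ProbabilityTheory.stdGaussian (EuclideanSpace ℝ (Fin q × Fin n))).map (rowMul t) =
      ProbabilityTheory.stdGaussian _ := by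
  let L : EuclideanSpace ℝ (Fin q × Fin n) →ₗ[ℝ] EuclideanSpace ℝ (Fin n) :=
    { toFun := rowMul t
      map_add' := fun a b => by ext; simp [rowMul, mul_add, Finset.sum_add_distrib]
      map_smul' := fun c a => by ext; simp [rowMul, Finset.mul_sum, mul_left_comm] }
  exact map_stdGaussian_of_adjoint_isometry (LinearMap.toContinuousLinearMap L) (outer t)
    (fun Γ x => inner_rowMul Γ x t) (fun x => by rw [norm_outer, ht, one_mul])

theorem map_mulCol_stdGaussian {x : EuclideanSpace ℝ (Fin n)} (hx : ‖x‖ = 1) :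
    (ProbabilityTheory.stdGaussian (EuclideanSpace ℝ (Fin q × Fin n))).map (fun Γ => mulCol Γ x) =
      ProbabilityTheory.stdGaussian _ := by
  let L : EuclideanSpace ℝ (Fin q × Fin n) →ₗ[ℝ] EuclideanSpace ℝ (Fin q) :=
    { toFun := fun Γ => mulCol Γ x
      map_add' := fun a b => by ext; simp [mulCol, add_mul, Finset.sum_add_distrib]
      map_smul' := fun c a => by ext; simp [mulCol, Finset.mul_sum, mul_assoc] }
  refine map_stdGaussian_of_adjoint_isometry (LinearMap.toContinuousLinearMap L)
    (fun t => outer t x) (fun Γ t => ?_) (fun t => by rw [norm_outer, hx, mul_one])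
  rw [← inner_rowMul, ← inner_mulCol, real_inner_comm]
  rfl

theorem mulCol_smul (Γ : EuclideanSpace ℝ (Fin q × Fin n)) (c : ℝ) (x : EuclideanSpace ℝ (Fin n)) :
    mulCol Γ (c • x) = c • mulCol Γ x := by
  ext; simp [mulCol, Finset.mul_sum, mul_left_comm]

theorem mulCol_add (Γ : EuclideanSpace ℝ (Fin q × Fin n)) (x y : EuclideanSpace ℝ (Fin n)) :
    mulCol Γ (x + y) = mulCol Γ x + mulCol Γ y := by
  ext; simp [mulCol, mul_add, Finset.sum_add_distrib]

theorem rowMul_smul (Γ : EuclideanSpace ℝ (Fin q × Fin n)) (c : ℝ) (t : EuclideanSpace ℝ (Fin q)) :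
    rowMul (c • t) Γ = c • rowMul t Γ := by
  ext; simp [rowMul, Finset.mul_sum, mul_assoc]

theorem rowMul_add (Γ : EuclideanSpace ℝ (Fin q × Fin n)) (s t : EuclideanSpace ℝ (Fin q)) :
    rowMul (s + t) Γ = rowMul s Γ + rowMul t Γ := by
  ext; simp [rowMul, add_mul, Finset.sum_add_distrib]

theorem continuous_mulCol : Continuous fun p :
    EuclideanSpace ℝ (Fin q × Fin n) × EuclideanSpace ℝ (Fin n) => mulCol p.1 p.2 := by
  unfold mulCol
  fun_prop

theorem continuous_rowMul : Continuous fun p :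
    EuclideanSpace ℝ (Fin q) × EuclideanSpace ℝ (Fin q × Fin n) => rowMul p.1 p.2 := by
  unfold rowMul
  fun_prop

theorem lintegral_norm_mulCol_sq (x : EuclideanSpace ℝ (Fin n)) :
    ∫⁻ Γ, ENNReal.ofReal (‖mulCol Γ x‖ ^ 2)
      ∂ProbabilityTheory.stdGaussian (EuclideanSpace ℝ (Fin q × Fin n)) =
      ENNReal.ofReal (q * ‖x‖ ^ 2) := by
  rcases eq_or_ne x 0 with rfl | hv
  · have h0 : ∀ Γ : EuclideanSpace ℝ (Fin q × Fin n), mulCol Γ 0 = 0 := fun Γ => by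
      ext; simp [mulCol]
    simp [h0]
  have hv' : ‖x‖ ≠ 0 := norm_ne_zero_iff.mpr hv
  set u := ‖x‖⁻¹ • x with hu
  have hun : ‖u‖ = 1 := by rw [hu, norm_smul, norm_inv, norm_norm, inv_mul_cancel₀ hv']
  have hvu : x = ‖x‖ • u := by rw [hu, smul_smul, mul_inv_cancel₀ hv', one_smul]
  have hm : Measurable fun Γ : EuclideanSpace ℝ (Fin q × Fin n) => mulCol Γ u :=
    (continuous_mulCol.comp (by fun_prop : Continuous fun Γ => (Γ, u))).measurable
  have h := lintegral_norm_sq_of_isotropic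
    (μ := ProbabilityTheory.stdGaussian (EuclideanSpace ℝ (Fin q))) lintegral_inner_sq_stdGaussian
  rw [← map_mulCol_stdGaussian hun, lintegral_map (by fun_prop) hm] at h
  have h2 : ∀ Γ : EuclideanSpace ℝ (Fin q × Fin n), ENNReal.ofReal (‖mulCol Γ x‖ ^ 2) =
      ENNReal.ofReal (‖x‖ ^ 2) * ENNReal.ofReal (‖mulCol Γ u‖ ^ 2) := fun Γ => by
    rw [← ENNReal.ofReal_mul (by positivity), ← mul_pow]
    congr 2
    conv_lhs => rw [hvu, mulCol_smul, norm_smul, norm_norm]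
  simp_rw [h2]
  rw [lintegral_const_mul _ (by fun_prop), h, mul_comm, ENNReal.ofReal_mul (by positivity),
    ENNReal.ofReal_natCast]

end GaussianMatrix

theorem le_of_net_of_seminorm {q : ℕ} {p : EuclideanSpace ℝ (Fin q) → ℝ} (hp : Continuous p)
    (hadd : ∀ s t, p (s + t) ≤ p s + p t) (hsmul : ∀ (c : ℝ) t, p (c • t) = |c| * p t)
    {F : Set (EuclideanSpace ℝ (Fin q))}
    (hF : ∀ t, ‖t‖ = 1 → ∃ x ∈ F, ‖t - x‖ ≤ 1 / 10) {m : ℝ}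
    (h : ∀ x ∈ F, |p x - m| ≤ m / 2) (t : EuclideanSpace ℝ (Fin q)) (ht : ‖t‖ = 1) :
    m / 3 ≤ p t := by
  obtain ⟨t₀, ht₀, hmax⟩ := (isCompact_sphere (0 : EuclideanSpace ℝ (Fin q)) 1).exists_isMaxOn
    ⟨t, by simpa using ht⟩ hp.continuousOn
  have hM : ∀ s, p s ≤ p t₀ * ‖s‖ := by
    intro s
    rcases eq_or_ne s 0 with rfl | hs
    · have := hsmul 0 0
      simp at this
      simp [this]
    have hs' : ‖s‖ ≠ 0 := norm_ne_zero_iff.mpr hs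
    have h1 : p (‖s‖⁻¹ • s) ≤ p t₀ := hmax (by simp [norm_smul, hs'])
    rw [hsmul, abs_inv, abs_norm, inv_mul_le_iff₀ (by positivity)] at h1
    linarith
  have hM0 : 0 ≤ p t₀ := by
    have h1 := hadd t₀ ((-1 : ℝ) • t₀)
    have h2 := hsmul 0 0
    rw [hsmul] at h1
    simp at h1 h2
    rw [h2] at h1
    linarith
  have hstep : ∀ s, ‖s‖ = 1 → |p s - m| ≤ m / 2 + p t₀ / 10 := by
    intro s hs
    obtain ⟨x, hx, hsx⟩ := hF s hs
    have h1 := abs_le.mp (h x hx)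
    have h2 := hadd x (s - x)
    have h3 := hadd s (x - s)
    have h4 := hM (s - x)
    have h5 := hM (x - s)
    rw [norm_sub_rev] at h5
    rw [add_sub_cancel] at h2 h3
    have h6 : p t₀ * ‖s - x‖ ≤ p t₀ * (1 / 10) := by gcongr
    rw [abs_le]
    constructor <;> linarith
  have h1 := (abs_le.mp (hstep t₀ (by simpa using ht₀))).2
  have h2 := (abs_le.mp (hstep t ht)).1
  linarith

theorem measure_compl_norm_mulCol_le {q n : ℕ} {x : EuclideanSpace ℝ (Fin n)} {ρ : ℝ} (hρ : 0 < ρ)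
    (h : 4 * (q * ‖x‖ ^ 2) ≤ ρ ^ 2) :
    ProbabilityTheory.stdGaussian (EuclideanSpace ℝ (Fin q × Fin n)) {Γ | ‖mulCol Γ x‖ ≤ ρ}ᶜ ≤
      ENNReal.ofReal (1 / 4) := by
  have hρ0 : 0 < ρ ^ 2 := by positivity
  have hc : Continuous fun Γ : EuclideanSpace ℝ (Fin q × Fin n) => mulCol Γ x :=
    continuous_mulCol.comp (by fun_prop : Continuous fun Γ => (Γ, x))
  have h2 := mul_meas_ge_le_lintegral
    (μ := ProbabilityTheory.stdGaussian (EuclideanSpace ℝ (Fin q × Fin n)))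
    (f := fun Γ => ENNReal.ofReal (‖mulCol Γ x‖ ^ 2)) (by fun_prop) (ENNReal.ofReal (ρ ^ 2))
  rw [lintegral_norm_mulCol_sq] at h2
  have h4 := h2.trans (ENNReal.ofReal_le_ofReal (q := ρ ^ 2 * (1 / 4)) (by linarith))
  rw [ENNReal.ofReal_mul hρ0.le, ENNReal.mul_le_mul_iff_right
    (ENNReal.ofReal_pos.mpr hρ0).ne' ENNReal.ofReal_ne_top] at h4
  refine (measure_mono fun Γ hΓ => ?_).trans h4
  simp only [mem_compl_iff, mem_ofPred_eq, not_le] at hΓ ⊢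
  exact ENNReal.ofReal_le_ofReal (by gcongr)

section SmallBall

variable {q n : ℕ} {μ : Measure (EuclideanSpace ℝ (Fin n))} [IsProbabilityMeasure μ]

theorem measureReal_norm_mulCol_le (hμ : MidPL μ) (hs : μ.map Neg.neg = μ)
    (hiso : ∀ v, ∫⁻ x, ENNReal.ofReal (inner ℝ v x ^ 2) ∂μ = ENNReal.ofReal (‖v‖ ^ 2))
    (hq : 0 < q) {r ρ : ℝ} (hρ : 0 < ρ) (hρr : ρ ≤ r / 8)
    (Γ : EuclideanSpace ℝ (Fin q × Fin n))
    (hΓ : ∀ t, ‖t‖ = 1 → r ≤ momNorm μ q (rowMul t Γ)) :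
    μ.real {x | ‖mulCol Γ x‖ ≤ ρ} ≤ (Real.exp 1 * (ρ / (r / 7000))) ^ q := by
  let L : EuclideanSpace ℝ (Fin n) →ₗ[ℝ] EuclideanSpace ℝ (Fin q) :=
    { toFun := mulCol Γ
      map_add' := mulCol_add Γ
      map_smul' := mulCol_smul Γ }
  have hLm : Measurable L :=
    (continuous_mulCol.comp (by fun_prop : Continuous fun x => (Γ, x))).measurable
  have hL : ∀ x, L x = mulCol Γ x := fun x => rfl
  have : IsProbabilityMeasure (μ.map L) := Measure.isProbabilityMeasure_map hLm.aemeasurable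
  have h := ballMass_zero_le (ν := μ.map L) (hμ.map L hLm) ?_ hq hρ hρr ?_
  · rw [map_measureReal_apply hLm measurableSet_closedBall] at h
    convert h using 3
    ext x
    simp [hL]
  · conv_rhs => rw [← hs]
    rw [Measure.map_map measurable_neg hLm, Measure.map_map hLm measurable_neg]
    congr 1
    ext1 x
    simp
  · intro t ht
    rw [lintegral_map (by fun_prop) hLm]
    simp_rw [hL, inner_mulCol]
    rw [← ofReal_momNorm_pow hμ hs hiso hq]
    exact ENNReal.ofReal_le_ofReal (pow_le_pow_left₀ (by linarith) (hΓ t ht) q)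

theorem measure_exists_momNorm_rowMul_lt_le (hμ : MidPL μ) (hs : μ.map Neg.neg = μ)
    (hiso : ∀ v, ∫⁻ x, ENNReal.ofReal (inner ℝ v x ^ 2) ∂μ = ENNReal.ofReal (‖v‖ ^ 2))
    (hq : 2 ≤ q) (hqn : 86400 * Real.exp 10 * q ^ 2 ≤ n) :
    ∃ G : Set (EuclideanSpace ℝ (Fin q × Fin n)), MeasurableSet G ∧
      ProbabilityTheory.stdGaussian _ Gᶜ ≤ ENNReal.ofReal (1 / 4) ∧
      ∀ Γ ∈ G, ∀ t, ‖t‖ = 1 →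
        Real.exp (-5) * (Real.sqrt q * Real.sqrt n) / 3 ≤ momNorm μ q (rowMul t Γ) := by
  have hq0 : 0 < q := by omega
  have hqr : (0 : ℝ) < q := by exact_mod_cast hq0
  have hn0 : (0 : ℝ) < n := lt_of_lt_of_le (by positivity) hqn
  set h := momNorm μ q with hh
  have hlip : ∀ u v, |h u - h v| ≤ (30 * q : ℝ) * ‖u - v‖ := lipschitz_momNorm hμ hs hiso hq0
  have hcont : Continuous h := continuous_momNorm hμ hs hiso hq0
  set m := ∫ x, h x ∂ProbabilityTheory.stdGaussian (EuclideanSpace ℝ (Fin n)) with hm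
  set T := Real.exp (-3) * Real.sqrt q * Real.sqrt n with hT
  have hTsq : T ^ 2 = Real.exp (-6) * q * n := by
    rw [hT, mul_pow, mul_pow, Real.sq_sqrt hqr.le, Real.sq_sqrt hn0.le, ← Real.exp_nat_mul]
    norm_num
  have hee : Real.exp 10 * Real.exp (-6) = Real.exp 4 := by rw [← Real.exp_add]; norm_num
  have hmT : Real.exp (-2) * T ≤ m := by
    refine le_integral_stdGaussian_of_moment hlip (fun x => momNorm_nonneg x) hq0 (by positivity)
      (le_lintegral_momNorm_pow hμ hs hiso hq) ?_
    rw [hTsq, ← hee]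
    have h1 : (0 : ℝ) < Real.exp (-6) * q := by positivity
    have h2 : (0 : ℝ) < Real.exp 10 * q ^ 2 := by positivity
    nlinarith
  have hm5 : Real.exp (-5) * (Real.sqrt q * Real.sqrt n) ≤ m := by
    refine le_trans (le_of_eq ?_) hmT
    rw [hT, ← mul_assoc, ← mul_assoc, ← mul_assoc, ← Real.exp_add]
    norm_num
  have hm0 : 0 ≤ m := le_trans (by positivity) hm5
  have hmsq : 6 * q ≤ (m / 2) ^ 2 / (4 * (30 * q : ℝ) ^ 2) := by
    rw [le_div_iff₀ (by positivity)]
    have h1 : (Real.exp (-5) * (Real.sqrt q * Real.sqrt n)) ^ 2 ≤ m ^ 2 := by gcongr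
    have h2 : Real.exp 10 * (Real.exp (-5) * (Real.sqrt q * Real.sqrt n)) ^ 2 = q * n := by
      rw [mul_pow, mul_pow, Real.sq_sqrt hqr.le, Real.sq_sqrt hn0.le, ← Real.exp_nat_mul,
        ← mul_assoc, ← Real.exp_add]
      norm_num
    have h3 : q * (86400 * Real.exp 10 * q ^ 2) ≤ Real.exp 10 * m ^ 2 := by
      calc q * (86400 * Real.exp 10 * q ^ 2) ≤ q * (n : ℝ) := by gcongr
        _ ≤ _ := by rw [← h2]; gcongr
    have h4 : 0 < Real.exp 10 := Real.exp_pos _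
    have h5 : (q : ℝ) * (86400 * q ^ 2) ≤ m ^ 2 := le_of_mul_le_mul_left (by linarith) h4
    linarith
  obtain ⟨F, hF1, hFc, hF⟩ := exists_sphere_net q hq0
  have hrm : ∀ t : EuclideanSpace ℝ (Fin q), Measurable (rowMul (n := n) t) := fun t =>
    (continuous_rowMul.comp (by fun_prop : Continuous fun Γ => (t, Γ))).measurable
  have hbad : ∀ t, MeasurableSet {Γ : EuclideanSpace ℝ (Fin q × Fin n) |
      m / 2 ≤ |h (rowMul t Γ) - m|} := fun t =>
    measurableSet_le measurable_const ((hcont.measurable.comp (hrm t)).sub_const m).abs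
  refine ⟨(⋃ t ∈ F, {Γ | m / 2 ≤ |h (rowMul t Γ) - m|})ᶜ,
    (Finset.measurableSet_biUnion _ fun t _ => hbad t).compl, ?_, ?_⟩
  · rw [compl_compl]
    refine (measure_biUnion_finset_le _ _).trans ?_
    have h1 : ∀ t ∈ F, ProbabilityTheory.stdGaussian (EuclideanSpace ℝ (Fin q × Fin n))
        {Γ | m / 2 ≤ |h (rowMul t Γ) - m|} ≤ ENNReal.ofReal (2 * Real.exp (-6) ^ q) := by
      intro t ht
      have h2 := measure_le_abs_sub_integral_le (R := 30 * q) (by positivity) hlip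
        (s := m / 2) (by positivity)
      rw [← hm, ← map_rowMul_stdGaussian (hF1 t ht), Measure.map_apply (hrm t)
        (measurableSet_le measurable_const (hcont.measurable.sub_const m).abs)] at h2
      refine h2.trans ?_
      rw [ENNReal.ofReal_mul (by positivity), ENNReal.ofReal_ofNat, ← Real.exp_nat_mul]
      gcongr
      linarith
    refine (Finset.sum_le_sum h1).trans ?_
    rw [Finset.sum_const, nsmul_eq_mul, ← ENNReal.ofReal_natCast,
      ← ENNReal.ofReal_mul (by positivity)]
    refine ENNReal.ofReal_le_ofReal ?_
    have h3 : Real.exp (-6) ≤ 1 / 300 := by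
      rw [Real.exp_neg, one_div]
      refine inv_anti₀ (by norm_num) ?_
      have : (2.7 : ℝ) ^ 6 ≤ Real.exp 1 ^ 6 := by
        gcongr
        linarith [Real.exp_one_gt_d9]
      rw [← Real.exp_nat_mul] at this
      norm_num at this
      linarith
    calc (F.card : ℝ) * (2 * Real.exp (-6) ^ q) ≤ 21 ^ q * (2 * (1 / 300) ^ q) := by
          gcongr
          exact_mod_cast hFc
      _ = 2 * (21 / 300) ^ q := by rw [mul_left_comm, ← mul_pow]; norm_num
      _ ≤ 2 * (21 / 300) ^ 1 := by
          gcongr ?_ * ?_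
          exact pow_le_pow_of_le_one (by norm_num) (by norm_num) (by omega)
      _ ≤ 1 / 4 := by norm_num
  · intro Γ hΓ t ht
    simp only [mem_compl_iff, mem_iUnion, mem_ofPred_eq, not_exists, not_le] at hΓ
    have h1 := le_of_net_of_seminorm (p := fun t => h (rowMul t Γ)) (F := F) (m := m)
      (hcont.comp (continuous_rowMul.comp (by fun_prop : Continuous fun t => (t, Γ))))
      (fun s t => by
        rw [rowMul_add]
        exact momNorm_add_le hμ hs hiso hq0 _ _)
      (fun c t => by rw [rowMul_smul]; exact momNorm_smul c _) hF (fun x hx => (hΓ x hx).le) t ht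
    linarith

theorem measure_closedBall_le (hμ : MidPL μ) (hs : μ.map Neg.neg = μ)
    (hiso : ∀ v, ∫⁻ x, ENNReal.ofReal (inner ℝ v x ^ 2) ∂μ = ENNReal.ofReal (‖v‖ ^ 2))
    (hq : 2 ≤ q) (hqn : 86400 * Real.exp 10 * q ^ 2 ≤ n) :
    μ (Metric.closedBall 0 (Real.exp (-7) / 42000 * Real.sqrt n)) ≤
      ENNReal.ofReal (2 * Real.exp (-q)) := by
  obtain ⟨G, hGm, hGc, hG⟩ := measure_exists_momNorm_rowMul_lt_le hμ hs hiso hq hqn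
  have hq0 : 0 < q := by omega
  have hqr : (0 : ℝ) < q := by exact_mod_cast hq0
  have hn0 : (0 : ℝ) < n := lt_of_lt_of_le (by positivity) hqn
  set ε := Real.exp (-7) / 42000 with hε
  set ρ := 2 * ε * (Real.sqrt q * Real.sqrt n) with hρ
  set P := ProbabilityTheory.stdGaussian (EuclideanSpace ℝ (Fin q × Fin n))
  have hsq : 0 < Real.sqrt q * Real.sqrt n := by positivity
  have hfib : ∀ Γ ∈ G, μ {x | ‖mulCol Γ x‖ ≤ ρ} ≤ ENNReal.ofReal (Real.exp (-q)) := by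
    intro Γ hΓ
    have h1 := measureReal_norm_mulCol_le hμ hs hiso hq0 (ρ := ρ)
      (r := Real.exp (-5) * (Real.sqrt q * Real.sqrt n) / 3) (by positivity) ?_ Γ (hG Γ hΓ)
    · have h2 : Real.exp 1 * (ρ / (Real.exp (-5) * (Real.sqrt q * Real.sqrt n) / 3 / 7000)) =
          Real.exp (-1) := by
        have h3 : Real.exp 1 * Real.exp (-7) = Real.exp (-1) * Real.exp (-5) := by
          rw [← Real.exp_add, ← Real.exp_add]
          norm_num
        have h4 : Real.exp (-5) ≠ 0 := (Real.exp_pos _).ne'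
        rw [hρ, hε]
        field_simp
        linarith
      rw [h2, ← Real.exp_nat_mul, mul_neg_one] at h1
      rw [← ofReal_measureReal]
      exact ENNReal.ofReal_le_ofReal h1
    · have h3 : Real.exp (-7) ≤ Real.exp (-5) := Real.exp_le_exp.mpr (by norm_num)
      rw [hρ, hε]
      have h4 := mul_le_mul_of_nonneg_right h3 hsq.le
      have h5 : 0 ≤ Real.exp (-7) * (Real.sqrt q * Real.sqrt n) := by positivity
      linarith
  have hBm : ∀ x, MeasurableSet {Γ : EuclideanSpace ℝ (Fin q × Fin n) | ‖mulCol Γ x‖ ≤ ρ} :=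
    fun x => measurableSet_le (continuous_mulCol.comp
      (by fun_prop : Continuous fun Γ => (Γ, x))).norm.measurable measurable_const
  have hcol : ∀ x ∈ Metric.closedBall (0 : EuclideanSpace ℝ (Fin n)) (ε * Real.sqrt n),
      ENNReal.ofReal (1 / 2) ≤ P (G ∩ {Γ | ‖mulCol Γ x‖ ≤ ρ}) := by
    intro x hx
    rw [mem_closedBall_zero_iff] at hx
    have h1 : P {Γ | ‖mulCol Γ x‖ ≤ ρ}ᶜ ≤ ENNReal.ofReal (1 / 4) := by
      refine measure_compl_norm_mulCol_le (by positivity) ?_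
      calc 4 * (q * ‖x‖ ^ 2) ≤ 4 * (q * (ε * Real.sqrt n) ^ 2) := by gcongr
        _ = ρ ^ 2 := by
          rw [hρ, mul_pow, mul_pow, mul_pow, mul_pow, Real.sq_sqrt hqr.le, Real.sq_sqrt hn0.le]
          ring
    have h2 : P (G ∩ {Γ | ‖mulCol Γ x‖ ≤ ρ})ᶜ ≤ ENNReal.ofReal (1 / 2) := by
      rw [compl_inter]
      refine (measure_union_le _ _).trans ((add_le_add hGc h1).trans (le_of_eq ?_))
      rw [← ENNReal.ofReal_add (by norm_num) (by norm_num)]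
      norm_num
    have h3 := prob_add_prob_compl (μ := P) (hGm.inter (hBm x))
    have h4 : ENNReal.ofReal (1 / 2) + ENNReal.ofReal (1 / 2) = 1 := by
      rw [← ENNReal.ofReal_add (by norm_num) (by norm_num)]
      norm_num
    refine (ENNReal.add_le_add_iff_right (a := ENNReal.ofReal (1 / 2)) ENNReal.ofReal_ne_top).mp ?_
    rw [h4, ← h3]
    gcongr
  set A := Metric.closedBall (0 : EuclideanSpace ℝ (Fin n)) (ε * Real.sqrt n)
  set S : Set (EuclideanSpace ℝ (Fin n) × EuclideanSpace ℝ (Fin q × Fin n)) :=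
    {p | p.2 ∈ G ∧ ‖mulCol p.2 p.1‖ ≤ ρ} with hS
  have hSm : MeasurableSet S := (measurable_snd hGm).inter
    (measurableSet_le (continuous_mulCol.comp continuous_swap).norm.measurable measurable_const)
  have hlow : ENNReal.ofReal (1 / 2) * μ A ≤ (μ.prod P) S := by
    rw [Measure.prod_apply hSm, ← setLIntegral_const]
    exact (setLIntegral_mono (measurable_measure_prodMk_left hSm) hcol).trans
      (setLIntegral_le_lintegral _ _)
  have hup : (μ.prod P) S ≤ ENNReal.ofReal (Real.exp (-q)) := by
    rw [Measure.prod_apply_symm hSm]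
    refine (lintegral_mono (g := fun _ => ENNReal.ofReal (Real.exp (-q))) fun Γ => ?_).trans
      (by simp)
    by_cases hΓ : Γ ∈ G
    · exact (measure_mono fun x hx => hx.2).trans (hfib Γ hΓ)
    · have : (fun x => (x, Γ)) ⁻¹' S = ∅ := by
        ext x
        simp [hS, hΓ]
      simp [this]
  have h2 : (1 : ENNReal) = ENNReal.ofReal 2 * ENNReal.ofReal (1 / 2) := by
    rw [← ENNReal.ofReal_mul (by norm_num)]
    norm_num
  calc μ A = ENNReal.ofReal 2 * (ENNReal.ofReal (1 / 2) * μ A) := by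
        rw [← mul_assoc, ← h2, one_mul]
    _ ≤ ENNReal.ofReal 2 * ENNReal.ofReal (Real.exp (-q)) := by
        gcongr
        exact hlow.trans hup
    _ = _ := by rw [← ENNReal.ofReal_mul (by norm_num)]

end SmallBall

section Avg

variable {E : Type*} [NormedAddCommGroup E] [InnerProductSpace ℝ E] [FiniteDimensional ℝ E]
  [MeasurableSpace E] [BorelSpace E]

/-- The law of the average of two independent samples from `ν`. -/
noncomputable def avg (ν : Measure E) : Measure E :=
  (ν.prod ν).map fun p => (1 / 2 : ℝ) • (p.1 + p.2)

instance (ν : Measure E) [IsProbabilityMeasure ν] : IsProbabilityMeasure (avg ν) :=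
  Measure.isProbabilityMeasure_map (by fun_prop)

theorem avg_le_of_le {ν ν₀ : Measure E} [SFinite ν] [SFinite ν₀] {c : NNReal} (h : ν ≤ c • ν₀) :
    avg ν ≤ c ^ 2 • avg ν₀ := by
  have h1 : ν.prod ν ≤ c ^ 2 • ν₀.prod ν₀ := by
    refine (Measure.prod_mono h h).trans (le_of_eq ?_)
    rw [Measure.prod_smul_left, Measure.prod_smul_right, smul_smul, sq]
  rw [avg, avg, ← Measure.map_smul]
  exact Measure.map_mono h1 (by fun_prop)

instance (ν : Measure E) [IsProbabilityMeasure ν] (k : ℕ) : IsProbabilityMeasure (avg^[k] ν) := by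
  induction k with
  | zero => simpa
  | succ k ih =>
    rw [Function.iterate_succ_apply']
    infer_instance

theorem iterate_avg_le {ν : Measure E} [IsProbabilityMeasure ν] {N : NNReal}
    (h : avg ν ≤ N • ν) (k : ℕ) : avg^[k] ν ≤ N ^ (2 ^ k - 1) • ν := by
  induction k with
  | zero => simp
  | succ k ih =>
    rw [Function.iterate_succ_apply']
    refine (avg_le_of_le ih).trans ?_
    have h1 : 2 ^ (k + 1) - 1 = (2 ^ k - 1) * 2 + 1 := by
      have : 1 ≤ 2 ^ k := Nat.one_le_two_pow
      omega
    rw [show N ^ (2 ^ (k + 1) - 1) = (N ^ (2 ^ k - 1)) ^ 2 * N by rw [h1, pow_succ, pow_mul],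
      mul_smul]
    gcongr

theorem memLp_avg {ν : Measure E} [IsProbabilityMeasure ν] (h : MemLp id 2 ν) :
    MemLp id 2 (avg ν) := by
  rw [avg, memLp_map_measure_iff (by fun_prop) (by fun_prop)]
  exact ((h.comp_fst ν).add (h.comp_snd ν)).const_smul (1 / 2 : ℝ)

theorem integral_avg {ν : Measure E} [IsProbabilityMeasure ν] (h : MemLp id 2 ν)
    (h0 : ∫ x, x ∂ν = 0) : ∫ x, x ∂(avg ν) = 0 := by
  have hi : Integrable (fun x : E => x) ν := h.integrable one_le_two
  rw [avg, integral_map (by fun_prop) (by fun_prop), integral_smul, integral_add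
    (hi.comp_fst ν) (hi.comp_snd ν), integral_fun_fst (fun x : E => x),
    integral_fun_snd (fun x : E => x), h0]
  simp

theorem integral_inner_prod {ν : Measure E} [IsProbabilityMeasure ν] (h : MemLp id 2 ν)
    (h0 : ∫ x, x ∂ν = 0) : Integrable (fun p : E × E => inner ℝ p.1 p.2) (ν.prod ν) ∧
      ∫ p, inner ℝ p.1 p.2 ∂(ν.prod ν) = 0 := by
  have hi : Integrable (fun x : E => x) ν := h.integrable one_le_two
  have hint : Integrable (fun p : E × E => inner ℝ p.1 p.2) (ν.prod ν) :=
    (hi.norm.mul_prod hi.norm).mono' (by fun_prop) (.of_forall fun p => norm_inner_le_norm _ _)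
  refine ⟨hint, ?_⟩
  rw [integral_prod _ hint]
  have h1 : ∀ x : E, ∫ y, inner ℝ x y ∂ν = 0 := fun x => by
    rw [integral_inner hi, h0, inner_zero_right]
  simp [h1]

theorem integral_norm_sq_avg {ν : Measure E} [IsProbabilityMeasure ν] (h : MemLp id 2 ν)
    (h0 : ∫ x, x ∂ν = 0) : ∫ x, ‖x‖ ^ 2 ∂(avg ν) = (∫ x, ‖x‖ ^ 2 ∂ν) / 2 := by
  have hi : Integrable (fun x : E => ‖x‖ ^ 2) ν := h.integrable_norm_pow two_ne_zero
  obtain ⟨h1, h2⟩ := integral_inner_prod h h0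
  have h3 : ∀ p : E × E, ‖(1 / 2 : ℝ) • (p.1 + p.2)‖ ^ 2 =
      (1 / 4) * (‖p.1‖ ^ 2 + ‖p.2‖ ^ 2) + (1 / 2) * inner ℝ p.1 p.2 := fun p => by
    rw [norm_smul, mul_pow, norm_add_sq_real]
    norm_num
    ring
  rw [avg, integral_map (by fun_prop) (by fun_prop)]
  simp_rw [h3]
  have h4 : Integrable (fun p : E × E => (1 / 4) * (‖p.1‖ ^ 2 + ‖p.2‖ ^ 2)) (ν.prod ν) :=
    ((hi.comp_fst ν).add (hi.comp_snd ν)).const_mul _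
  rw [integral_add h4 (h1.const_mul _),
    integral_const_mul, integral_const_mul, h2, integral_add (hi.comp_fst ν) (hi.comp_snd ν),
    integral_fun_fst (fun x => ‖x‖ ^ 2), integral_fun_snd (fun x => ‖x‖ ^ 2)]
  simp
  ring

theorem iterate_avg_moments {ν : Measure E} [IsProbabilityMeasure ν] (h : MemLp id 2 ν)
    (h0 : ∫ x, x ∂ν = 0) (k : ℕ) : MemLp id 2 (avg^[k] ν) ∧ ∫ x, x ∂(avg^[k] ν) = 0 ∧
      ∫ x, ‖x‖ ^ 2 ∂(avg^[k] ν) = (∫ x, ‖x‖ ^ 2 ∂ν) / 2 ^ k := by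
  induction k with
  | zero => simpa using ⟨h, h0⟩
  | succ k ih =>
    simp only [Function.iterate_succ_apply']
    obtain ⟨h1, h2, h3⟩ := ih
    refine ⟨memLp_avg h1, integral_avg h1 h2, ?_⟩
    rw [integral_norm_sq_avg h1 h2, h3, pow_succ, div_div]

theorem half_le_mul_measureReal_closedBall {ν : Measure E} [IsProbabilityMeasure ν]
    (h : MemLp id 2 ν) (h0 : ∫ x, x ∂ν = 0) {N : NNReal} (hN : avg ν ≤ N • ν) (k : ℕ) {r : ℝ}
    (hr : 0 < r) (hk : 2 * ∫ x, ‖x‖ ^ 2 ∂ν ≤ 2 ^ k * r ^ 2) :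
    1 / 2 ≤ (N : ℝ) ^ (2 ^ k - 1) * ν.real (Metric.closedBall 0 r) := by
  obtain ⟨h1, -, h3⟩ := iterate_avg_moments h h0 k
  have hi : Integrable (fun x : E => ‖x‖ ^ 2) (avg^[k] ν) := h1.integrable_norm_pow two_ne_zero
  have hM := mul_meas_ge_le_integral_of_nonneg (.of_forall fun x => by positivity) hi (r ^ 2)
  have hc : (avg^[k] ν).real (Metric.closedBall 0 r)ᶜ ≤ 1 / 2 := by
    rw [h3] at hM
    have h4 : (avg^[k] ν).real (Metric.closedBall 0 r)ᶜ ≤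
        (avg^[k] ν).real {x | r ^ 2 ≤ ‖x‖ ^ 2} := by
      refine measureReal_mono fun x hx => ?_
      simp only [mem_compl_iff, mem_closedBall_zero_iff, not_le, mem_ofPred_eq] at hx ⊢
      gcongr
    have h5 : (∫ x, ‖x‖ ^ 2 ∂ν) / 2 ^ k ≤ r ^ 2 * (1 / 2) := by
      rw [div_le_iff₀ (by positivity)]
      linarith
    exact h4.trans (le_of_mul_le_mul_left (hM.trans h5) (by positivity))
  rw [measureReal_compl Metric.isClosed_closedBall.measurableSet, probReal_univ] at hc
  have h6 := iterate_avg_le hN k (Metric.closedBall 0 r)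
  have h7 : (avg^[k] ν).real (Metric.closedBall 0 r) ≤
      (N : ℝ) ^ (2 ^ k - 1) * ν.real (Metric.closedBall 0 r) := by
    have h8 := ENNReal.toReal_mono (by
      rw [Measure.smul_apply, ENNReal.smul_def, smul_eq_mul]
      finiteness) h6
    simpa [Measure.real, ENNReal.smul_def] using h8
  linarith

end Avg

section Uniform

variable {n : ℕ} {K : Set (EuclideanSpace ℝ (Fin n))}

theorem lintegral_eq_two_pow_mul_lintegral_reflect {f : EuclideanSpace ℝ (Fin n) → ENNReal}
    (hf : Measurable f) (x : EuclideanSpace ℝ (Fin n)) :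
    ∫⁻ y, f y = 2 ^ n * ∫⁻ z, f ((2 : ℝ) • z - x) := by
  have h1 : ∫⁻ z, f ((2 : ℝ) • z - x) =
      ∫⁻ w, f (w - x) ∂(volume.map fun z : EuclideanSpace ℝ (Fin n) => (2 : ℝ) • z) :=
    (lintegral_map (f := fun w => f (w - x)) (by fun_prop) (by fun_prop)).symm
  rw [h1, Measure.map_addHaar_smul _ two_ne_zero, lintegral_smul_measure,
    lintegral_sub_right_eq_self f, finrank_euclideanSpace_fin, smul_eq_mul, ← mul_assoc,
    abs_of_nonneg (by positivity), ENNReal.ofReal_inv_of_pos (by positivity),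
    ENNReal.ofReal_pow (by norm_num)]
  norm_num [ENNReal.mul_inv_cancel]

theorem avg_uniform_le (hK : Convex ℝ K) (hKm : MeasurableSet K) (hK0 : volume K ≠ 0)
    (hKt : volume K ≠ ⊤) {N : NNReal}
    (h : ∀ z, 2 ^ n * volume (K ∩ (fun x => (2 : ℝ) • z - x) ⁻¹' K) ≤ N * volume K) :
    avg ((volume K)⁻¹ • volume.restrict K) ≤ N • ((volume K)⁻¹ • volume.restrict K) := by
  classical
  refine Measure.le_iff.2 fun S hS => ?_
  set a := (volume K)⁻¹ with ha
  have haK : a * volume K = 1 := ENNReal.inv_mul_cancel hK0 hKt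
  set u : EuclideanSpace ℝ (Fin n) → ENNReal := K.indicator 1 with hu
  set s : EuclideanSpace ℝ (Fin n) → ENNReal := S.indicator 1 with hs
  have hum : Measurable u := measurable_one.indicator hKm
  have hsm : Measurable s := measurable_one.indicator hS
  have h1 : avg (a • volume.restrict K) S =
      a * (a * ∫⁻ x, ∫⁻ y, u x * u y * s ((1 / 2 : ℝ) • (x + y))) := by
    have hpre : MeasurableSet ((fun p : EuclideanSpace ℝ (Fin n) × EuclideanSpace ℝ (Fin n) =>
      (1 / 2 : ℝ) • (p.1 + p.2)) ⁻¹' S) := hS.preimage (by fun_prop)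
    rw [avg, Measure.map_apply (by fun_prop) hS, Measure.prod_smul_left, Measure.prod_smul_right,
      Measure.smul_apply, Measure.smul_apply, smul_eq_mul, smul_eq_mul, Measure.prod_apply hpre,
      ← lintegral_indicator hKm]
    congr 3
    ext x
    by_cases hx : x ∈ K
    · rw [indicator_of_mem hx, Measure.restrict_apply (hpre.preimage measurable_prodMk_left),
        ← lintegral_indicator_one ((hpre.preimage measurable_prodMk_left).inter hKm)]
      congr 1
      ext y
      simp only [hu, hs, hx, indicator_apply, mem_inter_iff, mem_preimage, Pi.one_apply]
      split_ifs <;> simp_all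
    · simp [hu, hx]
  have h2 : ∀ x, ∫⁻ y, u x * u y * s ((1 / 2 : ℝ) • (x + y)) =
      2 ^ n * ∫⁻ z, u x * u ((2 : ℝ) • z - x) * s z := fun x => by
    rw [lintegral_eq_two_pow_mul_lintegral_reflect (by fun_prop) x]
    congr 2
    ext z
    congr 2
    simp [smul_smul]
  have h3 : ∀ z, 2 ^ n * ∫⁻ x, u x * u ((2 : ℝ) • z - x) * s z ≤
      N * volume K * (S ∩ K).indicator 1 z := fun z => by
    rw [lintegral_mul_const _ (by fun_prop)]
    have h4 : ∫⁻ x, u x * u ((2 : ℝ) • z - x) =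
        volume (K ∩ (fun x => (2 : ℝ) • z - x) ⁻¹' K) := by
      rw [← lintegral_indicator_one (hKm.inter (hKm.preimage (by fun_prop)))]
      congr 1
      ext y
      simp only [hu, indicator_apply, mem_inter_iff, mem_preimage, Pi.one_apply]
      split_ifs <;> simp_all
    rw [h4, ← mul_assoc]
    by_cases hzS : z ∈ S
    · by_cases hzK : z ∈ K
      · simpa [hs, hzS, hzK] using h z
      · have : K ∩ (fun x => (2 : ℝ) • z - x) ⁻¹' K = ∅ := by
          refine eq_empty_of_forall_notMem fun x hx => hzK ?_
          have := hK hx.1 hx.2 (a := 1 / 2) (b := 1 / 2) (by norm_num) (by norm_num) (by norm_num)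
          rwa [← smul_add, add_sub_cancel, smul_smul, show (1 / 2 * 2 : ℝ) = 1 by norm_num,
            one_smul] at this
        simp [this]
    · simp [hs, hzS]
  calc avg (a • volume.restrict K) S
      = a * (a * ∫⁻ z, 2 ^ n * ∫⁻ x, u x * u ((2 : ℝ) • z - x) * s z) := by
        rw [h1]
        simp_rw [h2]
        rw [lintegral_const_mul _ (by fun_prop), lintegral_const_mul _ (by fun_prop),
          lintegral_lintegral_swap (by fun_prop)]
    _ ≤ a * (a * ∫⁻ z, N * volume K * (S ∩ K).indicator 1 z) := by
        exact mul_le_mul' le_rfl (mul_le_mul' le_rfl (lintegral_mono h3))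
    _ = (a * volume K) * (N * (a * volume (S ∩ K))) := by
        rw [lintegral_const_mul _ (measurable_one.indicator (hS.inter hKm)),
          lintegral_indicator_one (hS.inter hKm)]
        ring
    _ = _ := by
        rw [haK, one_mul, Measure.smul_apply, Measure.smul_apply, Measure.restrict_apply hS,
          ENNReal.smul_def, smul_eq_mul, smul_eq_mul]

end Uniform

section Isotropic

variable {n : ℕ} {μ : Measure (EuclideanSpace ℝ (Fin n))}

theorem exists_linear_isotropic [IsProbabilityMeasure μ] (h : MemLp id 2 μ)
    (m : EuclideanSpace ℝ (Fin n))
    (hinj : ∀ v, (∀ᵐ x ∂μ, inner ℝ v (x - m) = 0) → v = 0) :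
    ∃ S : EuclideanSpace ℝ (Fin n) →ₗ[ℝ] EuclideanSpace ℝ (Fin n),
      ∀ v, ∫ x, inner ℝ v (S (x - m)) ^ 2 ∂μ = ‖v‖ ^ 2 := by
  have hc : MemLp (fun x => x - m) 2 μ := h.sub (memLp_const m)
  have hv : ∀ v, MemLp (fun x => inner ℝ v (x - m)) 2 μ := fun v => hc.const_inner v
  let J : EuclideanSpace ℝ (Fin n) →ₗ[ℝ] Lp ℝ 2 μ :=
    { toFun := fun v => (hv v).toLp
      map_add' := fun v w => by
        rw [← MemLp.toLp_add]
        exact MemLp.toLp_congr _ _ (.of_forall fun x => inner_add_left _ _ _)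
      map_smul' := fun c v => by
        rw [RingHom.id_apply, ← MemLp.toLp_const_smul]
        exact MemLp.toLp_congr _ _ (.of_forall fun x => real_inner_smul_left _ _ _) }
  have hJ : Function.Injective J := by
    refine (injective_iff_map_eq_zero J).2 fun v hv0 => hinj v ?_
    have h1 := (MemLp.coeFn_toLp (hv v)).symm
    rw [show (hv v).toLp = 0 from hv0] at h1
    filter_upwards [h1, Lp.coeFn_zero ℝ 2 μ] with x hx hx0
    rw [hx, hx0]
    rfl
  have hnorm : ∀ v, ∫ x, inner ℝ v (x - m) ^ 2 ∂μ = ‖J v‖ ^ 2 := fun v => by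
    rw [← real_inner_self_eq_norm_sq, L2.inner_def]
    refine integral_congr_ae ?_
    filter_upwards [MemLp.coeFn_toLp (hv v)] with x hx
    rw [show J v x = inner ℝ v (x - m) from hx]
    simp [sq]
  let e := LinearEquiv.ofInjective J hJ
  have hdim : Module.finrank ℝ (LinearMap.range J) = n := by
    rw [← e.finrank_eq, finrank_euclideanSpace_fin]
  let b := (stdOrthonormalBasis ℝ (LinearMap.range J)).reindex (finCongr hdim)
  let T : EuclideanSpace ℝ (Fin n) →ₗ[ℝ] EuclideanSpace ℝ (Fin n) :=
    e.symm.toLinearMap ∘ₗ b.repr.symm.toLinearEquiv.toLinearMap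
  refine ⟨LinearMap.adjoint T, fun v => ?_⟩
  simp_rw [LinearMap.adjoint_inner_right]
  rw [hnorm]
  have : J (T v) = (b.repr.symm v : LinearMap.range J) := by
    have : e (T v) = b.repr.symm v := e.apply_symm_apply _
    rw [← this]
    rfl
  rw [this]
  exact congrArg (· ^ 2) (b.repr.symm.norm_map v)


theorem map_avg {E F : Type*} [NormedAddCommGroup E] [InnerProductSpace ℝ E]
    [FiniteDimensional ℝ E] [MeasurableSpace E] [BorelSpace E] [NormedAddCommGroup F]
    [InnerProductSpace ℝ F] [FiniteDimensional ℝ F] [MeasurableSpace F] [BorelSpace F]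
    {μ : Measure E} [SFinite μ] {A : E → F} (hA : Measurable A)
    (h : ∀ x y, A ((1 / 2 : ℝ) • (x + y)) = (1 / 2 : ℝ) • (A x + A y)) :
    avg (μ.map A) = (avg μ).map A := by
  rw [avg, avg, Measure.map_prod_map _ _ hA hA, Measure.map_map (by fun_prop) (by fun_prop),
    Measure.map_map hA (by fun_prop)]
  congr 1
  ext1 p
  exact (h p.1 p.2).symm

/-- The law of the normalized difference of two independent samples from `ν`. -/
noncomputable def symmDiffLaw (ν : Measure (EuclideanSpace ℝ (Fin n))) :
    Measure (EuclideanSpace ℝ (Fin n)) :=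
  (ν.prod ν).map fun p => (√2)⁻¹ • (p.1 - p.2)

instance (ν : Measure (EuclideanSpace ℝ (Fin n))) [IsProbabilityMeasure ν] :
    IsProbabilityMeasure (symmDiffLaw ν) :=
  Measure.isProbabilityMeasure_map (by fun_prop)

theorem map_neg_symmDiffLaw (ν : Measure (EuclideanSpace ℝ (Fin n))) [SFinite ν] :
    (symmDiffLaw ν).map Neg.neg = symmDiffLaw ν := by
  rw [symmDiffLaw, Measure.map_map measurable_neg (by fun_prop)]
  conv_rhs => rw [← Measure.prod_swap, Measure.map_map (by fun_prop) measurable_swap]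
  congr 1
  ext1 p
  simp [← smul_neg]

theorem midPL_symmDiffLaw_map [SFinite μ] (hμ : MidPL μ)
    (S : EuclideanSpace ℝ (Fin n) →ₗ[ℝ] EuclideanSpace ℝ (Fin n))
    (m : EuclideanSpace ℝ (Fin n)) : MidPL (symmDiffLaw (μ.map fun x => S (x - m))) := by
  have hS : Measurable S := S.continuous_of_finiteDimensional.measurable
  have hA : Measurable fun x => S (x - m) := by fun_prop
  rw [symmDiffLaw, Measure.map_prod_map _ _ hA hA, Measure.map_map (by fun_prop) (by fun_prop)]
  let L : EuclideanSpace ℝ (Fin n) × EuclideanSpace ℝ (Fin n) →ₗ[ℝ] EuclideanSpace ℝ (Fin n) :=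
    (√2)⁻¹ • S ∘ₗ (LinearMap.fst ℝ _ _ - LinearMap.snd ℝ _ _)
  have h1 : (fun p : EuclideanSpace ℝ (Fin n) × EuclideanSpace ℝ (Fin n) =>
      (√2)⁻¹ • (p.1 - p.2)) ∘ Prod.map (fun x => S (x - m)) (fun x => S (x - m)) = L := by
    ext1 p
    simp [L]
  rw [h1]
  exact (hμ.prod hμ).map L (L.continuous_of_finiteDimensional.measurable)

theorem symmDiffLaw_isotropic {ν : Measure (EuclideanSpace ℝ (Fin n))} [IsProbabilityMeasure ν]
    (h : MemLp id 2 ν) (h0 : ∫ x, x ∂ν = 0) (v : EuclideanSpace ℝ (Fin n)) :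
    ∫⁻ x, ENNReal.ofReal (inner ℝ v x ^ 2) ∂(symmDiffLaw ν) =
      ENNReal.ofReal (∫ x, inner ℝ v x ^ 2 ∂ν) := by
  have hi : Integrable (fun x : EuclideanSpace ℝ (Fin n) => x) ν := h.integrable one_le_two
  have hv : MemLp (fun x => inner ℝ v x) 2 ν := h.const_inner v
  have h1 : Integrable (fun x => inner ℝ v x) ν := hi.const_inner v
  have h2 : Integrable (fun x => inner ℝ v x ^ 2) ν := hv.integrable_sq
  have h10 : ∫ x, inner ℝ v x ∂ν = 0 := by
    rw [integral_inner hi, h0, inner_zero_right]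
  have h3 : ∀ p : EuclideanSpace ℝ (Fin n) × EuclideanSpace ℝ (Fin n),
      inner ℝ v ((√2)⁻¹ • (p.1 - p.2)) ^ 2 =
        (1 / 2) * (inner ℝ v p.1 ^ 2 + inner ℝ v p.2 ^ 2) - inner ℝ v p.1 * inner ℝ v p.2 :=
    fun p => by
      rw [real_inner_smul_right, inner_sub_right, mul_pow, inv_pow, Real.sq_sqrt (by norm_num)]
      ring
  have h4 : Integrable (fun p : EuclideanSpace ℝ (Fin n) × EuclideanSpace ℝ (Fin n) =>
      (1 / 2) * (inner ℝ v p.1 ^ 2 + inner ℝ v p.2 ^ 2)) (ν.prod ν) :=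
    ((h2.comp_fst ν).add (h2.comp_snd ν)).const_mul _
  have h5 : Integrable (fun p : EuclideanSpace ℝ (Fin n) × EuclideanSpace ℝ (Fin n) =>
      inner ℝ v p.1 * inner ℝ v p.2) (ν.prod ν) := h1.mul_prod h1
  have h6 : Integrable (fun p : EuclideanSpace ℝ (Fin n) × EuclideanSpace ℝ (Fin n) =>
      inner ℝ v ((√2)⁻¹ • (p.1 - p.2)) ^ 2) (ν.prod ν) := by
    simp_rw [h3]
    exact h4.sub h5
  rw [symmDiffLaw, lintegral_map (by fun_prop) (by fun_prop),
    ← ofReal_integral_eq_lintegral_ofReal h6 (.of_forall fun p => by positivity)]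
  simp_rw [h3]
  rw [integral_sub h4 h5, integral_const_mul, integral_add (h2.comp_fst ν) (h2.comp_snd ν),
    integral_fun_fst (fun x => inner ℝ v x ^ 2), integral_fun_snd (fun x => inner ℝ v x ^ 2),
    integral_prod_mul (fun x => inner ℝ v x) (fun x => inner ℝ v x), h10]
  congr 1
  simp
  ring

theorem measureReal_closedBall_sq_le_symmDiffLaw (ν : Measure (EuclideanSpace ℝ (Fin n)))
    [IsProbabilityMeasure ν] (r : ℝ) :
    ν.real (Metric.closedBall 0 (r / √2)) ^ 2 ≤
      (symmDiffLaw ν).real (Metric.closedBall 0 r) := by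
  rw [sq, ← measureReal_prod_prod, symmDiffLaw, map_measureReal_apply (by fun_prop)
    Metric.isClosed_closedBall.measurableSet]
  refine measureReal_mono ?_
  rintro ⟨x, y⟩ ⟨hx, hy⟩
  simp only [mem_closedBall_zero_iff, mem_preimage] at *
  calc ‖(√2)⁻¹ • (x - y)‖ = (√2)⁻¹ * ‖x - y‖ := by
        rw [norm_smul, Real.norm_of_nonneg (by positivity)]
    _ ≤ (√2)⁻¹ * (r / √2 + r / √2) := by
        gcongr
        exact (norm_sub_le _ _).trans (add_le_add hx hy)
    _ = r := by
        have := Real.mul_self_sqrt (show (0 : ℝ) ≤ 2 by norm_num)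
        field_simp
        linear_combination (-r) * this

theorem exp_le_of_avg_le [IsProbabilityMeasure μ] (hμ : MidPL μ) (h : MemLp id 2 μ)
    (hinj : ∀ v m, (∀ᵐ x ∂μ, inner ℝ v (x - m) = 0) → v = 0) {N : NNReal}
    (hN : avg μ ≤ N • μ) {k : ℕ} (hk : 4 ≤ 2 ^ k * (Real.exp (-7) / 42000) ^ 2) {q : ℕ}
    (hq : 2 ≤ q) (hqn : 86400 * Real.exp 10 * q ^ 2 ≤ n) :
    Real.exp q ≤ 8 * ((N : ℝ) ^ (2 ^ k - 1)) ^ 2 := by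
  set ε := Real.exp (-7) / 42000 with hε
  have hε0 : 0 < ε := by positivity
  have hn0 : (0 : ℝ) < n := lt_of_lt_of_le (by positivity) hqn
  set m := ∫ x, x ∂μ with hm
  obtain ⟨S, hS⟩ := exists_linear_isotropic h m fun v => hinj v m
  have hSc : Continuous S := S.continuous_of_finiteDimensional
  have hA : Measurable fun x => S (x - m) := by fun_prop
  have hc : MemLp (fun x => x - m) 2 μ := h.sub (memLp_const m)
  set ν := μ.map fun x => S (x - m) with hν
  have : IsProbabilityMeasure ν := Measure.isProbabilityMeasure_map hA.aemeasurable
  have hν2 : MemLp id 2 ν := by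
    rw [hν, memLp_map_measure_iff (by fun_prop) (by fun_prop)]
    exact (LinearMap.toContinuousLinearMap S).comp_memLp' hc
  have hν0 : ∫ x, x ∂ν = 0 := by
    rw [hν, integral_map (by fun_prop) (by fun_prop)]
    have := (LinearMap.toContinuousLinearMap S).integral_comp_comm (hc.integrable one_le_two)
    rw [LinearMap.coe_toContinuousLinearMap'] at this
    have hi : Integrable (fun x : EuclideanSpace ℝ (Fin n) => x) μ := h.integrable one_le_two
    rw [this, integral_sub hi (integrable_const m)]
    simp [hm]
  have hνi : ∀ v, ∫ x, inner ℝ v x ^ 2 ∂ν = ‖v‖ ^ 2 := fun v => by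
    rw [hν, integral_map (by fun_prop) (by fun_prop)]
    exact hS v
  have hνn : ∫ x, ‖x‖ ^ 2 ∂ν = n := by
    rw [integral_eq_lintegral_of_nonneg_ae (.of_forall fun x => by positivity) (by fun_prop),
      lintegral_norm_sq_of_isotropic, ENNReal.toReal_natCast]
    intro v
    have hv : MemLp (fun x => inner ℝ v x) 2 ν := hν2.const_inner v
    rw [← ofReal_integral_eq_lintegral_ofReal hv.integrable_sq
      (.of_forall fun p => by positivity), hνi]
  have hνN : avg ν ≤ N • ν := by
    rw [hν, map_avg hA fun x y => ?_, ← Measure.map_smul]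
    · exact Measure.map_mono hN hA
    · rw [← map_add, ← map_smul]
      congr 1
      module
  have h1 := half_le_mul_measureReal_closedBall hν2 hν0 hνN k
    (r := ε * √n / √2) (by positivity) (by
      rw [hνn, div_pow, mul_pow, Real.sq_sqrt hn0.le, Real.sq_sqrt (by norm_num)]
      nlinarith)
  have h2 := measureReal_closedBall_sq_le_symmDiffLaw ν (ε * √n)
  have h3 : (symmDiffLaw ν).real (Metric.closedBall 0 (ε * √n)) ≤ 2 * Real.exp (-q) := by
    have := measure_closedBall_le (midPL_symmDiffLaw_map hμ S m) (map_neg_symmDiffLaw ν)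
      (fun v => by rw [symmDiffLaw_isotropic hν2 hν0, hνi]) hq hqn
    exact ENNReal.toReal_le_of_le_ofReal (by positivity) this
  set P := (N : ℝ) ^ (2 ^ k - 1)
  have hP : 0 ≤ P := by positivity
  set x := ν.real (Metric.closedBall 0 (ε * √n / √2))
  have hx : 0 ≤ x := measureReal_nonneg
  have h4 : 1 / 4 ≤ P ^ 2 * (2 * Real.exp (-q)) := by
    calc (1 / 4 : ℝ) = (1 / 2) ^ 2 := by norm_num
      _ ≤ (P * x) ^ 2 := by gcongr
      _ = P ^ 2 * x ^ 2 := by ring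
      _ ≤ _ := by gcongr; exact h2.trans h3
  rw [Real.exp_neg] at h4
  have h5 := Real.exp_pos q
  field_simp at h4
  linarith

end Isotropic

section LargeIntersection

variable {n : ℕ} {K : Set (EuclideanSpace ℝ (Fin n))}

theorem eq_zero_of_ae_restrict_inner_eq_zero {U : Set (EuclideanSpace ℝ (Fin n))} (hU : IsOpen U)
    (hU0 : U.Nonempty) {v m : EuclideanSpace ℝ (Fin n)}
    (h : ∀ᵐ x ∂(volume.restrict U), inner ℝ v (x - m) = 0) : v = 0 := by
  have h1 : EqOn (fun x => inner ℝ v (x - m)) (fun _ => (0 : ℝ)) U :=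
    Measure.eqOn_open_of_ae_eq h hU (by fun_prop) (by fun_prop)
  obtain ⟨x, hx⟩ := hU0
  obtain ⟨t, ht, htU⟩ : ∃ t : ℝ, 0 < t ∧ x + t • v ∈ U := by
    have hc : Filter.Tendsto (fun t : ℝ => x + t • v) (nhdsWithin 0 (Ioi 0)) (nhds x) := by
      have : Continuous fun t : ℝ => x + t • v := by fun_prop
      simpa using (this.tendsto 0).mono_left nhdsWithin_le_nhds
    obtain ⟨t, ht, ht0⟩ := ((hc.eventually (hU.mem_nhds hx)).and self_mem_nhdsWithin).exists
    exact ⟨t, ht0, ht⟩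
  have h2 := h1 htU
  have h3 := h1 hx
  simp only [add_sub_right_comm, inner_add_right, real_inner_smul_right] at h2 h3
  rw [h3, zero_add, mul_eq_zero, inner_self_eq_zero] at h2
  exact h2.resolve_left ht.ne'

theorem IsConvexBody.volume_ne_zero (hK : IsConvexBody K) : volume K ≠ 0 :=
  (Measure.measure_pos_of_nonempty_interior _ hK.2.2).ne'

theorem IsConvexBody.volume_ne_top (hK : IsConvexBody K) : volume K ≠ ⊤ :=
  hK.2.1.measure_lt_top.ne

theorem IsConvexBody.measurableSet (hK : IsConvexBody K) : MeasurableSet K :=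
  hK.2.1.measurableSet

theorem exists_exp_le_pow_of_avg_uniform_le : ∃ c C : ℝ, ∃ p : ℕ, 0 < c ∧ 0 < C ∧
    ∀ (n : ℕ) (K : Set (EuclideanSpace ℝ (Fin n))), IsConvexBody K → ∀ N : NNReal,
      avg ((volume K)⁻¹ • volume.restrict K) ≤ N • ((volume K)⁻¹ • volume.restrict K) →
        Real.exp (c * √n) ≤ C * N ^ (p + 1) := by
  obtain ⟨k, hk⟩ : ∃ k : ℕ, 4 / (Real.exp (-7) / 42000) ^ 2 < (2 : ℝ) ^ k :=
    pow_unbounded_of_one_lt _ one_lt_two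
  rw [div_lt_iff₀ (by positivity)] at hk
  set B : ℝ := √(86400 * Real.exp 10) with hB
  have hB0 : 0 < B := by positivity
  refine ⟨B⁻¹, 8 * Real.exp 2, (2 ^ k - 1) * 2, by positivity, by positivity,
    fun n K hK N hN => ?_⟩
  set μ := (volume K)⁻¹ • volume.restrict K with hμ
  have : IsProbabilityMeasure μ := ⟨by
    rw [hμ, Measure.smul_apply, Measure.restrict_apply_univ, smul_eq_mul]
    exact ENNReal.inv_mul_cancel hK.volume_ne_zero hK.volume_ne_top⟩
  have hN1 : (1 : ℝ) ≤ N := by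
    have := hN univ
    rw [Measure.smul_apply, measure_univ, measure_univ, ENNReal.smul_def, smul_eq_mul,
      mul_one] at this
    exact_mod_cast this
  have hp : ((N : ℝ) ^ (2 ^ k - 1)) ^ 2 ≤ (N : ℝ) ^ ((2 ^ k - 1) * 2 + 1) := by
    rw [← pow_mul]
    exact pow_le_pow_right₀ hN1 (Nat.le_succ _)
  set q := ⌊B⁻¹ * √n⌋₊ with hq
  have hqle : (q : ℝ) ≤ B⁻¹ * √n := Nat.floor_le (by positivity)
  have hqlt : B⁻¹ * √n < q + 1 := Nat.lt_floor_add_one _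
  by_cases hq2 : 2 ≤ q
  · have hqn : 86400 * Real.exp 10 * q ^ 2 ≤ n := by
      have h1 : B * q ≤ √n := by
        rwa [inv_mul_eq_div, le_div_iff₀ hB0, mul_comm] at hqle
      calc 86400 * Real.exp 10 * (q : ℝ) ^ 2 = (B * q) ^ 2 := by
            rw [mul_pow, hB, Real.sq_sqrt (by positivity)]
        _ ≤ √n ^ 2 := by gcongr
        _ = n := Real.sq_sqrt (by positivity)
    have hMid : MidPL μ := ((midPL_volume n).restrict hK.1 hK.measurableSet).smul _
    obtain ⟨R, hR⟩ := hK.2.1.isBounded.exists_norm_le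
    have hae : ∀ᵐ x ∂μ, x ∈ K :=
      Measure.ae_smul_measure (ae_restrict_mem hK.measurableSet) _
    have hmem : MemLp id 2 μ :=
      MemLp.of_bound (by fun_prop) R (hae.mono fun x hx => hR x hx)
    have hinj : ∀ v m, (∀ᵐ x ∂μ, inner ℝ v (x - m) = 0) → v = 0 := fun v m h => by
      rw [hμ, Measure.ae_ennreal_smul_measure_iff (ENNReal.inv_ne_zero.2 hK.volume_ne_top)] at h
      exact eq_zero_of_ae_restrict_inner_eq_zero isOpen_interior hK.2.2
        (ae_restrict_of_ae_restrict_of_subset interior_subset h)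
    have h := exp_le_of_avg_le hMid hmem hinj hN hk.le hq2 hqn
    calc Real.exp (B⁻¹ * √n) ≤ Real.exp (1 + q) := by gcongr; linarith
      _ = Real.exp 1 * Real.exp q := Real.exp_add _ _
      _ ≤ Real.exp 2 * (8 * (N : ℝ) ^ ((2 ^ k - 1) * 2 + 1)) := by
        gcongr
        · norm_num
        · exact h.trans (by gcongr)
      _ = _ := by ring
  · calc Real.exp (B⁻¹ * √n) ≤ Real.exp 2 := by
          have : (q : ℝ) ≤ 1 := by exact_mod_cast (by omega : q ≤ 1)
          gcongr
          linarith
      _ ≤ 8 * Real.exp 2 * 1 := by linarith [Real.exp_pos 2]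
      _ ≤ _ := by
        gcongr
        exact one_le_pow₀ hN1

/-- Every convex body has a reflection in a point meeting it in a set of large volume. -/
theorem exists_reflection_inter_volume_ge : ∃ c C : ℝ, 0 < c ∧ 0 < C ∧
    ∀ (n : ℕ) (K : Set (EuclideanSpace ℝ (Fin n))), IsConvexBody K →
      ∃ z, Real.exp (c * √n) * volume.real K ≤
        C * 2 ^ n * volume.real (K ∩ (fun x => (2 : ℝ) • z - x) ⁻¹' K) := by
  obtain ⟨c, C, p, hc, hC, h⟩ := exists_exp_le_pow_of_avg_uniform_le
  refine ⟨c / (p + 1), C + 1, by positivity, by positivity, fun n K hK => ?_⟩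
  by_contra! hlt
  set M : ℝ := Real.exp (c / (p + 1) * √n) / (C + 1) with hM
  have hM0 : 0 ≤ M := by positivity
  have h1 := h n K hK M.toNNReal (avg_uniform_le hK.1 hK.measurableSet hK.volume_ne_zero
    hK.volume_ne_top fun z => by
      have h2 := hlt z
      rw [← ofReal_measureReal (s := K ∩ _) (by
          exact measure_ne_top_of_subset inter_subset_left hK.volume_ne_top),
        ← ofReal_measureReal (s := K) hK.volume_ne_top,
        show (2 : ENNReal) ^ n = ENNReal.ofReal (2 ^ n) by simp [ENNReal.ofReal_pow],
        show (M.toNNReal : ENNReal) = ENNReal.ofReal M from rfl,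
        ← ENNReal.ofReal_mul (by positivity), ← ENNReal.ofReal_mul hM0]
      refine ENNReal.ofReal_le_ofReal ?_
      rw [hM, div_mul_eq_mul_div, le_div_iff₀ (by positivity)]
      linarith)
  have h3 : C * M ^ (p + 1) = C / (C + 1) ^ (p + 1) * Real.exp (c * √n) := by
    rw [hM, div_pow, ← Real.exp_nat_mul]
    push_cast
    rw [show ((p : ℝ) + 1) * (c / (p + 1) * √n) = c * √n by field_simp]
    ring
  have h4 : C / (C + 1) ^ (p + 1) < 1 := by
    rw [div_lt_one (by positivity)]
    calc C < C + 1 := by linarith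
      _ ≤ _ := le_self_pow₀ (by linarith) (by omega)
  have h5 : Real.exp (c * √n) ≤ C * M ^ (p + 1) := by
    rwa [Real.coe_toNNReal M hM0] at h1
  rw [h3] at h5
  nlinarith [Real.exp_pos (c * √n)]

end LargeIntersection

section Covering

theorem gCov_le_length {E : Type*} [NormedAddCommGroup E] [NormedSpace ℝ E] {B : Set E} {α : ℝ}
    (hα : 0 ≤ α) {t : ℝ} (ht : t ∈ Ioo (0 : ℝ) 1) (l : List E)
    (h : ∀ b ∈ B, ∃ x ∈ l, b ∈ x +ᵥ t • B) : gCov α B ≤ l.length := by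
  have h1 : gCov α B ≤ ∑ _i : Fin l.length, t ^ α := by
    refine csInf_le ⟨0, ?_⟩ ⟨l.length, fun _ => t, l.get, fun _ => ht, fun b hb => ?_, rfl⟩
    · rintro _ ⟨k, lam, x, hlam, -, rfl⟩
      exact Finset.sum_nonneg fun i _ => Real.rpow_nonneg (hlam i).1.le _
    · obtain ⟨x, hx, hbx⟩ := h b hb
      obtain ⟨i, rfl⟩ := List.mem_iff_get.1 hx
      exact mem_iUnion.2 ⟨i, hbx⟩
  refine h1.trans ?_
  rw [Finset.sum_const, Finset.card_univ, Fintype.card_fin, nsmul_eq_mul]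
  exact mul_le_of_le_one_right (by positivity) (Real.rpow_le_one ht.1.le ht.2.le hα)

theorem exists_list_greedy_cover {X Y : Type*} [DecidableEq Y] {R : X → Y → Prop}
    {S : Finset Y} {p : ℝ} (hp : p ≤ 1)
    (h : ∀ A ⊆ S, ∃ x, ∃ A' ⊆ A, p * A.card ≤ A'.card ∧ ∀ y ∈ A', R x y) (m : ℕ) :
    ∃ l : List X, l.length = m ∧ ∃ A ⊆ S, (A.card : ℝ) ≤ (1 - p) ^ m * S.card ∧
      ∀ y ∈ S, y ∉ A → ∃ x ∈ l, R x y := by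
  induction m with
  | zero => exact ⟨[], rfl, S, subset_rfl, by simp, fun y hy hy' => absurd hy hy'⟩
  | succ m ih =>
    obtain ⟨l, hl, A, hAS, hA, hcov⟩ := ih
    obtain ⟨x, A', hA', hcard, hR⟩ := h A hAS
    refine ⟨x :: l, by simp [hl], A \ A', Finset.sdiff_subset.trans hAS, ?_, fun y hy hyA => ?_⟩
    · rw [Finset.card_sdiff_of_subset hA', Nat.cast_sub (Finset.card_le_card hA'), pow_succ]
      calc (A.card : ℝ) - A'.card ≤ (1 - p) * A.card := by linarith
        _ ≤ (1 - p) * ((1 - p) ^ m * S.card) := by gcongr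
        _ = _ := by ring
    · by_cases hyA' : y ∈ A'
      · exact ⟨x, by simp, hR y hyA'⟩
      · obtain ⟨x', hx', hRx'⟩ := hcov y hy fun hy' => hyA (by simp [hy', hyA'])
        exact ⟨x', by simp [hx'], hRx'⟩

theorem exists_list_cover {X Y : Type*} [DecidableEq Y] {R : X → Y → Prop}
    {S : Finset Y} {p : ℝ} (hp0 : 0 < p) (hp : p ≤ 1)
    (h : ∀ A ⊆ S, ∃ x, ∃ A' ⊆ A, p * A.card ≤ A'.card ∧ ∀ y ∈ A', R x y) {L : ℝ}
    (hL : 0 < L) (hS : S.card ≤ Real.exp L) :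
    ∃ l : List X, l.length ≤ L / p + 1 ∧ ∀ y ∈ S, ∃ x ∈ l, R x y := by
  obtain ⟨l, hl, A, -, hA, hcov⟩ := exists_list_greedy_cover hp h (⌊L / p⌋₊ + 1)
  have hlt : (A.card : ℝ) < 1 := by
    calc (A.card : ℝ) ≤ (1 - p) ^ (⌊L / p⌋₊ + 1) * S.card := hA
      _ ≤ Real.exp (-p) ^ (⌊L / p⌋₊ + 1) * Real.exp L := by
        gcongr
        exact Real.one_sub_le_exp_neg p
      _ = Real.exp (L - p * (⌊L / p⌋₊ + 1)) := by
        rw [← Real.exp_nat_mul, ← Real.exp_add]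
        push_cast
        ring_nf
      _ < 1 := by
        rw [Real.exp_lt_one_iff]
        have := Nat.lt_floor_add_one (L / p)
        rw [div_lt_iff₀ hp0] at this
        linarith
  have hA0 : A = ∅ := Finset.card_eq_zero.1 (Nat.lt_one_iff.1 (by exact_mod_cast hlt))
  refine ⟨l, ?_, fun y hy => hcov y hy (by simp [hA0])⟩
  rw [hl]
  push_cast
  gcongr
  exact Nat.floor_le (by positivity)

variable {n : ℕ}

theorem exists_translate_card_ge {Y : Finset (EuclideanSpace ℝ (Fin n))}
    {W D : Set (EuclideanSpace ℝ (Fin n))} [DecidablePred (· ∈ W)] (hW : MeasurableSet W)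
    (hWt : volume W ≠ ⊤) (hDm : MeasurableSet D) (hD0 : volume D ≠ 0) (hD : volume D ≠ ⊤)
    (h : ∀ y ∈ Y, ∀ w ∈ W, y - w ∈ D) :
    ∃ x, (Y.card : ENNReal) * volume W ≤ (Y.filter fun y => y - x ∈ W).card * volume D := by
  have hint : ∫⁻ x in D, ((Y.filter fun y => y - x ∈ W).card : ENNReal) = Y.card * volume W := by
    have h1 : ∀ x, ((Y.filter fun y => y - x ∈ W).card : ENNReal) =
        ∑ y ∈ Y, W.indicator 1 (y - x) := fun x => by
      rw [Finset.card_filter]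
      push_cast
      exact Finset.sum_congr rfl fun y _ => by simp [indicator_apply]
    have hm : ∀ y : EuclideanSpace ℝ (Fin n),
        Measurable fun x => W.indicator (1 : EuclideanSpace ℝ (Fin n) → ENNReal) (y - x) := fun y =>
      (measurable_one.indicator hW).comp (measurable_const.sub measurable_id)
    simp_rw [h1]
    rw [lintegral_finsetSum _ fun y _ => hm y, ← nsmul_eq_mul]
    refine Finset.sum_eq_card_nsmul fun y hy => ?_
    calc ∫⁻ x in D, W.indicator 1 (y - x) = ∫⁻ x, W.indicator 1 (y - x) := by
          rw [← lintegral_indicator hDm]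
          congr 1
          ext x
          by_cases hx : x ∈ D
          · rw [indicator_of_mem hx]
          · rw [indicator_of_notMem hx, indicator_of_notMem]
            intro hw
            exact hx (by simpa using h y hy _ hw)
      _ = ∫⁻ x, W.indicator 1 x := lintegral_sub_left_eq_self _ y
      _ = volume W := lintegral_indicator_one hW
  obtain ⟨x, -, hx⟩ := exists_setLAverage_le hD0 hDm.nullMeasurableSet (by
    rw [hint]
    finiteness)
  refine ⟨x, ?_⟩
  rwa [setLAverage_eq, hint, ENNReal.div_le_iff hD0 hD] at hx

end Covering

section Reflection

variable {n : ℕ} {K : Set (EuclideanSpace ℝ (Fin n))}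

theorem measureReal_smul_of_nonneg (S : Set (EuclideanSpace ℝ (Fin n))) {c : ℝ} (hc : 0 ≤ c) :
    volume.real (c • S) = c ^ n * volume.real S := by
  rw [Measure.real, Measure.addHaar_smul_of_nonneg _ hc, finrank_euclideanSpace_fin,
    ENNReal.toReal_mul, ENNReal.toReal_ofReal (by positivity), Measure.real]

/-- The largest subset of `K - z` that is symmetric about the origin. -/
def symmPart (K : Set (EuclideanSpace ℝ (Fin n))) (z : EuclideanSpace ℝ (Fin n)) :
    Set (EuclideanSpace ℝ (Fin n)) :=
  {w | z + w ∈ K ∧ z - w ∈ K}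

theorem neg_mem_symmPart {z w : EuclideanSpace ℝ (Fin n)} (h : w ∈ symmPart K z) :
    -w ∈ symmPart K z := by
  constructor
  · rw [← sub_eq_add_neg]
    exact h.2
  · rw [sub_neg_eq_add]
    exact h.1

theorem convex_symmPart (hK : Convex ℝ K) (z : EuclideanSpace ℝ (Fin n)) :
    Convex ℝ (symmPart K z) := by
  intro x hx y hy a b ha hb hab
  constructor
  · have h := hK hx.1 hy.1 ha hb hab
    rwa [show a • (z + x) + b • (z + y) = (a + b) • z + (a • x + b • y) by module, hab,
      one_smul] at h
  · have h := hK hx.2 hy.2 ha hb hab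
    rwa [show a • (z - x) + b • (z - y) = (a + b) • z - (a • x + b • y) by module, hab,
      one_smul] at h

theorem measurableSet_symmPart (hK : MeasurableSet K) (z : EuclideanSpace ℝ (Fin n)) :
    MeasurableSet (symmPart K z) :=
  (hK.preimage (measurable_const_add z)).inter (hK.preimage (measurable_const.sub measurable_id))

theorem measureReal_symmPart (K : Set (EuclideanSpace ℝ (Fin n))) (z : EuclideanSpace ℝ (Fin n)) :
    volume.real (symmPart K z) = volume.real (K ∩ (fun x => (2 : ℝ) • z - x) ⁻¹' K) := by
  have h : symmPart K z = (fun w => z + w) ⁻¹' (K ∩ (fun x => (2 : ℝ) • z - x) ⁻¹' K) := by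
    ext w
    have : (2 : ℝ) • z - (z + w) = z - w := by module
    simp [symmPart, this]
  rw [h, Measure.real, measure_preimage_add, Measure.real]

theorem add_smul_mem_vadd_smul (hK : Convex ℝ K) {z y w : EuclideanSpace ℝ (Fin n)} {c : ℝ}
    (hc : 0 ≤ c) (hy : y ∈ K) (hw : w ∈ c • symmPart K z) :
    y + w ∈ (-(c • z)) +ᵥ (1 + c) • K := by
  obtain ⟨u, hu, rfl⟩ := hw
  rw [hK.add_smul zero_le_one hc, one_smul]
  refine ⟨y + c • (z + u), add_mem_add hy ⟨_, hu.1, rfl⟩, ?_⟩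
  simp only [vadd_eq_add]
  module

theorem measureReal_vadd_smul (K : Set (EuclideanSpace ℝ (Fin n))) (v : EuclideanSpace ℝ (Fin n))
    {c : ℝ} (hc : 0 ≤ c) : volume.real (v +ᵥ c • K) = c ^ n * volume.real K := by
  rw [← measureReal_smul_of_nonneg K hc, Measure.real, measure_vadd, Measure.real]

theorem neg_mem_smul_symmPart {z w : EuclideanSpace ℝ (Fin n)} {c : ℝ}
    (h : w ∈ c • symmPart K z) : -w ∈ c • symmPart K z := by
  obtain ⟨u, hu, rfl⟩ := h
  exact ⟨-u, neg_mem_symmPart hu, smul_neg c u⟩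

theorem gCov_le_of_measureReal_symmPart (hn : 1 ≤ n) (hK : IsConvexBody K)
    {z : EuclideanSpace ℝ (Fin n)} (ht : 0 < volume.real (symmPart K z)) {L : ℝ} (hL : 0 < L)
    (hLt : (16 * n) ^ n * volume.real K ≤ Real.exp L * volume.real (symmPart K z)) {α : ℝ}
    (hα : 0 ≤ α) :
    gCov α K ≤ L * (2 ^ (n + 1) * volume.real K / volume.real (symmPart K z)) + 1 := by
  classical
  set T := symmPart K z with hT
  set t := volume.real T with ht'
  set V := volume.real K with hV
  have hTm : MeasurableSet T := measurableSet_symmPart hK.measurableSet z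
  have hTc : Convex ℝ T := convex_symmPart hK.1 z
  have hT0 : volume T ≠ 0 := fun h => by simp [ht', Measure.real, h] at ht
  have hTt : volume T ≠ ⊤ := fun h => by simp [ht', Measure.real, h] at ht
  have hV0 : 0 < V := ENNReal.toReal_pos hK.volume_ne_zero hK.volume_ne_top
  have htV : t ≤ V := by
    rw [ht', hT, measureReal_symmPart]
    exact measureReal_mono inter_subset_left hK.volume_ne_top
  have hn1 : (1 : ℝ) ≤ n := by exact_mod_cast hn
  set η : ℝ := 1 / (4 * n) with hη
  have hη0 : 0 < η := by positivity
  have hη1 : η ≤ 1 / 4 := by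
    rw [hη]
    exact one_div_le_one_div_of_le (by norm_num) (by linarith)
  have hηn : n * η = 1 / 4 := by
    rw [hη]
    field_simp
  have hsmulm : ∀ {c : ℝ}, 0 < c → MeasurableSet (c • T) := fun hc =>
    hTm.const_smul_of_ne_zero hc.ne'
  have hsmul0 : ∀ {c : ℝ}, 0 < c → volume (c • T) ≠ 0 := fun hc => by
    rw [Measure.addHaar_smul_of_nonneg _ hc.le]
    exact mul_ne_zero (by simpa using pow_pos hc _) hT0
  have hsmult : ∀ {c : ℝ}, 0 < c → volume (c • T) ≠ ⊤ := fun hc => by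
    rw [Measure.addHaar_smul_of_nonneg _ hc.le]
    finiteness
  have hDc : ∀ (v : EuclideanSpace ℝ (Fin n)) (c : ℝ), IsCompact (v +ᵥ c • K) := fun v c =>
    (hK.2.1.smul c).vadd v
  obtain ⟨F, hFK, hFc, hF⟩ := exists_finset_packing (W := (η / 2) • T) (A := K)
    (D := (-((η / 2) • z)) +ᵥ (1 + η / 2) • K) (hsmulm (by positivity))
    (fun w => neg_mem_smul_symmPart) (hsmul0 (by positivity)) (hDc _ _).measure_lt_top.ne
    fun a ha w hw => add_smul_mem_vadd_smul hK.1 (by positivity) ha hw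
  have hFL : (F.card : ℝ) ≤ Real.exp L := by
    have h1 : (F.card : ℝ) * ((η / 2) ^ n * t) ≤ (1 + η / 2) ^ n * V := by
      rw [← measureReal_smul_of_nonneg T (by positivity),
        ← measureReal_vadd_smul K (-((η / 2) • z)) (by positivity)]
      have := ENNReal.toReal_mono (hDc _ _).measure_lt_top.ne hFc
      simpa [Measure.real] using this
    have h2 : 1 + η / 2 ≤ (16 * n) * (η / 2) := by linarith
    have h3 : (F.card : ℝ) * ((η / 2) ^ n * t) ≤ Real.exp L * ((η / 2) ^ n * t) := by
      calc (F.card : ℝ) * ((η / 2) ^ n * t) ≤ (1 + η / 2) ^ n * V := h1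
        _ ≤ ((16 * n) * (η / 2)) ^ n * V := by gcongr
        _ = (η / 2) ^ n * ((16 * n) ^ n * V) := by rw [mul_pow]; ring
        _ ≤ (η / 2) ^ n * (Real.exp L * t) := by gcongr
        _ = _ := by ring
    exact le_of_mul_le_mul_right h3 (by positivity)
  set s : ℝ := 1 - 2 * η with hs
  have hs0 : 0 < s := by linarith
  have hsn : 1 / 2 ≤ s ^ n := by
    have := one_add_mul_le_pow (a := -(2 * η)) (by linarith) n
    rw [← sub_eq_add_neg] at this
    linarith
  set p := t / (2 ^ (n + 1) * V) with hp
  have hp0 : 0 < p := by positivity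
  have hp1 : p ≤ 1 := by
    rw [hp, div_le_one (by positivity)]
    calc t ≤ V := htV
      _ ≤ 2 ^ (n + 1) * V := le_mul_of_one_le_left hV0.le (one_le_pow₀ one_le_two)
  obtain ⟨l, hl, hcov⟩ := exists_list_cover (S := F) (R := fun x y => y - x ∈ s • T) hp0 hp1
    (fun A hA => by
      obtain ⟨x, hx⟩ := exists_translate_card_ge (Y := A) (W := s • T)
        (D := (-(s • z)) +ᵥ (1 + s) • K) (hsmulm hs0) (hsmult hs0) (hDc _ _).measurableSet
        (by
          rw [measure_vadd, Measure.addHaar_smul_of_nonneg _ (by positivity)]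
          exact mul_ne_zero (by simpa using pow_pos (by positivity) _) hK.volume_ne_zero)
        (hDc _ _).measure_lt_top.ne fun y hy w hw => by
          rw [sub_eq_add_neg]
          exact add_smul_mem_vadd_smul hK.1 hs0.le (hFK (hA hy)) (neg_mem_smul_symmPart hw)
      refine ⟨x, _, Finset.filter_subset (fun y => y - x ∈ s • T) A, ?_,
        fun y hy => (Finset.mem_filter.1 hy).2⟩
      have h1 : (A.card : ℝ) * (s ^ n * t) ≤
          (A.filter fun y => y - x ∈ s • T).card * ((1 + s) ^ n * V) := by
        rw [← measureReal_smul_of_nonneg T (by positivity),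
          ← measureReal_vadd_smul K (-(s • z)) (by positivity)]
        have := ENNReal.toReal_mono
          (ENNReal.mul_ne_top (by simp) (hDc _ _).measure_lt_top.ne) hx
        simpa [Measure.real] using this
      rw [hp, div_mul_eq_mul_div, div_le_iff₀ (by positivity)]
      calc t * A.card = 2 * (A.card * (1 / 2 * t)) := by ring
        _ ≤ 2 * (A.card * (s ^ n * t)) := by gcongr
        _ ≤ 2 * ((A.filter fun y => y - x ∈ s • T).card * ((1 + s) ^ n * V)) := by gcongr
        _ ≤ 2 * ((A.filter fun y => y - x ∈ s • T).card * (2 ^ n * V)) := by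
          gcongr
          linarith
        _ = _ := by ring) hL hFL
  have hη2 : 0 < 1 - η := by linarith
  have h := gCov_le_length (B := K) hα (t := 1 - η) ⟨hη2, by linarith⟩
    (l.map fun x => x - (1 - η) • z) fun a ha => by
      obtain ⟨y, hyF, w, hw, w', hw', hay⟩ := hF a ha
      obtain ⟨x, hx, hyx⟩ := hcov y hyF
      refine ⟨_, List.mem_map_of_mem hx, ?_⟩
      have hmem : a - x ∈ (1 - η) • T := by
        rw [show 1 - η = s + (η / 2 + η / 2) by ring, hTc.add_smul hs0.le (by positivity),
          hTc.add_smul (by positivity) (by positivity),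
          show a - x = (y - x) + (w + w') by rw [← hay]; abel]
        exact add_mem_add hyx (add_mem_add hw hw')
      obtain ⟨u, hu, hua⟩ := hmem
      refine ⟨(1 - η) • (z + u), ⟨_, hu.1, rfl⟩, ?_⟩
      simp only [vadd_eq_add]
      rw [← sub_add_cancel a x, ← hua]
      module
  rw [List.length_map] at h
  refine h.trans (hl.trans (le_of_eq ?_))
  rw [hp, div_div_eq_mul_div, mul_div_assoc]

end Reflection

/-- There exist universal constants `c₁, c₂ > 0` such that for every `d ≥ 1`, every convex
body `B ⊆ ℝ^d`, and every `α ≥ 0`, `g_α(B) ≤ c₁ · 4^d · e^{-c₂ √d}`. -/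
theorem gCov_upper_bound :
    ∃ c1 c2 : ℝ, 0 < c1 ∧ 0 < c2 ∧
      ∀ (d : ℕ), 1 ≤ d → ∀ B : Set (EuclideanSpace ℝ (Fin d)), IsConvexBody B →
        ∀ α : ℝ, 0 ≤ α →
          gCov α B ≤ c1 * 4 ^ d * Real.exp (-c2 * Real.sqrt d) := by
  obtain ⟨c, C, hc, hC, h⟩ := exists_reflection_inter_volume_ge
  set M := 2 * C * (C + 32 * (24 * (2 / c) ^ 4)) with hM
  refine ⟨M + 1, min (c / 2) 1, by positivity, by positivity, fun d hd B hB α hα => ?_⟩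
  obtain ⟨z, hz⟩ := h d B hB
  rw [← measureReal_symmPart] at hz
  set V := volume.real B with hV
  set t := volume.real (symmPart B z) with ht
  set x := √(d : ℝ) with hx
  have hx0 : 0 ≤ x := Real.sqrt_nonneg _
  have hd1 : (1 : ℝ) ≤ d := by exact_mod_cast hd
  have hxd : x ^ 2 = d := Real.sq_sqrt (by positivity)
  have hV0 : 0 < V := ENNReal.toReal_pos hB.volume_ne_zero hB.volume_ne_top
  have ht0 : 0 < t := by
    have : 0 < C * 2 ^ d * t := lt_of_lt_of_le (by positivity) hz
    exact pos_of_mul_pos_right this (by positivity)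
  have hVt : V / t ≤ C * 2 ^ d * Real.exp (-(c * x)) := by
    rw [Real.exp_neg, div_le_iff₀ ht0, ← div_eq_mul_inv, div_mul_eq_mul_div,
      le_div_iff₀ (Real.exp_pos _)]
    linarith
  have hcx : Real.exp (-(c * x)) ≤ 1 := Real.exp_le_one_iff.2 (by nlinarith)
  have hL : (16 * d) ^ d * V ≤ Real.exp (C + 32 * (d : ℝ) ^ 2) * t := by
    rw [← div_le_iff₀ ht0, mul_div_assoc]
    calc (16 * d : ℝ) ^ d * (V / t) ≤ (16 * d : ℝ) ^ d * (C * 2 ^ d * 1) := by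
          gcongr
          exact hVt.trans (by gcongr)
      _ = C * (32 * d : ℝ) ^ d := by
          rw [show (32 * d : ℝ) = (16 * d) * 2 by ring, mul_pow (16 * d : ℝ)]
          ring
      _ ≤ Real.exp C * Real.exp (32 * d) ^ d := by
          gcongr
          · linarith [Real.add_one_le_exp C]
          · linarith [Real.add_one_le_exp (32 * d : ℝ)]
      _ = _ := by
          rw [← Real.exp_nat_mul, ← Real.exp_add]
          ring_nf
  have hpow : x ^ 4 ≤ 24 * (2 / c) ^ 4 * Real.exp (c / 2 * x) := by
    have := Real.pow_div_factorial_le_exp (c / 2 * x) (by positivity) 4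
    rw [show ((Nat.factorial 4 : ℕ) : ℝ) = 24 by norm_num [Nat.factorial],
      div_le_iff₀ (by norm_num)] at this
    calc x ^ 4 = (2 / c) ^ 4 * (c / 2 * x) ^ 4 := by
          field_simp
      _ ≤ (2 / c) ^ 4 * (Real.exp (c / 2 * x) * 24) := by gcongr
      _ = _ := by ring
  have hexp1 : 1 ≤ Real.exp (c / 2 * x) := Real.one_le_exp (by positivity)
  have hmain : (C + 32 * (d : ℝ) ^ 2) * (2 * C * Real.exp (-(c * x))) ≤
      M * Real.exp (-min (c / 2) 1 * x) := by
    calc (C + 32 * (d : ℝ) ^ 2) * (2 * C * Real.exp (-(c * x)))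
        ≤ (C * Real.exp (c / 2 * x) + 32 * (24 * (2 / c) ^ 4 * Real.exp (c / 2 * x))) *
          (2 * C * Real.exp (-(c * x))) := by
          rw [← hxd, ← pow_mul]
          gcongr
          exact le_mul_of_one_le_right hC.le hexp1
      _ = M * (Real.exp (c / 2 * x) * Real.exp (-(c * x))) := by rw [hM]; ring
      _ = M * Real.exp (-(c / 2) * x) := by rw [← Real.exp_add]; ring_nf
      _ ≤ _ := by
          gcongr
          exact min_le_left _ _
  have hone : 1 ≤ 4 ^ d * Real.exp (-min (c / 2) 1 * x) := by
    have h1 : x ≤ d := by nlinarith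
    have h2 : Real.exp (min (c / 2) 1 * x) ≤ 4 ^ d := by
      calc Real.exp (min (c / 2) 1 * x) ≤ Real.exp (d * 1) := by
            rw [mul_comm]
            gcongr
            exact min_le_right _ _
        _ = Real.exp 1 ^ d := Real.exp_nat_mul _ _
        _ ≤ 4 ^ d := by
            gcongr
            linarith [Real.exp_one_lt_d9]
    rw [neg_mul, Real.exp_neg, ← div_eq_mul_inv, le_div_iff₀ (Real.exp_pos _), one_mul]
    exact h2
  calc gCov α B ≤ (C + 32 * (d : ℝ) ^ 2) * (2 ^ (d + 1) * V / t) + 1 :=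
        gCov_le_of_measureReal_symmPart hd hB ht0 (by positivity) hL hα
    _ ≤ (C + 32 * (d : ℝ) ^ 2) * (2 ^ (d + 1) * (C * 2 ^ d * Real.exp (-(c * x)))) + 1 := by
        rw [mul_div_assoc]
        gcongr
    _ = 4 ^ d * ((C + 32 * (d : ℝ) ^ 2) * (2 * C * Real.exp (-(c * x)))) + 1 := by
        rw [show (4 : ℝ) ^ d = 2 ^ d * 2 ^ d by rw [← mul_pow]; norm_num]
        ring
    _ ≤ 4 ^ d * (M * Real.exp (-min (c / 2) 1 * x)) +
        4 ^ d * Real.exp (-min (c / 2) 1 * x) := by gcongr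
    _ = _ := by ring
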